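/- arXiv:2411.06610 — 2 statements merged into one kernel-verified Lean document; each statement's English description precedes it below -/
import Mathlib

section
/- Let f be a fake μ defined via the sequence (ε_j), and suppose there is an integer k ≥ 1 with ε_j = 0 for 1 ≤ j ≤ k−1 and ε_k = −1 (so f is of Möbius-type with initial index k). Then there exist real constants c_j for k+1 ≤ j ≤ 2k, with c_j = 0 whenever ε_j ≠ 1, such that F_f(x) − Σ_{j=k+1}^{2k} c_j x^{1/j} = Ω_±(x^{1/(2k)}). -/
/-- `OmegaPM E g` means `E(x) = Ω_±(g(x))`: there are positive constants `c`
such that `E(x) ≥ c g(x)` for arbitrarily large `x` and `E(x) ≤ -c g(x)` for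
arbitrarily large `x` (equivalently `limsup E/g > 0` and `liminf E/g < 0`). -/
def OmegaPM (E g : ℝ → ℝ) : Prop :=
  (∃ c : ℝ, 0 < c ∧ ∀ x₀ : ℝ, ∃ x : ℝ, x₀ ≤ x ∧ c * g x ≤ E x) ∧
  (∃ c : ℝ, 0 < c ∧ ∀ x₀ : ℝ, ∃ x : ℝ, x₀ ≤ x ∧ E x ≤ -(c * g x))

section

open Complex Filter Topology Set

lemma norm_inv_Gamma_strip_le : ∃ C : ℝ, 0 < C ∧ ∀ w : ℂ, 1 ≤ w.re → w.re ≤ 2 →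
    ‖(Gamma w)⁻¹‖ ≤ C * Real.exp (Real.pi * |w.im|) := by
  have hcomp : IsCompact (uIcc (1:ℝ) 2 ×ℂ uIcc (-1:ℝ) 1) := isCompact_uIcc.reProdIm isCompact_uIcc
  obtain ⟨C₁, hC₁⟩ := hcomp.exists_bound_of_continuousOn
    (f := fun w : ℂ => (Gamma w)⁻¹) differentiable_one_div_Gamma.continuous.continuousOn
  have hcomp2 : IsCompact (Icc (1:ℝ) 2) := isCompact_Icc
  obtain ⟨C₂, hC₂⟩ := hcomp2.exists_bound_of_continuousOn (f := fun x : ℝ => Real.Gamma x)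
    (fun x hx => (Real.differentiableAt_Gamma (fun m => by
      have := hx.1
      have : (0:ℝ) ≤ m := m.cast_nonneg
      intro h; linarith)).continuousAt.continuousWithinAt)
  refine ⟨|C₁| + |C₂| + 1, by positivity, fun w h1 h2 => ?_⟩
  have hexp : 1 ≤ Real.exp (Real.pi * |w.im|) := Real.one_le_exp (by positivity)
  by_cases him : |w.im| ≤ 1
  · have := hC₁ w (by
      rw [mem_reProdIm, uIcc_of_le (by norm_num), uIcc_of_le (by norm_num)]
      exact ⟨⟨h1, h2⟩, abs_le.mp him⟩)
    calc ‖(Gamma w)⁻¹‖ ≤ C₁ := this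
      _ ≤ (|C₁| + |C₂| + 1) * 1 := by linarith [le_abs_self C₁, abs_nonneg C₂]
      _ ≤ _ := by gcongr
  · push Not at him
    have hsin : ‖sin (Real.pi * w)‖ ≤ Real.exp (Real.pi * |w.im|) := by
      rw [Complex.sin]
      have e1 : ‖cexp (-(Real.pi * w) * I)‖ ≤ Real.exp (Real.pi * |w.im|) := by
        rw [norm_exp]
        apply Real.exp_le_exp.mpr
        simp
        gcongr
        exact le_abs_self _
      have e2 : ‖cexp ((Real.pi * w) * I)‖ ≤ Real.exp (Real.pi * |w.im|) := by
        rw [norm_exp]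
        apply Real.exp_le_exp.mpr
        simp
        rw [← mul_neg]
        gcongr
        exact neg_le_abs _
      rw [norm_div, norm_mul, norm_I, mul_one, Complex.norm_ofNat]
      have := norm_sub_le (cexp (-(Real.pi * w) * I)) (cexp ((Real.pi * w) * I))
      linarith
    have hw1 : 1 - w ≠ 0 := by
      intro h
      have : w.im = 0 := by simpa using congrArg im h
      rw [this] at him; norm_num at him
    have hw2 : 2 - w ≠ 0 := by
      intro h
      have : w.im = 0 := by simpa using congrArg im h
      rw [this] at him; norm_num at him
    have hsn : sin (Real.pi * w) ≠ 0 := by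
      rw [Complex.sin_ne_zero_iff]
      intro n h
      have : w.im = 0 := by
        have := congrArg im h
        simpa [Real.pi_ne_zero] using this
      rw [this] at him; norm_num at him
    have hrefl := Complex.Gamma_mul_Gamma_one_sub w
    have hG : Gamma (3 - w) = (2 - w) * ((1 - w) * Gamma (1 - w)) := by
      rw [← Complex.Gamma_add_one _ hw1, show 1 - w + 1 = 2 - w by ring,
        ← Complex.Gamma_add_one _ hw2]
      congr 1; ring
    have hΓ : Gamma w ≠ 0 := Gamma_ne_zero_of_re_pos (by linarith)
    have key : (Gamma w)⁻¹ = Gamma (3 - w) * sin (Real.pi * w) /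
        (Real.pi * ((2 - w) * (1 - w))) := by
      rw [hG]
      have hpi : (Real.pi : ℂ) ≠ 0 := by exact_mod_cast Real.pi_ne_zero
      rw [eq_div_iff hsn] at hrefl
      field_simp
      rw [mul_comm w]
      linear_combination -hrefl
    have hn1 : 1 ≤ ‖1 - w‖ := by
      have := abs_im_le_norm (1 - w)
      simp at this; linarith
    have hn2 : 1 ≤ ‖2 - w‖ := by
      have := abs_im_le_norm (2 - w)
      simp at this; linarith
    have hg3 : ‖Gamma (3 - w)‖ ≤ |C₂| := by
      have hpos : 0 < (3 - w).re := by simp; linarith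
      have h3 : ‖Gamma (3 - w)‖ ≤ Real.Gamma (3 - w).re := by
        rw [Complex.Gamma_eq_integral hpos, Real.Gamma_eq_integral hpos, Complex.GammaIntegral]
        refine (MeasureTheory.norm_integral_le_integral_norm _).trans (le_of_eq ?_)
        refine MeasureTheory.setIntegral_congr_fun measurableSet_Ioi fun x hx => ?_
        have hx : 0 < x := hx
        rw [norm_mul, norm_cpow_eq_rpow_re_of_pos hx, Complex.norm_real,
          Real.norm_of_nonneg (Real.exp_pos _).le]
        simp
      have := hC₂ (3 - w).re (by simp; constructor <;> linarith)
      exact h3.trans ((le_abs_self _).trans (this.trans (le_abs_self _)))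
    rw [key, norm_div, norm_mul, norm_mul, norm_mul, Complex.norm_real,
      Real.norm_of_nonneg Real.pi_pos.le]
    have hden : 1 ≤ Real.pi * (‖2 - w‖ * ‖1 - w‖) := by
      have := Real.pi_gt_three
      have : 1 ≤ ‖2 - w‖ * ‖1 - w‖ := one_le_mul_of_one_le_of_one_le hn2 hn1
      nlinarith
    calc _ ≤ ‖Gamma (3 - w)‖ * ‖sin (Real.pi * w)‖ := div_le_self (by positivity) hden
      _ ≤ (|C₁| + |C₂| + 1) * Real.exp (Real.pi * |w.im|) := by
        gcongr
        linarith [abs_nonneg C₁]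

lemma norm_inv_Gamma_add_nat_le : ∃ C : ℝ, 0 < C ∧ ∀ (m : ℕ) (w : ℂ), 1 ≤ w.re → w.re ≤ 2 →
    ‖(Gamma (w + m))⁻¹‖ ≤ C * Real.exp (Real.pi * |w.im|) / (max 1 |w.im|) ^ m := by
  obtain ⟨C, hC, h⟩ := norm_inv_Gamma_strip_le
  refine ⟨C, hC, fun m w h1 h2 => ?_⟩
  induction m with
  | zero => simpa using h w h1 h2
  | succ m ih =>
    have hre : 1 ≤ (w + m).re := by
      simp
      have : (0:ℝ) ≤ m := m.cast_nonneg
      linarith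
    have hne : w + m ≠ 0 := by
      intro h0; rw [h0] at hre; simp at hre; linarith
    have hnorm : max 1 |w.im| ≤ ‖w + m‖ := by
      refine max_le (hre.trans (re_le_norm _)) ?_
      simpa using abs_im_le_norm (w + m)
    have hmax : 0 < max 1 |w.im| := lt_of_lt_of_le one_pos (le_max_left _ _)
    push_cast
    rw [← add_assoc, Complex.Gamma_add_one _ hne, mul_inv, norm_mul, norm_inv ]
    calc ‖w + m‖⁻¹ * ‖(Gamma (w + m))⁻¹‖
        ≤ (max 1 |w.im|)⁻¹ * (C * Real.exp (Real.pi * |w.im|) / (max 1 |w.im|) ^ m) := by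
          gcongr
      _ = _ := by rw [pow_succ]; field_simp

lemma norm_inv_mul_Gammaℝ_le : ∃ C : ℝ, 0 < C ∧ ∀ (m : ℕ) (s : ℂ), (m : ℝ) ≤ s.re / 2 →
    s.re / 2 ≤ m + 1 →
    ‖(s * Gammaℝ s)⁻¹‖ ≤ Real.exp (C * (1 + ‖s‖)) / (max 1 |s.im / 2|) ^ m := by
  obtain ⟨C, hC, h⟩ := norm_inv_Gamma_add_nat_le
  refine ⟨C + 2 * Real.pi, by positivity, fun m s h1 h2 => ?_⟩
  have hmax : 0 < max 1 |s.im / 2| := lt_of_lt_of_le one_pos (le_max_left _ _)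
  by_cases hs : s = 0
  · subst hs; simp; positivity
  have hs2 : s / 2 ≠ 0 := div_ne_zero hs two_ne_zero
  have hg := h m (s / 2 + 1 - m) (by simp; linarith) (by simp; linarith)
  have hG : Gamma (s / 2 + 1 - m + m) = s / 2 * Gamma (s / 2) := by
    rw [sub_add_cancel, Complex.Gamma_add_one _ hs2]
  rw [hG] at hg
  have him : (s / 2 + 1 - m).im = s.im / 2 := by simp
  rw [him] at hg
  have hpi : (Real.pi : ℂ) ≠ 0 := by exact_mod_cast Real.pi_ne_zero
  have e : (s * Gammaℝ s)⁻¹ = (Real.pi : ℂ) ^ (s / 2) / 2 * (s / 2 * Gamma (s / 2))⁻¹ := by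
    rw [Gammaℝ_def, neg_div, cpow_neg]
    have : (Real.pi : ℂ) ^ (s / 2) ≠ 0 := by simp [cpow_eq_zero_iff, hpi]
    rw [mul_inv, mul_inv, mul_inv, inv_inv, div_eq_mul_inv s 2, mul_inv, inv_inv]
    ring
  rw [e, norm_mul, norm_div, Complex.norm_ofNat,
    Complex.norm_cpow_eq_rpow_re_of_pos Real.pi_pos]
  have him2 : |s.im / 2| ≤ ‖s‖ / 2 := by
    rw [abs_div, abs_two]
    gcongr
    exact abs_im_le_norm s
  have hre2 : (s / 2).re ≤ ‖s‖ / 2 := by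
    simp
    gcongr
    exact re_le_norm s
  have hpe : Real.pi ^ (s / 2).re ≤ Real.exp (Real.pi * (‖s‖ / 2)) := by
    have h3 := Real.pi_gt_three
    calc Real.pi ^ (s / 2).re ≤ Real.pi ^ (‖s‖ / 2) :=
          Real.rpow_le_rpow_of_exponent_le (by linarith) hre2
      _ = Real.exp (Real.log Real.pi * (‖s‖ / 2)) := Real.rpow_def_of_pos Real.pi_pos _
      _ ≤ _ := by
        gcongr
        exact (Real.log_le_sub_one_of_pos Real.pi_pos).trans (by linarith)
  have hCe : C ≤ Real.exp C := by linarith [Real.add_one_le_exp C]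
  refine (mul_le_mul_of_nonneg_left hg (by positivity)).trans ?_
  rw [← mul_div_assoc]
  gcongr
  calc Real.pi ^ (s / 2).re / 2 * (C * Real.exp (Real.pi * |s.im / 2|))
      ≤ Real.exp (Real.pi * (‖s‖ / 2)) * (Real.exp C * Real.exp (Real.pi * (‖s‖ / 2))) := by
        gcongr
        have : 0 ≤ Real.pi ^ (s / 2).re := Real.rpow_nonneg Real.pi_pos.le _
        linarith
    _ = Real.exp (C + Real.pi * ‖s‖) := by rw [← Real.exp_add, ← Real.exp_add]; ring_nf
    _ ≤ _ := by
      gcongr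
      have := norm_nonneg s
      have := Real.pi_pos
      nlinarith [mul_nonneg hC.le (norm_nonneg s), mul_nonneg Real.pi_pos.le (norm_nonneg s)]

lemma exists_entire_quotient {f g : ℂ → ℂ} (hf : Differentiable ℂ f) (hg : Differentiable ℂ g)
    (hg0 : ∃ s, g s ≠ 0)
    (h : ∀ s₀ : ℂ, ∀ δ > 0, ∃ᶠ s in 𝓝[≠] s₀, ‖f s * (s - s₀)‖ ≤ δ * ‖g s‖) :
    ∃ q : ℂ → ℂ, Differentiable ℂ q ∧ ∀ s, q s * g s = f s := by
  have hfa : AnalyticOnNhd ℂ f univ := fun z _ => hf.analyticAt z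
  have hga : AnalyticOnNhd ℂ g univ := fun z _ => hg.analyticAt z
  have hgne : ∀ s₀, ∀ᶠ s in 𝓝[≠] s₀, g s ≠ 0 := by
    intro s₀
    rcases (hga s₀ trivial).eventually_eq_zero_or_eventually_ne_zero with h0 | h0
    · obtain ⟨s, hs⟩ := hg0
      have := hga.eqOn_zero_of_preconnected_of_eventuallyEq_zero isPreconnected_univ
        (mem_univ s₀) h0
      exact absurd (this (mem_univ s)) hs
    · exact h0
  have hm : MeromorphicOn (fun s => f s / g s) univ := fun z _ =>
    (hfa z trivial).meromorphicAt.div (hga z trivial).meromorphicAt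
  set q := toMeromorphicNFOn (fun s => f s / g s) univ with hq
  have hord : ∀ s₀, 0 ≤ meromorphicOrderAt (fun s => f s / g s) s₀ := by
    intro s₀
    by_contra hneg
    push Not at hneg
    have hms := hm s₀ trivial
    have hlin : AnalyticAt ℂ (fun s : ℂ => s - s₀) s₀ := by fun_prop
    have hprod : MeromorphicAt (fun s => f s / g s * (s - s₀)) s₀ := hms.mul hlin.meromorphicAt
    have hone : meromorphicOrderAt (fun s : ℂ => s - s₀) s₀ = 1 := by
      rw [show (1 : WithTop ℤ) = ((1 : ℤ) : WithTop ℤ) by rfl,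
        meromorphicOrderAt_eq_int_iff hlin.meromorphicAt]
      exact ⟨fun _ => 1, analyticAt_const, one_ne_zero, by simp⟩
    have hple : meromorphicOrderAt (fun s => f s / g s * (s - s₀)) s₀ ≤ 0 := by
      have := meromorphicOrderAt_mul hms hlin.meromorphicAt
      have e : (fun s => f s / g s) * (fun s => s - s₀) = fun s => f s / g s * (s - s₀) := rfl
      rw [e] at this
      rw [this, hone]
      cases hn : meromorphicOrderAt (fun s => f s / g s) s₀ with
      | top => rw [hn] at hneg; simp at hneg
      | coe n =>
        rw [hn] at hneg
        have : n < 0 := by exact_mod_cast hneg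
        have h2 : n + 1 ≤ 0 := by omega
        exact_mod_cast h2
    have hbig : ∃ δ > 0, ∀ᶠ s in 𝓝[≠] s₀, δ < ‖f s / g s * (s - s₀)‖ := by
      rcases hple.lt_or_eq with hlt | heq
      · have := tendsto_cobounded_of_meromorphicOrderAt_neg hlt
        rw [← tendsto_norm_atTop_iff_cobounded] at this
        exact ⟨1, one_pos, this.eventually_gt_atTop 1⟩
      · obtain ⟨c, hc, hcl⟩ := tendsto_ne_zero_of_meromorphicOrderAt_eq_zero hprod heq
        refine ⟨‖c‖ / 2, by positivity, hcl.norm.eventually (lt_mem_nhds ?_)⟩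
        have : 0 < ‖c‖ := norm_pos_iff.mpr hc
        linarith
    obtain ⟨δ, hδ, hev⟩ := hbig
    obtain ⟨s, hs1, hs2, hs3⟩ := ((h s₀ δ hδ).and_eventually (hev.and (hgne s₀))).exists
    have hgpos : 0 < ‖g s‖ := norm_pos_iff.mpr hs3
    rw [div_mul_eq_mul_div, norm_div, lt_div_iff₀ hgpos] at hs2
    linarith
  have hqa : ∀ s, AnalyticAt ℂ q s := fun s =>
    (meromorphicNFOn_toMeromorphicNFOn _ _ (mem_univ s)).meromorphicOrderAt_nonneg_iff_analyticAt.1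
      (by rw [meromorphicOrderAt_toMeromorphicNFOn hm trivial]; exact hord s)
  refine ⟨q, fun s => (hqa s).differentiableAt, fun s => ?_⟩
  have hev : ∀ᶠ w in 𝓝[≠] s, q w * g w = f w := by
    filter_upwards [hm.toMeromorphicNFOn_eq_self_on_nhdsNE (mem_univ s), hgne s] with w hw hgw
    rw [hq, hw]; field_simp
  have h1 : Tendsto (fun w => q w * g w) (𝓝[≠] s) (𝓝 (q s * g s)) :=
    (((hqa s).continuousAt).mul hg.continuous.continuousAt).tendsto.mono_left nhdsWithin_le_nhds
  have h2 : Tendsto f (𝓝[≠] s) (𝓝 (f s)) :=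
    hf.continuous.continuousAt.tendsto.mono_left nhdsWithin_le_nhds
  exact tendsto_nhds_unique (h1.congr' hev) h2

lemma norm_le_exp_of_norm_le_off_line {q : ℂ → ℂ} (hq : Differentiable ℂ q) {C : ℝ} (hC : 0 ≤ C)
    (h : ∀ s : ℂ, s.re ≠ 1 / 2 →
      ‖q s‖ ≤ Real.exp (C * (1 + ‖s‖)) * (1 + 1 / |s.re - 1 / 2|)) :
    ∀ s : ℂ, ‖q s‖ ≤ 4 * Real.exp (C * (3 + ‖s‖)) := by
  intro s
  by_cases hs : 1 / 2 ≤ |s.re - 1 / 2|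
  · have hne : s.re ≠ 1 / 2 := by
      intro h0; rw [h0] at hs; norm_num at hs
    refine (h s hne).trans ?_
    rw [mul_comm]
    gcongr
    · have : 1 / |s.re - 1 / 2| ≤ 1 / (1 / 2) := one_div_le_one_div_of_le (by norm_num) hs
      norm_num at this ⊢; linarith
    · norm_num
  · push Not at hs
    set c : ℂ := ⟨1 / 2, s.im⟩ with hc
    have hsc : s - c = ((s.re - 1 / 2 : ℝ) : ℂ) := by apply Complex.ext <;> simp [hc]
    have hmem : s ∈ closure (Metric.ball c 1) := by
      rw [closure_ball _ one_ne_zero, Metric.mem_closedBall, dist_eq_norm, hsc, Complex.norm_real,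
        Real.norm_eq_abs]
      linarith
    have hmax := Complex.norm_le_of_forall_mem_frontier_norm_le (U := Metric.ball c 1)
      (f := fun w => q w * ((w - c) ^ 2 + 1)) Metric.isBounded_ball
      (Differentiable.diffContOnCl (by fun_prop)) (C := 4 * Real.exp (C * (3 + ‖s‖))) ?_ hmem
    · refine le_trans ?_ hmax
      rw [norm_mul]
      apply le_mul_of_one_le_right (norm_nonneg _)
      rw [hsc]
      rw [show (((s.re - 1 / 2 : ℝ) : ℂ)) ^ 2 + 1 = (((s.re - 1 / 2) ^ 2 + 1 : ℝ) : ℂ) by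
          push_cast; ring,
        Complex.norm_real, Real.norm_of_nonneg (by positivity)]
      nlinarith [sq_nonneg (s.re - 1 / 2)]
    · intro w hw
      rw [frontier_ball _ one_ne_zero, mem_sphere_iff_norm] at hw
      have hfac : ‖(w - c) ^ 2 + 1‖ = 2 * |w.re - 1 / 2| := by
        have h1 : (w - c) * (starRingEnd ℂ) (w - c) = 1 := by
          rw [Complex.mul_conj, Complex.normSq_eq_norm_sq, hw]; simp
        have h2 : (w - c) ^ 2 + 1 = (w - c) * ((2 * (w.re - 1 / 2) : ℝ) : ℂ) := by
          have h3 : (w - c) + (starRingEnd ℂ) (w - c) = ((2 * (w.re - 1 / 2) : ℝ) : ℂ) := by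
            rw [Complex.add_conj]; simp [hc]
          rw [← h3, mul_add, h1]; ring
        rw [h2, norm_mul, hw, Complex.norm_real, Real.norm_eq_abs, abs_mul, abs_two, one_mul]
      rw [norm_mul, hfac]
      by_cases hw0 : w.re = 1 / 2
      · rw [hw0]; simp; positivity
      · have hpos : 0 < |w.re - 1 / 2| := abs_pos.mpr (sub_ne_zero.mpr hw0)
        have hle1 : |w.re - 1 / 2| ≤ 1 := by
          have := abs_re_le_norm (w - c)
          rw [hw] at this
          simpa [hc] using this
        have hwn : ‖w‖ ≤ ‖s‖ + 2 := by
          have h1 : ‖w - s‖ ≤ ‖w - c‖ + ‖s - c‖ := by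
            rw [show w - s = (w - c) - (s - c) by ring]; exact norm_sub_le _ _
          have h2 : ‖s - c‖ ≤ 1 := by rw [hsc, Complex.norm_real, Real.norm_eq_abs]; linarith
          have h3 := norm_sub_norm_le w s
          linarith
        calc ‖q w‖ * (2 * |w.re - 1 / 2|)
            ≤ (Real.exp (C * (1 + ‖w‖)) * (1 + 1 / |w.re - 1 / 2|)) * (2 * |w.re - 1 / 2|) := by
              gcongr; exact h w hw0
          _ = Real.exp (C * (1 + ‖w‖)) * (2 * |w.re - 1 / 2| + 2) := by
              generalize |w.re - 1 / 2| = a at hpos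
              field_simp
          _ ≤ Real.exp (C * (3 + ‖s‖)) * 4 := by
              refine mul_le_mul (Real.exp_le_exp.mpr (mul_le_mul_of_nonneg_left (by linarith) hC))
                (by linarith) (by positivity) (by positivity)
          _ = _ := by ring

noncomputable def riemannXi₁ (s : ℂ) : ℂ := s * (s - 1) * completedRiemannZeta₀ s + 1

lemma differentiable_riemannXi₁ : Differentiable ℂ riemannXi₁ := by
  unfold riemannXi₁
  exact (by fun_prop : Differentiable ℂ fun s : ℂ => s * (s - 1)).mul
    differentiable_completedZeta₀ |>.add_const _

lemma riemannXi₁_one_sub (s : ℂ) : riemannXi₁ (1 - s) = riemannXi₁ s := by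
  simp only [riemannXi₁, completedRiemannZeta₀_one_sub]; ring

lemma riemannZeta₁_mul_Gammaℝ {s : ℂ} (hs : 0 < s.re) :
    riemannZeta₁ s * (s * Gammaℝ s) = riemannXi₁ s := by
  by_cases h1 : s = 1
  · subst h1; simp [riemannXi₁, Gammaℝ_one]
  have hs0 : s ≠ 0 := by rintro rfl; simp at hs
  have hG := Gammaℝ_ne_zero_of_re_pos hs
  have e1 : riemannZeta₁ s = (s - 1) * riemannZeta s := by
    rw [riemannZeta_eq_inv_sub_mul h1]
    have : s - 1 ≠ 0 := sub_ne_zero.mpr h1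
    field_simp
  have h1' : 1 - s ≠ 0 := sub_ne_zero.mpr (Ne.symm h1)
  rw [e1, riemannZeta_def_of_ne_zero hs0, completedRiemannZeta_eq, riemannXi₁]
  field_simp
  ring

lemma riemannZeta₁_ne_zero_of_one_le_re {s : ℂ} (hs : 1 ≤ s.re) : riemannZeta₁ s ≠ 0 := by
  by_cases h1 : s = 1
  · subst h1; simp
  · intro h
    have := riemannZeta_eq_inv_sub_mul h1
    rw [h, mul_zero] at this
    exact riemannZeta_ne_zero_of_one_le_re hs this

lemma superpolynomialDecay_exp_of_le {u : ℝ → ℝ} {A a : ℝ} (ha : 0 < a) (hu : ∀ r, 0 ≤ u r)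
    (h : ∀ᶠ r in atTop, u r ≤ Real.exp (A * (1 + r)) / (a * r) ^ ⌊a * r⌋₊) :
    Asymptotics.SuperpolynomialDecay atTop Real.exp u := by
  intro n
  set b : ℝ := (A + n + 1) / a with hb
  refine squeeze_zero' (Eventually.of_forall fun r => mul_nonneg (by positivity) (hu r))
    (g := fun r => Real.exp (A + |b|) * Real.exp (-r)) ?_ ?_
  · filter_upwards [h, eventually_ge_atTop (Real.exp |b| / a), eventually_ge_atTop 0]
      with r hr hr2 hr0
    have har : Real.exp |b| ≤ a * r := by
      rwa [div_le_iff₀ ha, mul_comm] at hr2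
    have hpow : Real.exp (|b| * (a * r) - |b|) ≤ (a * r) ^ ⌊a * r⌋₊ := by
      calc Real.exp (|b| * (a * r) - |b|) ≤ Real.exp (⌊a * r⌋₊ * |b|) := by
            gcongr
            have := (Nat.lt_floor_add_one (a * r)).le
            nlinarith [abs_nonneg b]
        _ = Real.exp |b| ^ ⌊a * r⌋₊ := Real.exp_nat_mul _ _
        _ ≤ _ := by gcongr
    calc Real.exp r ^ n * u r
        ≤ Real.exp (n * r) * (Real.exp (A * (1 + r)) / Real.exp (|b| * (a * r) - |b|)) := by
          rw [Real.exp_nat_mul]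
          gcongr
          refine hr.trans ?_
          gcongr
      _ = Real.exp (n * r + (A * (1 + r)) - (|b| * (a * r) - |b|)) := by
          rw [← Real.exp_sub, ← Real.exp_add]; ring_nf
      _ ≤ Real.exp (A + |b| + -r) := by
          gcongr
          have hba : b * a = A + n + 1 := by rw [hb]; field_simp
          have : b * (a * r) ≤ |b| * (a * r) := by
            gcongr
            exact le_abs_self b
          have e : b * (a * r) = (A + n + 1) * r := by rw [← mul_assoc, hba]
          linarith
      _ = _ := by rw [Real.exp_add]
  · simpa using (Real.tendsto_exp_neg_atTop_nhds_zero).const_mul (Real.exp (A + |b|))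

lemma eq_of_mul_eq_mul_of_preconnected {U : Set ℂ} (hU : IsOpen U) (hUc : IsPreconnected U)
    {f g h : ℂ → ℂ} (hf : DifferentiableOn ℂ f U) (hg : DifferentiableOn ℂ g U)
    (hh : DifferentiableOn ℂ h U) {z : ℂ} (hz : z ∈ U) (hfz : f z ≠ 0)
    (heq : ∀ s ∈ U, f s * g s = f s * h s) : ∀ s ∈ U, g s = h s := by
  have := (hf.analyticOnNhd hU).eq_zero_or_eq_zero_of_mul_eq_zero
    ((hg.sub hh).analyticOnNhd hU) (fun s hs => by simp [mul_sub, heq s hs]) hUc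
  rcases this with h0 | h0
  · exact absurd (h0 z hz) hfz
  · intro s hs
    simpa [sub_eq_zero] using h0 s hs

theorem riemannZeta₁_cofactor_false {L T : ℂ → ℂ} (hL : Differentiable ℂ L) {C : ℝ} (hC : 0 ≤ C)
    (hLb : ∀ s, ‖L s‖ ≤ Real.exp (C * (1 + ‖s‖))) (hL0 : ∀ᶠ σ : ℝ in atTop, L σ ≠ 0)
    (hT : DifferentiableOn ℂ T {s | 1 / 2 < s.re})
    (hTb : ∀ s : ℂ, 1 / 2 < s.re →
      ‖T s‖ ≤ Real.exp (C * (1 + ‖s‖)) * (1 + 1 / (s.re - 1 / 2)))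
    (hZT : ∀ s : ℂ, 1 / 2 < s.re → riemannZeta₁ s * T s = L s)
    (hlim : ∀ t : ℝ, Tendsto (fun σ : ℝ => ((σ - 1 / 2 : ℝ) : ℂ) * T (σ + t * I))
      (𝓝[>] (1 / 2)) (𝓝 0)) : False := by
  obtain ⟨C₁, hC₁, hΓ⟩ := norm_inv_mul_Gammaℝ_le
  set H : Set ℂ := {s | 1 / 2 < s.re} with hH
  have hHo : IsOpen H := isOpen_lt continuous_const continuous_re
  have hHc : IsPreconnected H := (convex_halfSpace_re_gt (1 / 2)).isPreconnected
  set G : ℂ → ℂ := fun s => (s * Gammaℝ s)⁻¹ with hG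
  have hGd : DifferentiableOn ℂ G {s | 0 < s.re} := by
    have : DifferentiableOn ℂ (fun s : ℂ => s⁻¹ * (Gammaℝ s)⁻¹) {s | 0 < s.re} := by
      refine DifferentiableOn.mul ?_ differentiable_Gammaℝ_inv.differentiableOn
      exact differentiableOn_inv.mono fun s hs => by rintro rfl; simp at hs
    exact this.congr fun s _ => by simp [hG, mul_comm]
  have hL1 : Differentiable ℂ fun s => L (1 - s) := hL.comp (by fun_prop)
  set B : ℂ → ℂ := fun s => T s * L (1 - s) * G s with hB
  have hBd : DifferentiableOn ℂ B H :=
    (hT.mul hL1.differentiableOn).mul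
      (hGd.mono fun s hs => lt_trans (by norm_num) (show 1 / 2 < s.re from hs))
  have hXB : ∀ s ∈ H, L s * L (1 - s) = riemannXi₁ s * B s := by
    intro s hs
    have hs0 : 0 < s.re := lt_trans (by norm_num) (show 1 / 2 < s.re from hs)
    have hne : s * Gammaℝ s ≠ 0 :=
      mul_ne_zero (by rintro rfl; simp at hs0) (Gammaℝ_ne_zero_of_re_pos hs0)
    rw [← riemannZeta₁_mul_Gammaℝ hs0, ← hZT s hs]
    have := mul_inv_cancel₀ hne
    simp only [hB, hG]
    linear_combination (-(riemannZeta₁ s * T s * L (1 - s))) * this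
  have hX1 : riemannXi₁ 1 ≠ 0 := by simp [riemannXi₁]
  obtain ⟨q, hqd, hq⟩ := exists_entire_quotient (f := fun s => L s * L (1 - s)) (g := riemannXi₁)
    (hL.mul hL1) differentiable_riemannXi₁ ⟨1, hX1⟩ (by
    intro s₀ δ hδ
    rcases lt_trichotomy s₀.re (1 / 2) with hlt | heq | hgt
    · have h1 : 1 - s₀ ∈ H := by simp [hH]; linarith
      have hcont : ContinuousAt (fun s => B (1 - s) * (s - s₀)) s₀ := by
        refine ContinuousAt.mul ?_ (by fun_prop)
        exact ContinuousAt.comp (f := fun s => 1 - s)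
          (hBd.continuousOn.continuousAt (hHo.mem_nhds h1)) (by fun_prop)
      have hev : ∀ᶠ s in 𝓝 s₀, ‖B (1 - s) * (s - s₀)‖ < δ :=
        hcont.norm.eventually (gt_mem_nhds (by simpa using hδ))
      have hH' : ∀ᶠ s in 𝓝 s₀, 1 - s ∈ H :=
        (by fun_prop : ContinuousAt (fun s : ℂ => 1 - s) s₀).eventually (hHo.mem_nhds h1)
      refine Eventually.frequently ?_
      filter_upwards [nhdsWithin_le_nhds hev, nhdsWithin_le_nhds hH'] with s hs hs'
      have := hXB _ hs'
      rw [sub_sub_cancel, riemannXi₁_one_sub] at this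
      rw [mul_comm (L s), this, mul_assoc, norm_mul, mul_comm]
      gcongr
    · have hmap : Tendsto (fun σ : ℝ => (σ : ℂ) + s₀.im * I) (𝓝[>] (1 / 2)) (𝓝[≠] s₀) := by
        refine tendsto_nhdsWithin_iff.mpr ⟨?_, ?_⟩
        · refine Tendsto.mono_left ?_ nhdsWithin_le_nhds
          have : Continuous fun σ : ℝ => (σ : ℂ) + s₀.im * I := by fun_prop
          have h2 := this.tendsto (1 / 2)
          rwa [show (((1 / 2 : ℝ) : ℂ) + s₀.im * I) = s₀ by
            rw [← heq]; exact re_add_im s₀] at h2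
        · filter_upwards [self_mem_nhdsWithin] with σ hσ h0
          have : (σ : ℂ) + s₀.im * I = s₀ := h0
          have := congrArg re this
          simp [heq] at this
          have hσ : 1 / 2 < σ := hσ
          norm_num at hσ this
          linarith
      have hcont : ContinuousAt (fun s => L (1 - s) * G s) s₀ := by
        have hp : {s : ℂ | 0 < s.re} ∈ 𝓝 s₀ :=
          (isOpen_lt continuous_const continuous_re).mem_nhds (by simp [heq])
        exact hL1.continuous.continuousAt.mul (hGd.continuousOn.continuousAt hp)
      have hlim2 := (hlim s₀.im).mul (hcont.tendsto.comp (hmap.mono_right nhdsWithin_le_nhds))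
      rw [zero_mul] at hlim2
      have hev := hlim2.norm.eventually (gt_mem_nhds (show ‖(0:ℂ)‖ < δ by simpa using hδ))
      refine hmap.frequently (Eventually.frequently ?_)
      filter_upwards [hev, self_mem_nhdsWithin] with σ hσ hσ'
      have hmem : (σ : ℂ) + s₀.im * I ∈ H := by simpa [hH] using hσ'
      rw [hXB _ hmem]
      have e : (σ : ℂ) + s₀.im * I - s₀ = ((σ - 1 / 2 : ℝ) : ℂ) := by
        apply Complex.ext <;> simp [heq]
      rw [e, mul_assoc, norm_mul, mul_comm]
      gcongr
      refine le_trans (le_of_eq ?_) hσ.le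
      congr 1
      simp only [hB, Function.comp]
      ring
    · have h1 : s₀ ∈ H := hgt
      have hcont : ContinuousAt (fun s => B s * (s - s₀)) s₀ :=
        (hBd.continuousOn.continuousAt (hHo.mem_nhds h1)).mul (by fun_prop)
      have hev : ∀ᶠ s in 𝓝 s₀, ‖B s * (s - s₀)‖ < δ :=
        hcont.norm.eventually (gt_mem_nhds (by simpa using hδ))
      refine Eventually.frequently ?_
      filter_upwards [nhdsWithin_le_nhds hev, nhdsWithin_le_nhds (hHo.mem_nhds h1)] with s hs hs'
      rw [hXB s hs', mul_assoc, norm_mul, mul_comm]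
      gcongr)
  have h1H : (1 : ℂ) ∈ H := by simp [hH]; norm_num
  have hqB : ∀ s ∈ H, q s = B s :=
    eq_of_mul_eq_mul_of_preconnected hHo hHc differentiable_riemannXi₁.differentiableOn
      hqd.differentiableOn hBd h1H hX1 (fun s hs => by rw [mul_comm, hq, hXB s hs])
  have hqsymm : ∀ s, q (1 - s) = q s := by
    have hq1 : Differentiable ℂ fun s => q (1 - s) := hqd.comp (by fun_prop)
    have := eq_of_mul_eq_mul_of_preconnected isOpen_univ isPreconnected_univ
      differentiable_riemannXi₁.differentiableOn hq1.differentiableOn hqd.differentiableOn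
      (mem_univ 1) hX1 (fun s _ => by
        rw [mul_comm, mul_comm (riemannXi₁ s) (q s), hq s, ← riemannXi₁_one_sub, hq (1 - s),
          sub_sub_cancel, mul_comm])
    exact fun s => this s trivial
  have hL1b : ∀ s, ‖L (1 - s)‖ ≤ Real.exp (C * (2 + ‖s‖)) := fun s => by
    refine (hLb _).trans (Real.exp_le_exp.mpr (mul_le_mul_of_nonneg_left ?_ hC))
    have := norm_sub_le 1 s
    rw [norm_one] at this; linarith
  have hqm : ∀ s ∈ H, ∀ m : ℕ, (m : ℝ) ≤ s.re / 2 → s.re / 2 ≤ m + 1 →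
      ‖q s‖ ≤ Real.exp ((3 * C + C₁) * (1 + ‖s‖)) * (1 + 1 / (s.re - 1 / 2)) /
        (max 1 |s.im / 2|) ^ m := by
    intro s hs m h1 h2
    rw [hqB s hs]
    simp only [hB, hG]
    rw [norm_mul, norm_mul]
    have hpos : 0 < s.re - 1 / 2 := sub_pos.mpr hs
    calc ‖T s‖ * ‖L (1 - s)‖ * ‖(s * Gammaℝ s)⁻¹‖
        ≤ (Real.exp (C * (1 + ‖s‖)) * (1 + 1 / (s.re - 1 / 2))) * Real.exp (C * (2 + ‖s‖)) *
          (Real.exp (C₁ * (1 + ‖s‖)) / (max 1 |s.im / 2|) ^ m) := by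
          gcongr
          · exact hTb s hs
          · exact hL1b s
          · exact hΓ m s h1 h2
      _ = Real.exp (C * (1 + ‖s‖) + C * (2 + ‖s‖) + C₁ * (1 + ‖s‖)) * (1 + 1 / (s.re - 1 / 2)) /
        (max 1 |s.im / 2|) ^ m := by rw [Real.exp_add, Real.exp_add]; ring
      _ ≤ _ := by
        gcongr
        nlinarith [mul_nonneg hC (norm_nonneg s)]
  set A := 3 * C + C₁ with hA
  have hApos : 0 < A := by positivity
  have hqright : ∀ s ∈ H, ‖q s‖ ≤ Real.exp (A * (1 + ‖s‖)) * (1 + 1 / (s.re - 1 / 2)) := by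
    intro s hs
    have hpos : 0 < s.re - 1 / 2 := sub_pos.mpr hs
    refine (hqm s hs ⌊s.re / 2⌋₊ (Nat.floor_le (by linarith)) (Nat.lt_floor_add_one _).le).trans ?_
    exact div_le_self (by positivity) (one_le_pow₀ (le_max_left _ _))
  have hqoff : ∀ s : ℂ, s.re ≠ 1 / 2 →
      ‖q s‖ ≤ Real.exp ((2 * A) * (1 + ‖s‖)) * (1 + 1 / |s.re - 1 / 2|) := by
    intro s hs
    rcases lt_or_gt_of_ne hs with hlt | hgt
    · rw [← hqsymm]
      refine (hqright (1 - s) (by simp [hH]; linarith)).trans ?_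
      have e : (1 - s).re - 1 / 2 = |s.re - 1 / 2| := by
        rw [abs_of_neg (by linarith)]; simp; ring
      rw [e]
      have hp : 0 < |s.re - 1 / 2| := abs_pos.mpr (by linarith)
      refine mul_le_mul (Real.exp_le_exp.mpr ?_) le_rfl (by positivity) (by positivity)
      have := norm_sub_le 1 s
      rw [norm_one] at this
      nlinarith [norm_nonneg s]
    · refine (hqright s hgt).trans ?_
      rw [abs_of_pos (by linarith)]
      have : 0 < s.re - 1 / 2 := by linarith
      gcongr
      linarith
  have hqall := norm_le_exp_of_norm_le_off_line hqd (by positivity : 0 ≤ 2 * A) hqoff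
  have hs2 : 0 < √2 := by positivity
  have hs22 : √2 ^ 2 = 2 := Real.sq_sqrt (by norm_num)
  have hs2lt : √2 < 2 := by nlinarith
  have hs2gt : 1 < √2 := by nlinarith
  have hray : ∀ w : ℂ, w.re = √2 / 2 → |w.im| = √2 / 2 →
      Asymptotics.SuperpolynomialDecay atTop Real.exp fun r : ℝ => ‖q (1 / 2 + r * w)‖ := by
    intro w hwr hwi
    refine superpolynomialDecay_exp_of_le (A := 2 * A + 1) (a := √2 / 4) (by positivity)
      (fun r => norm_nonneg _) ?_
    filter_upwards [eventually_ge_atTop 4] with r hr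
    set s : ℂ := 1 / 2 + r * w with hs
    have hsre : s.re = 1 / 2 + r * (√2 / 2) := by simp [hs, hwr]
    have hsim : |s.im| = r * (√2 / 2) := by
      simp [hs, abs_mul, hwi, abs_of_nonneg (by linarith : (0:ℝ) ≤ r)]
    have hnw : ‖w‖ = 1 := by
      rw [← sq_eq_sq₀ (norm_nonneg _) (by norm_num), ← Complex.normSq_eq_norm_sq,
        Complex.normSq_apply,
        ← abs_mul_abs_self w.im, hwi, hwr]
      nlinarith
    have hsn : ‖s‖ ≤ 1 / 2 + r := by
      refine (norm_add_le _ _).trans ?_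
      rw [norm_mul, hnw, Complex.norm_real, Real.norm_of_nonneg (by linarith)]
      simp
    have hge : 1 ≤ s.re - 1 / 2 := by rw [hsre]; nlinarith
    have h1 := hqm s (by show 1 / 2 < s.re; linarith) ⌊s.re / 2⌋₊
      (Nat.floor_le (by linarith)) (Nat.lt_floor_add_one _).le
    refine h1.trans ?_
    have him : |s.im / 2| = √2 / 4 * r := by rw [abs_div, hsim, abs_two]; ring
    have hfl : ⌊√2 / 4 * r⌋₊ ≤ ⌊s.re / 2⌋₊ := Nat.floor_le_floor (by rw [hsre]; linarith)
    have hp0 : 0 < √2 / 4 * r := by positivity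
    gcongr ?_ / ?_
    · calc Real.exp (A * (1 + ‖s‖)) * (1 + 1 / (s.re - 1 / 2))
          ≤ Real.exp (A * (1 + (1 / 2 + r))) * Real.exp 1 := by
            gcongr
            have : 1 / (s.re - 1 / 2) ≤ 1 := by
              rw [div_le_one (by linarith)]; exact hge
            linarith [Real.add_one_le_exp 1]
        _ = Real.exp (A * (1 + (1 / 2 + r)) + 1) := by rw [Real.exp_add]
        _ ≤ _ := by
          gcongr
          nlinarith
    · calc (√2 / 4 * r) ^ ⌊√2 / 4 * r⌋₊ ≤ (max 1 |s.im / 2|) ^ ⌊√2 / 4 * r⌋₊ := by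
            gcongr
            rw [him]; exact le_max_right _ _
        _ ≤ _ := pow_le_pow_right₀ (le_max_left _ _) hfl
  set w₁ : ℂ := ⟨√2 / 2, -(√2 / 2)⟩ with hw₁
  set w₂ : ℂ := ⟨√2 / 2, √2 / 2⟩ with hw₂
  have hw12 : I * w₁ = w₂ := by apply Complex.ext <;> simp [hw₁, hw₂]
  have hd1 := hray w₁ rfl (by simp only [hw₁, abs_neg]; exact abs_of_pos (by positivity))
  have hd2 := hray w₂ rfl (by simp only [hw₂]; exact abs_of_pos (by positivity))
  have hw1n : ‖w₁‖ = 1 := by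
    rw [← sq_eq_sq₀ (norm_nonneg _) (by norm_num), ← Complex.normSq_eq_norm_sq,
        Complex.normSq_apply]
    simp only [hw₁]
    nlinarith
  have hw1ne : w₁ ≠ 0 := by
    intro h; rw [h] at hw1n; simp at hw1n
  set F : ℂ → ℂ := fun z => q (1 / 2 + z * w₁) with hF
  have hFd : Differentiable ℂ F := hqd.comp (by fun_prop)
  obtain ⟨M, hM⟩ : ∃ M : ℝ, ∀ x : ℝ, 0 ≤ x → ‖q (1 / 2 + x * w₂)‖ ≤ M := by
    have h0 := hd2 0
    simp only [pow_zero, one_mul] at h0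
    obtain ⟨R, hR⟩ := eventually_atTop.mp (h0.eventually (gt_mem_nhds one_pos))
    have hcont : Continuous fun x : ℝ => q (1 / 2 + x * w₂) :=
      hqd.continuous.comp (by fun_prop)
    obtain ⟨M, hM⟩ := (isCompact_Icc (a := (0:ℝ)) (b := R)).exists_bound_of_continuousOn
      hcont.continuousOn
    refine ⟨max M 1, fun x hx => ?_⟩
    rcases le_total x R with hxR | hxR
    · exact (hM x ⟨hx, hxR⟩).trans (le_max_left _ _)
    · exact (hR x hxR).le.trans (le_max_right _ _)
  have hPL := PhragmenLindelof.eq_zero_on_right_half_plane_of_superexponential_decay (f := F)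
    hFd.diffContOnCl ⟨1, by norm_num, 2 * A, by
      refine Asymptotics.IsBigO.of_bound (4 * Real.exp (2 * A * 4))
        (Eventually.of_forall fun z => ?_)
      rw [Real.rpow_one, Real.norm_of_nonneg (Real.exp_pos _).le, mul_assoc, ← Real.exp_add]
      refine (hqall _).trans ?_
      gcongr
      rw [← mul_add]
      refine mul_le_mul_of_nonneg_left ?_ (by positivity)
      have h1 := norm_add_le (1 / 2 : ℂ) (z * w₁)
      rw [norm_mul, hw1n] at h1
      norm_num at h1 ⊢
      linarith⟩ hd1 ⟨M, fun x => by
      have e : (x : ℂ) * I * w₁ = x * w₂ := by rw [mul_assoc, hw12]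
      simp only [hF]
      rw [e]
      rcases le_total 0 x with hx | hx
      · exact hM x hx
      · rw [← hqsymm]
        have := hM (-x) (by linarith)
        rwa [show 1 - (1 / 2 + (x : ℂ) * w₂) = 1 / 2 + ((-x : ℝ) : ℂ) * w₂ by push_cast; ring]⟩
  have hF0 : ∀ z, F z = 0 := by
    have hFa : AnalyticOnNhd ℂ F univ := fun z _ => hFd.analyticAt z
    have := hFa.eqOn_zero_of_preconnected_of_eventuallyEq_zero isPreconnected_univ (mem_univ 1) (by
      filter_upwards [(isOpen_lt continuous_const continuous_re).mem_nhds
        (show (0:ℝ) < (1:ℂ).re by simp)] with z hz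
      exact hPL (le_of_lt hz))
    exact fun z => this trivial
  have hLL : ∀ s, L s * L (1 - s) = 0 := by
    intro s
    have hz := hF0 ((s - 1 / 2) / w₁)
    simp only [hF] at hz
    rw [div_mul_cancel₀ _ hw1ne, add_sub_cancel] at hz
    rw [← hq s, hz, zero_mul]
  have hLa : AnalyticOnNhd ℂ L univ := fun z _ => hL.analyticAt z
  have hL1a : AnalyticOnNhd ℂ (fun s => L (1 - s)) univ := fun z _ => hL1.analyticAt z
  obtain ⟨σ, hσ⟩ := hL0.exists
  rcases hLa.eq_zero_or_eq_zero_of_mul_eq_zero hL1a (fun s _ => hLL s) isPreconnected_univ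
    with h0 | h0
  · exact hσ (h0 σ trivial)
  · exact hσ (by simpa using h0 (1 - σ) trivial)

end

section

open Complex Filter Topology Set MeasureTheory ProbabilityTheory

lemma AnalyticAt.comp_ofReal_real {f : ℂ → ℂ} {x : ℝ} (hf : AnalyticAt ℂ f x) :
    AnalyticAt ℝ (fun y : ℝ => f y) x :=
  (hf.restrictScalars (𝕜 := ℝ)).comp (f := fun y : ℝ => (y : ℂ)) (ofRealCLM.analyticAt x)

lemma eqOn_real_of_eventuallyEq {f g : ℂ → ℂ} {U : Set ℝ} (hU : IsPreconnected U)
    (hf : ∀ x ∈ U, AnalyticAt ℂ f (x : ℝ)) (hg : ∀ x ∈ U, AnalyticAt ℂ g (x : ℝ)) {x₀ : ℝ}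
    (hx₀ : x₀ ∈ U) (h : ∀ᶠ x : ℝ in 𝓝 x₀, f x = g x) : ∀ x ∈ U, f (x : ℝ) = g (x : ℝ) := by
  have hf' : AnalyticOnNhd ℝ (fun y : ℝ => f y) U := fun x hx => (hf x hx).comp_ofReal_real
  have hg' : AnalyticOnNhd ℝ (fun y : ℝ => g y) U := fun x hx => (hg x hx).comp_ofReal_real
  exact hf'.eqOn_of_preconnected_of_eventuallyEq hg' hU hx₀ h

lemma frequently_punctured_of_real {p : ℂ → Prop} {x₀ : ℝ} (h : ∀ᶠ x : ℝ in 𝓝 x₀, p x) :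
    ∃ᶠ z in 𝓝[≠] (x₀ : ℂ), p z := by
  have hmap : Tendsto (fun σ : ℝ => (σ : ℂ)) (𝓝[≠] x₀) (𝓝[≠] (x₀ : ℂ)) := by
    refine tendsto_nhdsWithin_iff.mpr
      ⟨(continuous_ofReal.tendsto x₀).mono_left nhdsWithin_le_nhds, ?_⟩
    filter_upwards [self_mem_nhdsWithin] with σ hσ h0
    exact hσ (ofReal_injective h0)
  exact hmap.frequently (Eventually.frequently (nhdsWithin_le_nhds h))

/-- Landau's theorem on the real singularity at the edge of convergence, in terms of moment
generating functions. -/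
theorem mem_integrableExpSet_of_analyticAt {Ω : Type*} {m : MeasurableSpace Ω} {X : Ω → ℝ}
    {μ : Measure Ω} (hXm : Measurable X) (hX : ∀ᵐ ω ∂μ, 0 ≤ X ω) {Q : ℂ → ℂ} {a b : ℝ}
    (ha : ∀ t < a, t ∈ integrableExpSet X μ) (hQ : ∀ t < b, AnalyticAt ℂ Q (t : ℝ))
    (heq : ∀ t < a, complexMGF X μ (t : ℝ) = Q (t : ℝ)) :
    ∀ t < b, t ∈ integrableExpSet X μ := by
  by_contra! hcon
  obtain ⟨t₁, ht₁b, ht₁⟩ := hcon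
  set S := integrableExpSet X μ with hS
  have hdown : ∀ u ∈ S, ∀ t ≤ u, t ∈ S := by
    intro u hu t htu
    refine Integrable.mono' hu (by fun_prop) ?_
    filter_upwards [hX] with ω hω
    rw [Real.norm_of_nonneg (Real.exp_pos _).le]
    exact Real.exp_le_exp.mpr (mul_le_mul_of_nonneg_right htu hω)
  have hbdd : BddAbove S := ⟨t₁, fun u hu => by
    by_contra! h
    exact ht₁ (hdown u hu t₁ h.le)⟩
  have hne : S.Nonempty := ⟨a - 1, ha _ (by linarith)⟩
  set s := sSup S with hs
  have hst : s ≤ t₁ := csSup_le hne fun u hu => by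
    by_contra! h
    exact ht₁ (hdown u hu t₁ h.le)
  have hIio : ∀ t < s, t ∈ S := fun t ht => by
    obtain ⟨u, hu, htu⟩ := exists_lt_of_lt_csSup hne ht
    exact hdown u hu t htu.le
  have has : a ≤ s := le_of_forall_lt fun t ht => by
    have := le_csSup hbdd (ha ((t + a) / 2) (by linarith))
    linarith
  have hint : ∀ t < s, t ∈ interior S := fun t ht =>
    interior_maximal (s := S) (t := Iio s) hIio isOpen_Iio ht
  have hM : ∀ t < s, AnalyticAt ℂ (complexMGF X μ) (t : ℝ) := fun t ht =>
    analyticAt_complexMGF (by simpa using hint t ht)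
  have heq' : ∀ t < s, complexMGF X μ (t : ℝ) = Q (t : ℝ) :=
    eqOn_real_of_eventuallyEq (U := Iio s) isPreconnected_Iio hM
      (fun t ht => hQ t (lt_of_lt_of_le ht (hst.trans ht₁b.le)))
      (x₀ := a - 1) (by simp; linarith)
      (by filter_upwards [Iio_mem_nhds (show a - 1 < a by linarith)] with t ht using heq t ht)
  obtain ⟨r, hr, hball⟩ := Metric.eventually_nhds_iff_ball.mp
    ((hQ s (lt_of_le_of_lt hst ht₁b)).eventually_analyticAt)
  set c : ℝ := s - r / 4 with hc
  set t : ℝ := s + r / 8 with ht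
  have hcs : c < s := by linarith
  have hsub : Metric.ball (c : ℂ) (r / 2) ⊆ Metric.ball (s : ℂ) r := by
    refine Metric.ball_subset_ball' ?_
    rw [dist_eq_norm, ← ofReal_sub, norm_real, Real.norm_eq_abs, hc, sub_sub_cancel_left, abs_neg,
      abs_of_pos (by positivity)]
    linarith
  have hdiff : DifferentiableOn ℂ Q (Metric.ball (c : ℂ) (r / 2)) := fun z hz =>
    (hball z (hsub hz)).differentiableAt.differentiableWithinAt
  have htm : (t : ℂ) ∈ Metric.ball (c : ℂ) (r / 2) := by
    rw [Metric.mem_ball, dist_eq_norm, ← ofReal_sub, norm_real, Real.norm_eq_abs, hc, ht,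
      abs_of_pos (by linarith)]
    linarith
  have htay := hasSum_taylorSeries_on_ball hdiff htm
  have hQM : complexMGF X μ =ᶠ[𝓝 (c : ℂ)] Q :=
    ((hM c hcs).frequently_eq_iff_eventually_eq (hQ c (by linarith))).mp
      (frequently_punctured_of_real
        (by filter_upwards [Iio_mem_nhds hcs] with t ht using heq' t ht))
  set I₀ : ℕ → ℝ := fun n => ∫ ω, X ω ^ n * Real.exp (c * X ω) ∂μ with hI₀
  have hder : ∀ n, iteratedDeriv n Q c = (I₀ n : ℂ) := fun n => by
    rw [← hQM.iteratedDeriv_eq n, iteratedDeriv_complexMGF (by simpa using hint c hcs), hI₀]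
    simp only
    rw [← integral_complex_ofReal]
    simp
  have hsum : Summable fun n : ℕ => ((n.factorial : ℝ)⁻¹ * (t - c) ^ n * I₀ n) := by
    rw [← Complex.summable_ofReal]
    refine htay.summable.congr fun n => ?_
    rw [hder]
    push_cast
    simp [mul_assoc]
  have hintn : ∀ n : ℕ, Integrable (fun ω => X ω ^ n * Real.exp (c * X ω)) μ := fun n =>
    integrable_pow_mul_exp_of_mem_interior_integrableExpSet (hint c hcs) n
  have htc : 0 < t - c := by linarith
  have htS : t ∈ S := by
    refine ⟨by fun_prop, ?_⟩
    rw [hasFiniteIntegral_iff_ofReal (ae_of_all _ fun ω => (Real.exp_pos _).le)]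
    have h1 : ∀ᵐ ω ∂μ, ENNReal.ofReal (Real.exp (t * X ω)) =
        ∑' n : ℕ, ENNReal.ofReal ((n.factorial : ℝ)⁻¹ * (t - c) ^ n *
          (X ω ^ n * Real.exp (c * X ω))) := by
      filter_upwards [hX] with ω hω
      have h2 : HasSum (fun n : ℕ => (n.factorial : ℝ)⁻¹ * (t - c) ^ n *
          (X ω ^ n * Real.exp (c * X ω)))
          (Real.exp (t * X ω)) := by
        have := (NormedSpace.expSeries_div_hasSum_exp ((t - c) * X ω)).mul_right
          (Real.exp (c * X ω))
        rw [← Real.exp_eq_exp_ℝ, ← Real.exp_add] at this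
        convert! this using 2
        · rw [mul_pow]; ring
        · ring
      rw [← h2.tsum_eq, ENNReal.ofReal_tsum_of_nonneg (fun n => by positivity) h2.summable]
    rw [lintegral_congr_ae h1, lintegral_tsum (fun n => by fun_prop)]
    have h3 : ∀ n : ℕ, ∫⁻ ω, ENNReal.ofReal ((n.factorial : ℝ)⁻¹ * (t - c) ^ n *
        (X ω ^ n * Real.exp (c * X ω))) ∂μ = ENNReal.ofReal ((n.factorial : ℝ)⁻¹ * (t - c) ^ n *
          I₀ n) := by
      intro n
      rw [hI₀, ← integral_const_mul, ofReal_integral_eq_lintegral_ofReal]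
      · exact (hintn n).const_mul _
      · filter_upwards [hX] with ω hω
        positivity
    simp_rw [h3]
    rw [← ENNReal.ofReal_tsum_of_nonneg _ hsum]
    · exact ENNReal.ofReal_lt_top
    · intro n
      refine mul_nonneg (by positivity) (integral_nonneg_of_ae ?_)
      filter_upwards [hX] with ω hω
      positivity
  have := le_csSup hbdd htS
  linarith

/-- The transform `s ↦ ∫ x > 1, g x * x ^ (-(s + 1))`. -/
noncomputable def mellinIoi (g : ℝ → ℝ) (s : ℂ) : ℂ :=
  ∫ x in Ioi (1 : ℝ), (g x : ℂ) * (x : ℂ) ^ (-(s + 1))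

noncomputable def mellinMeasure (g : ℝ → ℝ) : Measure ℝ :=
  (volume.restrict (Ioi 1)).withDensity fun x => ENNReal.ofReal (g x / x)

lemma complexMGF_mellinMeasure {g : ℝ → ℝ} (hgm : Measurable g) (hg : ∀ x, 1 < x → 0 ≤ g x)
    (s : ℂ) : complexMGF Real.log (mellinMeasure g) (-s) = mellinIoi g s := by
  rw [complexMGF, mellinMeasure, mellinIoi, integral_withDensity_eq_integral_toReal_smul
    (by fun_prop) (by simp)]
  refine setIntegral_congr_fun measurableSet_Ioi fun x hx => ?_
  have hx0 : 0 < x := lt_trans one_pos hx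
  rw [ENNReal.toReal_ofReal (div_nonneg (hg x hx) hx0.le),
    cpow_def_of_ne_zero (by exact_mod_cast hx0.ne'),
    real_smul, neg_add, mul_add, Complex.exp_add, ← ofReal_log hx0.le, mul_neg_one,
    Complex.exp_neg (Real.log x : ℂ),
    ← ofReal_exp, Real.exp_log hx0, mul_comm (-s)]
  push_cast
  ring

lemma mem_integrableExpSet_mellinMeasure {g : ℝ → ℝ} (hgm : Measurable g)
    (hg : ∀ x, 1 < x → 0 ≤ g x) (σ : ℝ) : -σ ∈ integrableExpSet Real.log (mellinMeasure g) ↔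
      IntegrableOn (fun x : ℝ => g x * x ^ (-(σ + 1))) (Ioi 1) := by
  rw [integrableExpSet, mem_ofPred_eq, mellinMeasure, integrable_withDensity_iff_integrable_smul'
    (by fun_prop) (by simp)]
  refine integrableOn_congr_fun (fun x hx => ?_) measurableSet_Ioi
  have hx0 : 0 < x := lt_trans one_pos hx
  rw [ENNReal.toReal_ofReal (div_nonneg (hg x hx) hx0.le), smul_eq_mul, Real.rpow_def_of_pos hx0,
    neg_add, mul_add, Real.exp_add, mul_neg_one,
    Real.exp_neg (Real.log x), Real.exp_log hx0, mul_comm (-σ)]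
  ring

lemma ae_mellinMeasure (g : ℝ → ℝ) : ∀ᵐ x ∂mellinMeasure g, 0 ≤ Real.log x := by
  refine (withDensity_absolutelyContinuous _ _).ae_le ?_
  filter_upwards [ae_restrict_mem measurableSet_Ioi] with x hx
  exact Real.log_nonneg (le_of_lt hx)

lemma mem_interior_of_integrable {g : ℝ → ℝ} (hgm : Measurable g)
    (hg : ∀ x, 1 < x → 0 ≤ g x) {a : ℝ}
    (hint : ∀ σ : ℝ, a < σ → IntegrableOn (fun x : ℝ => g x * x ^ (-(σ + 1))) (Ioi 1)) :
    ∀ t : ℝ, t < -a → t ∈ interior (integrableExpSet Real.log (mellinMeasure g)) := fun t ht =>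
  interior_maximal (t := Iio (-a)) (fun u hu => by
    have := (mem_integrableExpSet_mellinMeasure hgm hg (-u)).mpr (hint _ (by
      have : u < -a := hu
      linarith))
    rwa [neg_neg] at this) isOpen_Iio ht

lemma differentiableOn_mellinIoi {g : ℝ → ℝ} (hgm : Measurable g) (hg : ∀ x, 1 < x → 0 ≤ g x)
    {a : ℝ} (hint : ∀ σ : ℝ, a < σ → IntegrableOn (fun x : ℝ => g x * x ^ (-(σ + 1))) (Ioi 1)) :
    DifferentiableOn ℂ (mellinIoi g) {s | a < s.re} := by
  have h1 : DifferentiableOn ℂ (fun s => complexMGF Real.log (mellinMeasure g) (-s))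
      {s | a < s.re} :=
    (differentiableOn_complexMGF (X := Real.log) (μ := mellinMeasure g)).comp
      differentiable_neg.differentiableOn
      (fun s hs => mem_interior_of_integrable hgm hg hint _ (by
        have : a < s.re := hs
        simpa using this))
  exact h1.congr fun s _ => (complexMGF_mellinMeasure hgm hg s).symm

lemma norm_mellinIoi_le {g : ℝ → ℝ} (hgm : Measurable g) (hg : ∀ x, 1 < x → 0 ≤ g x)
    {a : ℝ} (hint : ∀ σ : ℝ, a < σ → IntegrableOn (fun x : ℝ => g x * x ^ (-(σ + 1))) (Ioi 1))
    (s : ℂ) (σ : ℝ) (hσ : a < σ) (hs : σ ≤ s.re) : ‖mellinIoi g s‖ ≤ ‖mellinIoi g σ‖ := by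
  rw [← complexMGF_mellinMeasure hgm hg, ← complexMGF_mellinMeasure hgm hg]
  refine norm_complexMGF_le_mgf.trans ?_
  rw [show -(σ : ℂ) = ((-σ : ℝ) : ℂ) by push_cast; rfl, complexMGF_ofReal, norm_real]
  refine le_trans ?_ (le_abs_self _)
  refine integral_mono_ae ?_ ?_ ?_
  · have := (mem_integrableExpSet_mellinMeasure hgm hg s.re).mpr (hint _ (by linarith))
    rwa [← neg_re] at this
  · exact (mem_integrableExpSet_mellinMeasure hgm hg σ).mpr (hint _ hσ)
  · filter_upwards [ae_mellinMeasure g] with x hx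
    exact Real.exp_le_exp.mpr (mul_le_mul_of_nonneg_right (by simpa using hs) hx)

theorem integrableOn_of_mellinIoi_analyticAt {g : ℝ → ℝ} (hgm : Measurable g)
    (hg : ∀ x, 1 < x → 0 ≤ g x) {Q : ℂ → ℂ} {θ b : ℝ}
    (hint : ∀ σ : ℝ, b < σ → IntegrableOn (fun x : ℝ => g x * x ^ (-(σ + 1))) (Ioi 1))
    (hQ : ∀ σ : ℝ, θ < σ → AnalyticAt ℂ Q σ)
    (heq : ∀ σ : ℝ, b < σ → mellinIoi g σ = Q σ) :
    ∀ σ : ℝ, θ < σ → IntegrableOn (fun x : ℝ => g x * x ^ (-(σ + 1))) (Ioi 1) := by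
  intro σ hσ
  rw [← mem_integrableExpSet_mellinMeasure hgm hg]
  refine mem_integrableExpSet_of_analyticAt (Q := fun s => Q (-s)) (a := -b) (b := -θ)
    Real.measurable_log (ae_mellinMeasure g)
    (fun t ht => interior_subset (mem_interior_of_integrable hgm hg hint t ht)) ?_ ?_ _
    (by linarith)
  · intro t ht
    have := hQ (-t) (by linarith)
    refine AnalyticAt.comp (f := fun s : ℂ => -s) (by simpa using this) analyticAt_id.neg
  · intro t ht
    have := heq (-t) (by linarith)
    rw [← complexMGF_mellinMeasure hgm hg] at this
    simpa using this

end

section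

open Complex Filter Topology Set MeasureTheory

lemma integrableOn_mellin_of_norm_le {g : ℝ → ℝ} (hgm : Measurable g) {C a : ℝ}
    (hg : ∀ x, 1 < x → |g x| ≤ C * x ^ a) {s : ℂ} (hs : a < s.re) :
    IntegrableOn (fun x : ℝ => (g x : ℂ) * (x : ℂ) ^ (-(s + 1))) (Ioi 1) := by
  refine Integrable.mono' (g := fun x : ℝ => C * x ^ (a - s.re - 1))
    ((integrableOn_Ioi_rpow_of_lt (by linarith) one_pos).const_mul C) ?_ ?_
  · refine AEStronglyMeasurable.mul (by fun_prop) ?_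
    refine ContinuousOn.aestronglyMeasurable (fun x hx => ?_) measurableSet_Ioi
    exact (continuousAt_ofReal_cpow_const _ _ (Or.inr (lt_trans one_pos hx).ne')).continuousWithinAt
  · filter_upwards [ae_restrict_mem measurableSet_Ioi] with x hx
    have hx0 : 0 < x := lt_trans one_pos hx
    rw [norm_mul, norm_real, Real.norm_eq_abs, norm_cpow_eq_rpow_re_of_pos hx0]
    refine (mul_le_mul_of_nonneg_right (hg x hx) (by positivity)).trans (le_of_eq ?_)
    rw [mul_assoc, ← Real.rpow_add hx0]
    congr 2
    simp; ring

lemma integrableOn_mellin_of_abs_le {g : ℝ → ℝ} (hgm : Measurable g) {C a : ℝ}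
    (hg : ∀ x, 1 < x → |g x| ≤ C * x ^ a) {σ : ℝ} (hs : a < σ) :
    IntegrableOn (fun x : ℝ => g x * x ^ (-(σ + 1))) (Ioi 1) := by
  have h := (integrableOn_mellin_of_norm_le hgm hg (s := (σ : ℂ)) (by simpa using hs)).re
  refine IntegrableOn.congr_fun h (fun x hx => ?_) measurableSet_Ioi
  have hx0 : 0 < x := lt_trans one_pos hx
  rw [show -((σ : ℂ) + 1) = ((-(σ + 1) : ℝ) : ℂ) by push_cast; rfl,
    ← ofReal_cpow hx0.le, ← ofReal_mul]
  rfl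

lemma mellinIoi_rpow (a : ℝ) {s : ℂ} (hs : a < s.re) :
    mellinIoi (fun x => x ^ a) s = 1 / (s - a) := by
  rw [mellinIoi, setIntegral_congr_fun (g := fun x : ℝ => (x : ℂ) ^ (a - s - 1)) measurableSet_Ioi,
    integral_Ioi_cpow_of_lt (by simp; linarith) one_pos]
  · simp only [ofReal_one, one_cpow, sub_add_cancel]
    rw [← neg_sub s, div_neg, neg_div, neg_neg]
  · intro x hx
    have hx0 : 0 < x := lt_trans one_pos hx
    simp only
    rw [ofReal_cpow hx0.le, ← cpow_add _ _ (by exact_mod_cast hx0.ne')]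
    congr 1; ring

lemma abs_fract_le (x : ℝ) : |Int.fract x| ≤ 1 * x ^ (0 : ℝ) := by
  rw [Real.rpow_zero, one_mul, abs_of_nonneg (Int.fract_nonneg x)]
  exact (Int.fract_lt_one x).le

lemma differentiableOn_mellinIoi_fract :
    DifferentiableOn ℂ (mellinIoi Int.fract) {s | 0 < s.re} :=
  differentiableOn_mellinIoi measurable_fract (fun x _ => Int.fract_nonneg x) fun _ hσ =>
    integrableOn_mellin_of_abs_le measurable_fract (fun x _ => abs_fract_le x) hσ

lemma riemannZeta₁_eq_of_one_lt {s : ℂ} (hs : 1 < s.re) :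
    riemannZeta₁ s = s - s * (s - 1) * mellinIoi Int.fract s := by
  have hs1 : s ≠ 1 := by rintro rfl; simp at hs
  have h1 : s - 1 ≠ 0 := sub_ne_zero.mpr hs1
  have hz : riemannZeta s = s * (1 / (s - 1) - mellinIoi Int.fract s) := by
    rw [← LSeries_one_eq_riemannZeta hs, LSeries_eq_mul_integral' 1 zero_le_one hs]
    · congr 1
      have e := mellinIoi_rpow 1 hs
      rw [ofReal_one] at e
      rw [← e, mellinIoi, mellinIoi, ← integral_sub]
      · refine setIntegral_congr_fun measurableSet_Ioi fun x hx => ?_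
        have hx0 : (0 : ℝ) ≤ x := (lt_trans one_pos hx).le
        simp only [Pi.one_apply, Finset.sum_const, Nat.card_Icc, Nat.add_sub_cancel, Real.rpow_one]
        rw [← sub_mul, ← ofReal_sub, Int.self_sub_fract, nsmul_eq_mul, mul_one,
          ← natCast_floor_eq_intCast_floor hx0]
        simp
      · refine integrableOn_mellin_of_norm_le (C := 1) (a := 1) (by fun_prop) (fun x hx => ?_) hs
        rw [Real.rpow_one, abs_of_pos (by linarith), one_mul]
      · exact integrableOn_mellin_of_norm_le measurable_fract
          (fun x _ => abs_fract_le x) (by linarith)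
    · refine Asymptotics.IsBigO.of_bound 1 (Eventually.of_forall fun n => ?_)
      simp
  have := riemannZeta_eq_inv_sub_mul hs1
  rw [hz] at this
  field_simp at this
  linear_combination -this

lemma riemannZeta₁_eq {s : ℂ} (hs : 0 < s.re) :
    riemannZeta₁ s = s - s * (s - 1) * mellinIoi Int.fract s := by
  have ho : IsOpen {s : ℂ | 0 < s.re} := isOpen_lt continuous_const continuous_re
  have hd : DifferentiableOn ℂ (fun s => s - s * (s - 1) * mellinIoi Int.fract s) {s | 0 < s.re} :=
    differentiableOn_id.sub
      ((by fun_prop : Differentiable ℂ fun s : ℂ => s * (s - 1)).differentiableOn.mul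
      differentiableOn_mellinIoi_fract)
  refine (differentiable_riemannZeta₁.differentiableOn.analyticOnNhd
    ho).eqOn_of_preconnected_of_eventuallyEq
    (hd.analyticOnNhd ho) (convex_halfSpace_re_gt 0).isPreconnected (z₀ := 2) (by simp) ?_ hs
  filter_upwards [(isOpen_lt continuous_const continuous_re).mem_nhds
    (show (1 : ℝ) < (2 : ℂ).re by simp)] with z hz using riemannZeta₁_eq_of_one_lt hz

lemma mellinIoi_fract_ofReal (σ : ℝ) :
    ∃ r : ℝ, 0 ≤ r ∧ mellinIoi Int.fract σ = r := by
  refine ⟨∫ x in Ioi (1 : ℝ), Int.fract x * x ^ (-(σ + 1)),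
    setIntegral_nonneg measurableSet_Ioi fun x hx =>
      mul_nonneg (Int.fract_nonneg x) (Real.rpow_nonneg (lt_trans one_pos hx).le _), ?_⟩
  rw [mellinIoi, ← integral_complex_ofReal]
  refine setIntegral_congr_fun measurableSet_Ioi fun x hx => ?_
  have hx0 : 0 < x := lt_trans one_pos hx
  rw [show -((σ : ℂ) + 1) = ((-(σ + 1) : ℝ) : ℂ) by push_cast; rfl,
    ← ofReal_cpow hx0.le, ← ofReal_mul]

lemma riemannZeta₁_ofReal_ne_zero {σ : ℝ} (hσ : 0 < σ) : riemannZeta₁ σ ≠ 0 := by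
  rcases le_or_gt 1 σ with h | h
  · exact riemannZeta₁_ne_zero_of_one_le_re (by simpa using h)
  · obtain ⟨r, hr, hr'⟩ := mellinIoi_fract_ofReal σ
    rw [riemannZeta₁_eq (by simpa using hσ), hr']
    norm_cast
    have : 0 ≤ σ * (1 - σ) * r := by
      have : 0 < 1 - σ := by linarith
      positivity
    nlinarith

lemma norm_riemannZeta₁_le : ∃ C : ℝ, 0 ≤ C ∧ ∀ s : ℂ, 1 / 2 ≤ s.re →
    ‖riemannZeta₁ s‖ ≤ Real.exp (C * (1 + ‖s‖)) := by
  set c := ‖mellinIoi Int.fract (((1 / 2 : ℝ) : ℝ) : ℂ)‖ with hc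
  have hc0 : 0 ≤ c := norm_nonneg _
  refine ⟨2 + c, by positivity, fun s hs => ?_⟩
  rw [riemannZeta₁_eq (by linarith)]
  have h1 : ‖mellinIoi Int.fract s‖ ≤ c :=
    norm_mellinIoi_le measurable_fract (fun x _ => Int.fract_nonneg x) (a := 0) (fun σ hσ =>
      integrableOn_mellin_of_abs_le measurable_fract (fun x _ => abs_fract_le x) hσ) s (1 / 2)
      (by norm_num) hs
  have h2 : ‖s - 1‖ ≤ 1 + ‖s‖ := (norm_sub_le _ _).trans (by rw [norm_one, add_comm])
  have h3 := norm_nonneg s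
  have h4 : 1 + ‖s‖ ≤ Real.exp ‖s‖ := by linarith [Real.add_one_le_exp ‖s‖]
  calc ‖s - s * (s - 1) * mellinIoi Int.fract s‖
      ≤ ‖s‖ + ‖s‖ * ‖s - 1‖ * ‖mellinIoi Int.fract s‖ := by
        refine (norm_sub_le _ _).trans ?_
        rw [norm_mul, norm_mul]
    _ ≤ ‖s‖ + ‖s‖ * (1 + ‖s‖) * c := by gcongr
    _ ≤ (1 + c) * (1 + ‖s‖) ^ 2 := by nlinarith [mul_nonneg hc0 h3]
    _ ≤ Real.exp c * Real.exp ‖s‖ ^ 2 := by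
        gcongr
        linarith [Real.add_one_le_exp c]
    _ = Real.exp (c + 2 * ‖s‖) := by rw [Real.exp_add, ← Real.exp_nat_mul]; norm_num
    _ ≤ _ := Real.exp_le_exp.mpr (by nlinarith [mul_nonneg hc0 h3])

lemma norm_inv_riemannZeta₁_le : ∃ C : ℝ, 0 ≤ C ∧ ∀ s : ℂ, 2 ≤ s.re →
    ‖(riemannZeta₁ s)⁻¹‖ ≤ Real.exp (C * (1 + ‖s‖)) := by
  have hsum : Summable fun n => ‖LSeries.term 1 2 n‖ :=
    (LSeriesSummable_one_iff.mpr (by simp)).norm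
  set c := ∑' n, ‖LSeries.term 1 2 n‖ with hc
  have hc0 : 0 ≤ c := tsum_nonneg fun n => norm_nonneg _
  refine ⟨c, hc0, fun s hs => ?_⟩
  have h1 : 1 < s.re := by linarith
  have hs1 : s ≠ 1 := by rintro rfl; simp at h1
  have h0 : s - 1 ≠ 0 := sub_ne_zero.mpr hs1
  have hmu := ArithmeticFunction.LSeries_zeta_mul_Lseries_moebius h1
  rw [ArithmeticFunction.LSeries_zeta_eq_riemannZeta h1, riemannZeta_eq_inv_sub_mul hs1] at hmu
  have hne := riemannZeta₁_ne_zero_of_one_le_re h1.le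
  have e : (riemannZeta₁ s)⁻¹ = (s - 1)⁻¹ *
      LSeries (fun n => (ArithmeticFunction.moebius n : ℂ)) s := by
    field_simp at hmu ⊢
    linear_combination -hmu
  have hb : ‖LSeries (fun n => (ArithmeticFunction.moebius n : ℂ)) s‖ ≤ c := by
    refine tsum_of_norm_bounded hsum.hasSum fun n => ?_
    refine (LSeries.norm_term_le s (g := 1) ?_).trans
      (LSeries.norm_term_le_of_re_le_re 1 (by simpa using hs) n)
    have := ArithmeticFunction.abs_moebius_le_one (n := n)
    simp only [norm_intCast, Pi.one_apply, norm_one]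
    exact_mod_cast this
  have hs2 : 1 ≤ ‖s - 1‖ := le_trans (by simp; linarith) (re_le_norm (s - 1))
  rw [e, norm_mul, norm_inv]
  calc ‖s - 1‖⁻¹ * ‖_‖ ≤ 1 * c := by gcongr; exact inv_le_one_of_one_le₀ hs2
    _ ≤ Real.exp c := by linarith [Real.add_one_le_exp c]
    _ ≤ _ := Real.exp_le_exp.mpr (by nlinarith [mul_nonneg hc0 (norm_nonneg s)])

lemma exists_continuation_of_eventually_le {E : ℝ → ℝ} (hEm : Measurable E) {C : ℝ}
    (hE : ∀ x, 1 < x → |E x| ≤ C * x) {θ : ℝ} (hθ0 : 0 < θ) (hθ1 : θ < 1) {q : ℂ → ℂ}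
    (hq : ∀ σ : ℝ, θ ≤ σ → AnalyticAt ℂ q σ) (hqE : ∀ s : ℂ, 1 < s.re → mellinIoi E s = q s)
    {ε : ℝ} (hε : 0 < ε) (hle : ∀ᶠ x in atTop, E x ≤ ε * x ^ θ) :
    ∃ Y : ℂ → ℂ, DifferentiableOn ℂ Y {s | θ < s.re} ∧ (∀ s : ℂ, 1 < s.re → Y s = q s) ∧
      ∃ C' : ℝ, 0 ≤ C' ∧ ∀ s : ℂ, θ < s.re → ‖Y s‖ ≤ 2 * ε / (s.re - θ) + C' := by
  have hC : 0 ≤ C := by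
    have := (abs_nonneg _).trans (hE 2 one_lt_two)
    linarith
  obtain ⟨x₀, hx₀1, hx₀⟩ : ∃ x₀ : ℝ, 1 ≤ x₀ ∧ ∀ x ≥ x₀, E x ≤ ε * x ^ θ := by
    obtain ⟨x₁, hx₁⟩ := eventually_atTop.mp hle
    exact ⟨max 1 x₁, le_max_left _ _, fun x hx => hx₁ x ((le_max_right _ _).trans hx)⟩
  set M : ℝ := C * x₀ with hM
  have hM0 : 0 ≤ M := by positivity
  set b : ℝ → ℝ := (Iic x₀).indicator fun _ => M with hb
  have hbm : Measurable b := measurable_const.indicator measurableSet_Iic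
  have hb0 : ∀ x, 0 ≤ b x := fun x => indicator_nonneg (fun _ _ => hM0) x
  have hbM : ∀ x, b x ≤ M := fun x => indicator_le_self' (fun _ _ => hM0) x
  have hbb : ∀ x, 1 < x → |b x| ≤ M * x ^ (0 : ℝ) := fun x _ => by
    rw [Real.rpow_zero, mul_one, abs_of_nonneg (hb0 x)]
    exact hbM x
  have hbint : ∀ σ : ℝ, 0 < σ → IntegrableOn (fun x : ℝ => b x * x ^ (-(σ + 1))) (Ioi 1) :=
    fun σ hσ => integrableOn_mellin_of_abs_le hbm hbb hσ
  set B := mellinIoi b with hB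
  have hBd : DifferentiableOn ℂ B {s | 0 < s.re} :=
    differentiableOn_mellinIoi hbm (fun x _ => hb0 x) hbint
  have hBle : ∀ s : ℂ, θ ≤ s.re → ‖B s‖ ≤ ‖B θ‖ := fun s hs =>
    norm_mellinIoi_le hbm (fun x _ => hb0 x) hbint s θ hθ0 hs
  set h : ℝ → ℝ := fun x => ε * x ^ θ - E x + b x with hh
  have hhm : Measurable h := by fun_prop
  have hh0 : ∀ x, 1 < x → 0 ≤ h x := by
    intro x hx
    have hp : 0 ≤ ε * x ^ θ := by positivity
    rcases le_or_gt x x₀ with hxx | hxx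
    · have h1 := (le_abs_self _).trans (hE x hx)
      have h2 : b x = M := indicator_of_mem (show x ∈ Iic x₀ from hxx) _
      have h3 : C * x ≤ M := mul_le_mul_of_nonneg_left hxx hC
      simp only [hh, h2]
      linarith
    · have h1 := hx₀ x hxx.le
      have := hb0 x
      simp only [hh]
      linarith
  have hhle : ∀ x, 1 < x → |h x| ≤ (ε + C + M) * x ^ (1 : ℝ) := by
    intro x hx
    have h1 : x ^ θ ≤ x ^ (1 : ℝ) := Real.rpow_le_rpow_of_exponent_le hx.le hθ1.le
    rw [Real.rpow_one] at h1 ⊢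
    have h2 := abs_le.mp (hE x hx)
    have h3 := hbM x
    rw [abs_of_nonneg (hh0 x hx)]
    simp only [hh]
    nlinarith
  have hx_int : ∀ s : ℂ, 1 < s.re → mellinIoi h s = ε / (s - θ) - q s + B s := by
    intro s hs
    have i1 : IntegrableOn (fun x : ℝ => ((ε * x ^ θ : ℝ) : ℂ) * (x : ℂ) ^ (-(s + 1))) (Ioi 1) :=
      integrableOn_mellin_of_norm_le (C := ε) (a := θ) (by fun_prop) (fun x hx => by
        rw [abs_of_nonneg (by positivity)]) (by linarith)
    have i2 : IntegrableOn (fun x : ℝ => (E x : ℂ) * (x : ℂ) ^ (-(s + 1))) (Ioi 1) :=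
      integrableOn_mellin_of_norm_le (C := C) (a := 1) hEm (by simpa using hE) hs
    have i3 : IntegrableOn (fun x : ℝ => (b x : ℂ) * (x : ℂ) ^ (-(s + 1))) (Ioi 1) :=
      integrableOn_mellin_of_norm_le hbm hbb (by linarith)
    have e1 : ∫ x in Ioi (1 : ℝ), ((ε * x ^ θ : ℝ) : ℂ) * (x : ℂ) ^ (-(s + 1)) = ε / (s - θ) := by
      have := mellinIoi_rpow θ (s := s) (by linarith)
      rw [div_eq_mul_one_div, ← this, mellinIoi, ← integral_const_mul]
      simp only [ofReal_mul, mul_assoc]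
    rw [← hqE s hs, hB, mellinIoi, mellinIoi, mellinIoi, ← e1, ← integral_sub i1 i2]
    refine Eq.trans ?_ (integral_add (i1.sub i2) i3)
    congr 1
    ext x
    simp only [hh]
    push_cast
    ring
  set Q : ℂ → ℂ := fun s => ε / (s - θ) - q s + B s with hQ
  have hQa : ∀ σ : ℝ, θ < σ → AnalyticAt ℂ Q σ := by
    intro σ hσ
    have h1 : AnalyticAt ℂ B σ := hBd.analyticAt
      ((isOpen_lt continuous_const continuous_re).mem_nhds (by simp; linarith))
    have h2 : ((σ : ℂ) - θ) ≠ 0 := by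
      rw [← ofReal_sub, ofReal_ne_zero]; linarith
    exact ((analyticAt_const.div (analyticAt_id.sub analyticAt_const) h2).sub (hq σ hσ.le)).add h1
  have hint : ∀ σ : ℝ, θ < σ → IntegrableOn (fun x : ℝ => h x * x ^ (-(σ + 1))) (Ioi 1) :=
    integrableOn_of_mellinIoi_analyticAt hhm hh0 (Q := Q)
      (fun σ hσ => integrableOn_mellin_of_abs_le hhm hhle hσ) hQa
      (fun σ hσ => hx_int σ (by simpa using hσ))
  have hHd := differentiableOn_mellinIoi hhm hh0 hint
  have hho : IsOpen {s : ℂ | θ < s.re} := isOpen_lt continuous_const continuous_re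
  have hHQ : ∀ σ ∈ Ioi θ, mellinIoi h (σ : ℝ) = Q (σ : ℝ) :=
    eqOn_real_of_eventuallyEq isPreconnected_Ioi
      (fun σ hσ => hHd.analyticAt (hho.mem_nhds (by simpa using hσ))) hQa (x₀ := 2)
      (show θ < 2 by linarith) (by
        filter_upwards [Ioi_mem_nhds (one_lt_two (α := ℝ))] with σ hσ
        exact hx_int σ (by simpa using hσ))
  obtain ⟨Cq, hCq⟩ := (isCompact_Icc (a := θ) (b := 2)).exists_bound_of_continuousOn
    (f := fun σ : ℝ => q σ) (fun σ hσ =>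
      ((hq σ hσ.1).continuousAt.comp continuous_ofReal.continuousAt).continuousWithinAt)
  have hCq0 : 0 ≤ Cq := (norm_nonneg _).trans (hCq 2 ⟨by linarith, le_rfl⟩)
  refine ⟨fun s => ε / (s - θ) + B s - mellinIoi h s, ?_, ?_, ε + 2 * ‖B θ‖ + Cq, by positivity, ?_⟩
  · refine (DifferentiableOn.add ?_
      (hBd.mono fun s hs => lt_trans hθ0 (show θ < s.re from hs))).sub hHd
    refine DifferentiableOn.div (by fun_prop) (by fun_prop) fun s hs h0 => ?_
    have h1 : θ < s.re := hs
    rw [sub_eq_zero.mp h0] at h1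
    simp at h1
  · intro s hs
    simp only
    rw [hx_int s hs]
    ring
  · intro s hs
    have hpos : 0 < s.re - θ := by linarith
    have hb1 : ‖(ε : ℂ) / (s - θ)‖ ≤ ε / (s.re - θ) := by
      rw [norm_div, norm_real, Real.norm_of_nonneg hε.le]
      refine div_le_div_of_nonneg_left hε.le hpos ?_
      have := re_le_norm (s - θ)
      simpa using this
    set m := min s.re 2 with hm
    have hmθ : θ < m := lt_min hs (by linarith)
    have h1 : ‖mellinIoi h s‖ ≤ ‖mellinIoi h m‖ :=
      norm_mellinIoi_le hhm hh0 hint s m hmθ (min_le_left _ _)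
    rw [hHQ m hmθ] at h1
    have h2 : ‖Q m‖ ≤ ε / (m - θ) + Cq + ‖B θ‖ := by
      refine (norm_add_le _ _).trans (add_le_add ((norm_sub_le _ _).trans (add_le_add ?_ ?_)) ?_)
      · rw [← ofReal_sub, ← ofReal_div, norm_real, Real.norm_of_nonneg]
        exact div_nonneg hε.le (by linarith)
      · exact hCq m ⟨hmθ.le, min_le_right _ _⟩
      · exact hBle m (by simpa using hmθ.le)
    have h3 : ε / (m - θ) ≤ ε / (s.re - θ) + ε := by
      rcases le_total s.re 2 with h | h
      · rw [hm, min_eq_left h]; linarith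
      · rw [hm, min_eq_right h]
        have : ε / (2 - θ) ≤ ε := div_le_self hε.le (by linarith)
        have : 0 ≤ ε / (s.re - θ) := by positivity
        linarith
    have h4 := hBle s hs.le
    have h5 : ‖(ε : ℂ) / (s - θ) + B s - mellinIoi h s‖ ≤
        ‖(ε : ℂ) / (s - θ)‖ + ‖B s‖ + ‖mellinIoi h s‖ :=
      (norm_sub_le _ _).trans (by gcongr; exact norm_add_le _ _)
    have h6 : 2 * ε / (s.re - θ) = ε / (s.re - θ) + ε / (s.re - θ) := by ring
    simp only
    linarith

theorem exists_continuation_of_oneSided {E : ℝ → ℝ} (hEm : Measurable E) {C : ℝ}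
    (hE : ∀ x, 1 < x → |E x| ≤ C * x) {θ : ℝ} (hθ0 : 0 < θ) (hθ1 : θ < 1) {q : ℂ → ℂ}
    (hq : ∀ σ : ℝ, θ ≤ σ → AnalyticAt ℂ q σ) (hqE : ∀ s : ℂ, 1 < s.re → mellinIoi E s = q s)
    (hle : ∀ ε : ℝ, 0 < ε → ∀ᶠ x in atTop, E x ≤ ε * x ^ θ) :
    ∃ Y : ℂ → ℂ, DifferentiableOn ℂ Y {s | θ < s.re} ∧ (∀ s : ℂ, 1 < s.re → Y s = q s) ∧
      ∀ ε : ℝ, 0 < ε → ∃ C' : ℝ, 0 ≤ C' ∧ ∀ s : ℂ, θ < s.re → ‖Y s‖ ≤ ε / (s.re - θ) + C' := by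
  have key := fun ε hε => exists_continuation_of_eventually_le hEm hE hθ0 hθ1 hq hqE hε (hle ε hε)
  obtain ⟨Y, hY, hYq, -⟩ := key 1 one_pos
  refine ⟨Y, hY, hYq, fun ε hε => ?_⟩
  obtain ⟨Y', hY', hYq', C', hC', hb⟩ := key (ε / 2) (by positivity)
  refine ⟨C', hC', fun s hs => ?_⟩
  have ho : IsOpen {s : ℂ | θ < s.re} := isOpen_lt continuous_const continuous_re
  have : Y s = Y' s :=
    (hY.analyticOnNhd ho).eqOn_of_preconnected_of_eventuallyEq (hY'.analyticOnNhd ho)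
      (convex_halfSpace_re_gt θ).isPreconnected (z₀ := 2) (by simp; linarith) (by
        filter_upwards [(isOpen_lt continuous_const continuous_re).mem_nhds
          (show (1 : ℝ) < (2 : ℂ).re by simp)] with z hz
        rw [hYq z hz, hYq' z hz]) hs
  rw [this]
  have := hb s hs
  rwa [mul_div_cancel₀ _ two_ne_zero] at this

end

section

open Complex Filter Topology Set

/-- `f` has at most exponential growth of order one on `U`. -/
def ExpBddOn (f : ℂ → ℂ) (U : Set ℂ) : Prop :=
  ∃ C : ℝ, 0 ≤ C ∧ ∀ s ∈ U, ‖f s‖ ≤ Real.exp (C * (1 + ‖s‖))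

namespace ExpBddOn

variable {f g : ℂ → ℂ} {U V : Set ℂ}

lemma mono (hf : ExpBddOn f U) (h : V ⊆ U) : ExpBddOn f V := by
  obtain ⟨C, hC, hb⟩ := hf
  exact ⟨C, hC, fun s hs => hb s (h hs)⟩

lemma of_le (hf : ExpBddOn f U) (h : ∀ s ∈ U, ‖g s‖ ≤ ‖f s‖) : ExpBddOn g U := by
  obtain ⟨C, hC, hb⟩ := hf
  exact ⟨C, hC, fun s hs => (h s hs).trans (hb s hs)⟩

lemma of_norm_le {A : ℝ} (h : ∀ s ∈ U, ‖f s‖ ≤ A) : ExpBddOn f U := by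
  refine ⟨|A|, abs_nonneg A, fun s hs => (h s hs).trans ((le_abs_self A).trans ?_)⟩
  have h1 : |A| ≤ |A| * (1 + ‖s‖) := le_mul_of_one_le_right (abs_nonneg A) (by simp)
  linarith [Real.add_one_le_exp (|A| * (1 + ‖s‖))]

lemma const (c : ℂ) : ExpBddOn (fun _ => c) U := of_norm_le fun _ _ => le_rfl

lemma id : ExpBddOn (fun s => s) U :=
  ⟨1, zero_le_one, fun s _ => by linarith [Real.add_one_le_exp (1 * (1 + ‖s‖))]⟩

lemma mul (hf : ExpBddOn f U) (hg : ExpBddOn g U) : ExpBddOn (fun s => f s * g s) U := by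
  obtain ⟨A, hA, ha⟩ := hf
  obtain ⟨B, hB, hb⟩ := hg
  refine ⟨A + B, by positivity, fun s hs => ?_⟩
  rw [norm_mul, add_mul, Real.exp_add]
  exact mul_le_mul (ha s hs) (hb s hs) (norm_nonneg _) (Real.exp_pos _).le

lemma add (hf : ExpBddOn f U) (hg : ExpBddOn g U) : ExpBddOn (fun s => f s + g s) U := by
  obtain ⟨A, hA, ha⟩ := hf
  obtain ⟨B, hB, hb⟩ := hg
  refine ⟨A + B + 1, by positivity, fun s hs => (norm_add_le _ _).trans ?_⟩
  have h1 : 0 ≤ A * (1 + ‖s‖) := by positivity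
  have h2 : 0 ≤ B * (1 + ‖s‖) := by positivity
  have h3 := Real.add_one_le_exp (1 + ‖s‖)
  have h4 : Real.exp (A * (1 + ‖s‖)) ≤ Real.exp ((A + B) * (1 + ‖s‖)) := by
    gcongr
    linarith
  have h5 : Real.exp (B * (1 + ‖s‖)) ≤ Real.exp ((A + B) * (1 + ‖s‖)) := by
    gcongr
    linarith
  rw [add_mul _ (1 : ℝ), one_mul, Real.exp_add]
  have h6 := Real.exp_pos ((A + B) * (1 + ‖s‖))
  nlinarith [ha s hs, hb s hs, norm_nonneg s]

lemma sub (hf : ExpBddOn f U) (hg : ExpBddOn g U) : ExpBddOn (fun s => f s - g s) U :=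
  (hf.add ((const (-1)).mul hg)).of_le fun s _ => by simp [sub_eq_add_neg]

lemma sum {ι : Type*} {J : Finset ι} {F : ι → ℂ → ℂ} (h : ∀ j ∈ J, ExpBddOn (F j) U) :
    ExpBddOn (fun s => ∑ j ∈ J, F j s) U := by
  classical
  induction J using Finset.induction_on with
  | empty => simpa using const 0
  | insert a J haJ ih =>
    simp only [Finset.sum_insert haJ]
    exact (h a (Finset.mem_insert_self _ _)).add
      (ih fun j hj => h j (Finset.mem_insert_of_mem hj))

lemma prod {ι : Type*} {J : Finset ι} {F : ι → ℂ → ℂ} (h : ∀ j ∈ J, ExpBddOn (F j) U) :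
    ExpBddOn (fun s => ∏ j ∈ J, F j s) U := by
  classical
  induction J using Finset.induction_on with
  | empty => simpa using const 1
  | insert a J haJ ih =>
    simp only [Finset.prod_insert haJ]
    exact (h a (Finset.mem_insert_self _ _)).mul
      (ih fun j hj => h j (Finset.mem_insert_of_mem hj))

lemma pow (hf : ExpBddOn f U) (n : ℕ) : ExpBddOn (fun s => f s ^ n) U := by
  simpa using prod (J := Finset.range n) (F := fun _ => f) fun _ _ => hf

lemma comp_const_mul (hf : ExpBddOn f U) (a : ℂ) (h : ∀ s ∈ V, a * s ∈ U) :
    ExpBddOn (fun s => f (a * s)) V := by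
  obtain ⟨C, hC, hb⟩ := hf
  refine ⟨C * (1 + ‖a‖), by positivity, fun s hs => (hb _ (h s hs)).trans ?_⟩
  rw [mul_assoc, norm_mul]
  gcongr
  nlinarith [norm_nonneg a, norm_nonneg s]

lemma natCast_cpow_neg {p : ℕ} (hp : 1 ≤ p) : ExpBddOn (fun s => (p : ℂ) ^ (-s)) U := by
  have hp' : (0 : ℝ) < p := by exact_mod_cast hp
  have hl : 0 ≤ Real.log p := Real.log_nonneg (by exact_mod_cast hp)
  refine ⟨Real.log p, hl, fun s _ => ?_⟩
  rw [norm_natCast_cpow_of_pos hp, Real.rpow_def_of_pos hp', neg_re]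
  gcongr
  have := (abs_le.mp (abs_re_le_norm s)).1
  linarith

lemma polynomial_eval (P : Polynomial ℂ) (hf : ExpBddOn f U) :
    ExpBddOn (fun s => P.eval (f s)) U := by
  simp only [Polynomial.eval_eq_sum_range]
  exact sum fun i _ => (const _).mul (hf.pow i)

end ExpBddOn

lemma isBigO_pow_of_le {m n : ℕ} (h : n ≤ m) :
    (fun u : ℂ => u ^ m) =O[𝓝 0] fun u => u ^ n := by
  refine Asymptotics.IsBigO.of_bound 1 ?_
  filter_upwards [Metric.closedBall_mem_nhds (0 : ℂ) one_pos] with u hu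
  rw [norm_pow, norm_pow, one_mul]
  exact pow_le_pow_of_le_one (norm_nonneg _) (by simpa using hu) h

lemma isBigO_pow_mul {f g : ℂ → ℂ} {m n N : ℕ} (hf : f =O[𝓝 0] fun u : ℂ => u ^ m)
    (hg : g =O[𝓝 0] fun u : ℂ => u ^ n) (h : N ≤ m + n) :
    (fun u => f u * g u) =O[𝓝 0] fun u : ℂ => u ^ N :=
  ((hf.mul hg).congr_right fun u => (pow_add u m n).symm).trans (isBigO_pow_of_le h)

lemma isBigO_sum_pow {k : ℕ} {J : Finset ℕ} (hJ : ∀ j ∈ J, k + 1 ≤ j) :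
    (fun u : ℂ => ∑ j ∈ J, u ^ j) =O[𝓝 0] fun u => u ^ (k + 1) :=
  Asymptotics.IsBigO.fun_sum fun j hj => isBigO_pow_of_le (hJ j hj)

lemma isBigO_prod_one_sub_pow {k : ℕ} {J : Finset ℕ} (hJ : ∀ j ∈ J, k + 1 ≤ j) :
    (fun u : ℂ => ∏ j ∈ J, (1 - u ^ j) - (1 - ∑ j ∈ J, u ^ j)) =O[𝓝 0]
      fun u => u ^ (2 * k + 1) := by
  classical
  induction J using Finset.induction_on with
  | empty => simpa using Asymptotics.isBigO_zero _ _
  | insert a J haJ ih =>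
    have ih' := ih fun j hj => hJ j (Finset.mem_insert_of_mem hj)
    have h1 := isBigO_pow_mul (isBigO_pow_of_le (hJ a (Finset.mem_insert_self _ _)))
      (isBigO_sum_pow fun j hj => hJ j (Finset.mem_insert_of_mem hj))
      (show 2 * k + 1 ≤ (k + 1) + (k + 1) by omega)
    have h2 : (fun u : ℂ => 1 - u ^ a) =O[𝓝 0] fun u => u ^ 0 := by
      simpa using ((by fun_prop : Continuous fun u : ℂ => 1 - u ^ a).tendsto 0).isBigO_one ℂ
    have h3 := isBigO_pow_mul h2 ih' (show 2 * k + 1 ≤ 0 + (2 * k + 1) by omega)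
    refine (h3.add h1).congr_left fun u => ?_
    rw [Finset.prod_insert haJ, Finset.sum_insert haJ]
    ring

lemma norm_tsum_sub_sum_le {a : ℕ → ℂ} (ha : ∀ j, ‖a j‖ ≤ 1) (N : ℕ) {u : ℂ} (hu : ‖u‖ < 1) :
    ‖(∑' j, a j * u ^ j) - ∑ j ∈ Finset.range N, a j * u ^ j‖ ≤ ‖u‖ ^ N * (1 - ‖u‖)⁻¹ := by
  have hg := hasSum_geometric_of_lt_one (norm_nonneg u) hu
  have hb : ∀ j, ‖a j * u ^ j‖ ≤ ‖u‖ ^ j := fun j => by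
    rw [norm_mul, norm_pow]
    exact mul_le_of_le_one_left (by positivity) (ha j)
  have hs : Summable fun j => a j * u ^ j := Summable.of_norm_bounded hg.summable hb
  rw [← hs.sum_add_tsum_nat_add N, add_sub_cancel_left]
  refine tsum_of_norm_bounded (hg.mul_left (‖u‖ ^ N)) fun j => ?_
  refine (hb _).trans (le_of_eq ?_)
  rw [pow_add, mul_comm]

lemma differentiableOn_tsum_mul_pow {a : ℕ → ℂ} (ha : ∀ j, ‖a j‖ ≤ 1) :
    DifferentiableOn ℂ (fun u => ∑' j, a j * u ^ j) (Metric.ball 0 1) := by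
  intro u hu
  obtain ⟨r, hur, hr⟩ := exists_between (show ‖u‖ < 1 by simpa using hu)
  have hr0 : 0 ≤ r := (norm_nonneg u).trans hur.le
  have := differentiableOn_tsum_of_summable_norm (u := fun j : ℕ => r ^ j)
    (F := fun j u => a j * u ^ j) (U := Metric.ball (0 : ℂ) r)
    (summable_geometric_of_lt_one hr0 hr) (fun j => by fun_prop) Metric.isOpen_ball
    (fun j w hw => by
      rw [norm_mul, norm_pow]
      have hw' : ‖w‖ ≤ r := (mem_ball_zero_iff.mp hw).le
      calc ‖a j‖ * ‖w‖ ^ j ≤ 1 * r ^ j := by gcongr; exact ha j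
        _ = r ^ j := one_mul _)
  exact (this.differentiableAt
    (Metric.isOpen_ball.mem_nhds (by simpa using hur))).differentiableWithinAt

lemma one_sub_pow_ne_zero {u : ℂ} (hu : ‖u‖ < 1) {j : ℕ} (hj : j ≠ 0) : 1 - u ^ j ≠ 0 := by
  intro h
  have h1 : ‖u ^ j‖ = 1 := by rw [← sub_eq_zero.mp h, norm_one]
  rw [norm_pow] at h1
  exact (pow_lt_one₀ (norm_nonneg u) hu hj).ne h1

lemma exists_correction {a : ℕ → ℂ} (ha : ∀ j, ‖a j‖ ≤ 1) {k : ℕ} (hk : 1 ≤ k) {Jp Jm : Finset ℕ}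
    (hJp : ∀ j ∈ Jp, k + 1 ≤ j) (hJm : ∀ j ∈ Jm, k + 1 ≤ j)
    (hsum : ∀ u : ℂ, ∑ j ∈ Finset.range (2 * k + 1), a j * u ^ j =
      1 - u ^ k + ∑ j ∈ Jp, u ^ j - ∑ j ∈ Jm, u ^ j) :
    ∃ g : ℂ → ℂ, DifferentiableOn ℂ g (Metric.ball 0 1) ∧
      ((fun u => g u - 1) =O[𝓝 0] fun u => u ^ (2 * k + 1)) ∧
      ∀ u : ℂ, ‖u‖ < 1 → g u * ∏ j ∈ Jp, (1 - u ^ j)⁻¹ =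
        (∑' j, a j * u ^ j) * (1 - u ^ k)⁻¹ * ∏ j ∈ Jm, (1 - u ^ j)⁻¹ := by
  set Φ : ℂ → ℂ := fun u => ∑' j, a j * u ^ j with hΦ
  set p : ℂ → ℂ := fun u => ∏ j ∈ Jp, (1 - u ^ j) with hp
  set m : ℂ → ℂ := fun u => ∏ j ∈ Jm, (1 - u ^ j) with hm
  have hpc : Differentiable ℂ p := by fun_prop
  have hmc : Differentiable ℂ m := by fun_prop
  have hk0 : ∀ u : ℂ, ‖u‖ < 1 → 1 - u ^ k ≠ 0 := fun u hu => one_sub_pow_ne_zero hu (by omega)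
  have hp0 : ∀ u : ℂ, ‖u‖ < 1 → p u ≠ 0 := fun u hu => Finset.prod_ne_zero_iff.mpr fun j hj =>
    one_sub_pow_ne_zero hu (by have := hJp j hj; omega)
  have hm0 : ∀ u : ℂ, ‖u‖ < 1 → m u ≠ 0 := fun u hu => Finset.prod_ne_zero_iff.mpr fun j hj =>
    one_sub_pow_ne_zero hu (by have := hJm j hj; omega)
  have hΦd := differentiableOn_tsum_mul_pow ha
  refine ⟨fun u => Φ u * p u * ((1 - u ^ k) * m u)⁻¹, ?_, ?_, ?_⟩
  · refine (hΦd.mul hpc.differentiableOn).mul (DifferentiableOn.inv ?_ ?_)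
    · exact (by fun_prop : Differentiable ℂ fun u : ℂ => (1 - u ^ k) * m u).differentiableOn
    · intro u hu
      have hu' : ‖u‖ < 1 := by simpa using hu
      exact mul_ne_zero (hk0 u hu') (hm0 u hu')
  · have hR : (fun u => Φ u - (1 - u ^ k + ∑ j ∈ Jp, u ^ j - ∑ j ∈ Jm, u ^ j)) =O[𝓝 0]
        fun u : ℂ => u ^ (2 * k + 1) := by
      refine Asymptotics.IsBigO.of_bound 2 ?_
      filter_upwards [Metric.closedBall_mem_nhds (0 : ℂ) (show (0:ℝ) < 1 / 2 by norm_num)] with u hu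
      have hu' : ‖u‖ ≤ 1 / 2 := by simpa using hu
      rw [← hsum, norm_pow]
      refine (norm_tsum_sub_sum_le ha _ (by linarith)).trans ?_
      rw [mul_comm (2 : ℝ)]
      refine mul_le_mul_of_nonneg_left ?_ (by positivity)
      rw [show (2 : ℝ) = (1 / 2)⁻¹ by norm_num]
      exact inv_anti₀ (by norm_num) (by linarith)
    have hcO : ∀ {h : ℂ → ℂ}, Continuous h → h =O[𝓝 0] fun u : ℂ => u ^ 0 := fun {h} hh => by
      simpa using (hh.tendsto 0).isBigO_one ℂ
    have hSp := isBigO_sum_pow hJp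
    have hSm := isBigO_sum_pow hJm
    have hDp := isBigO_prod_one_sub_pow hJp
    have hDm := isBigO_prod_one_sub_pow hJm
    have hkk : (fun u : ℂ => u ^ k) =O[𝓝 0] fun u => u ^ k := Asymptotics.isBigO_refl _ _
    have h1 := isBigO_pow_mul hkk hSp (show 2 * k + 1 ≤ k + (k + 1) by omega)
    have h2 := isBigO_pow_mul hSp hSp (show 2 * k + 1 ≤ (k + 1) + (k + 1) by omega)
    have h3 := isBigO_pow_mul hSm hSp (show 2 * k + 1 ≤ (k + 1) + (k + 1) by omega)
    have h4 := isBigO_pow_mul hkk hSm (show 2 * k + 1 ≤ k + (k + 1) by omega)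
    have h5 := isBigO_pow_mul hR (hcO hpc.continuous) (show 2 * k + 1 ≤ (2 * k + 1) + 0 by omega)
    have h6 := isBigO_pow_mul
      (hcO (by fun_prop : Continuous fun u : ℂ => 1 - u ^ k + ∑ j ∈ Jp, u ^ j - ∑ j ∈ Jm, u ^ j))
      hDp (show 2 * k + 1 ≤ 0 + (2 * k + 1) by omega)
    have h7 := isBigO_pow_mul (hcO (by fun_prop : Continuous fun u : ℂ => 1 - u ^ k))
      hDm (show 2 * k + 1 ≤ 0 + (2 * k + 1) by omega)
    have hnum : (fun u => Φ u * p u - (1 - u ^ k) * m u) =O[𝓝 0] fun u : ℂ => u ^ (2 * k + 1) := by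
      refine ((((((h1.sub h2).add h3).sub h4).add h5).add h6).sub h7).congr_left fun u => ?_
      simp only [hp, hm]
      ring
    have hinv : (fun u => ((1 - u ^ k) * m u)⁻¹) =O[𝓝 0] fun u : ℂ => u ^ 0 := by
      have hc : ContinuousAt (fun u => ((1 - u ^ k) * m u)⁻¹) 0 := by
        refine ContinuousAt.inv₀ (by fun_prop) (mul_ne_zero (hk0 0 (by simp)) (hm0 0 (by simp)))
      simpa using hc.tendsto.isBigO_one ℂ
    refine (isBigO_pow_mul hnum hinv (show 2 * k + 1 ≤ (2 * k + 1) + 0 by omega)).congr' ?_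
      EventuallyEq.rfl
    filter_upwards [Metric.ball_mem_nhds (0 : ℂ) one_pos] with u hu
    have hu' : ‖u‖ < 1 := by simpa using hu
    rw [sub_mul, mul_inv_cancel₀ (mul_ne_zero (hk0 u hu') (hm0 u hu'))]
  · intro u hu
    simp only [Finset.prod_inv_distrib]
    change Φ u * p u * ((1 - u ^ k) * m u)⁻¹ * (p u)⁻¹ = Φ u * (1 - u ^ k)⁻¹ * (m u)⁻¹
    have := hp0 u hu
    rw [mul_inv]
    field_simp

lemma exists_polynomial_mul_ne_zero_on_finset {U : Set ℂ} (hU : IsOpen U) (hUc : IsPreconnected U)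
    {g : ℂ → ℂ} (hg : DifferentiableOn ℂ g U) {z₀ : ℂ} (hz₀ : z₀ ∈ U) (hne : g z₀ ≠ 0)
    (S : Finset ℂ) (hS : ∀ z ∈ S, z ∈ U) :
    ∃ (P : Polynomial ℂ) (ψ : ℂ → ℂ), DifferentiableOn ℂ ψ U ∧ (∀ z ∈ U, g z = P.eval z * ψ z) ∧
      ∀ z ∈ S, ψ z ≠ 0 := by
  classical
  induction S using Finset.induction_on with
  | empty => exact ⟨1, g, hg, by simp, by simp⟩
  | insert a S haS ih =>
    obtain ⟨P, ψ, hψ, hP, hψS⟩ := ih fun z hz => hS z (Finset.mem_insert_of_mem hz)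
    have haU : a ∈ U := hS a (Finset.mem_insert_self _ _)
    have hψa : AnalyticOnNhd ℂ ψ U := hψ.analyticOnNhd hU
    have hnz : ¬ ∀ᶠ z in 𝓝 a, ψ z = 0 := fun h => by
      have := hψa.eqOn_zero_of_preconnected_of_eventuallyEq_zero hUc haU h hz₀
      exact hne (by rw [hP z₀ hz₀, this]; simp)
    obtain ⟨n, h, hh, hha, hev⟩ := (hψa a haU).exists_eventuallyEq_pow_smul_nonzero_iff.mpr hnz
    refine ⟨P * (Polynomial.X - Polynomial.C a) ^ n,
      Function.update (fun z => ψ z / (z - a) ^ n) a (h a), ?_, ?_, ?_⟩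
    · intro z hz
      rcases eq_or_ne z a with rfl | hza
      · refine (hh.congr ?_).differentiableAt.differentiableWithinAt
        filter_upwards [hev] with w hw
        rcases eq_or_ne w z with rfl | hwz
        · simp
        · rw [Function.update_of_ne hwz, hw, smul_eq_mul, mul_div_cancel_left₀]
          exact pow_ne_zero _ (sub_ne_zero.mpr hwz)
      · have hd : DifferentiableAt ℂ (fun z => ψ z / (z - a) ^ n) z :=
          (hψa z hz).differentiableAt.div (by fun_prop) (pow_ne_zero _ (sub_ne_zero.mpr hza))
        refine (hd.congr_of_eventuallyEq ?_).differentiableWithinAt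
        filter_upwards [isOpen_ne.mem_nhds hza] with w hw
        exact Function.update_of_ne hw _ _
    · intro z hz
      rw [hP z hz]
      rcases eq_or_ne z a with rfl | hza
      · rw [hev.self_of_nhds]
        simp
        ring
      · rw [Function.update_of_ne hza]
        have := pow_ne_zero n (sub_ne_zero.mpr hza)
        simp only [Polynomial.eval_mul, Polynomial.eval_pow, Polynomial.eval_sub, Polynomial.eval_X,
          Polynomial.eval_C]
        field_simp
    · intro z hz
      rcases eq_or_ne z a with rfl | hza
      · simpa using hha
      · rw [Function.update_of_ne hza]
        exact div_ne_zero (hψS z (Finset.mem_of_mem_insert_of_ne hz hza))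
          (pow_ne_zero _ (sub_ne_zero.mpr hza))

lemma exists_polynomial_mul_bounded_below {g : ℂ → ℂ}
    (hg : DifferentiableOn ℂ g (Metric.ball 0 1)) (h0 : g 0 ≠ 0) {r : ℝ} (hr : r < 1) :
    ∃ (P : Polynomial ℂ) (ψ : ℂ → ℂ) (m : ℝ), 0 < m ∧ P.eval 0 ≠ 0 ∧
      DifferentiableOn ℂ ψ (Metric.ball 0 1) ∧
      (∀ z ∈ Metric.ball (0 : ℂ) 1, g z = P.eval z * ψ z) ∧ ∀ z : ℂ, ‖z‖ ≤ r → m ≤ ‖ψ z‖ := by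
  have hcp : IsCompact (Metric.closedBall (0 : ℂ) r) := isCompact_closedBall 0 r
  have hsub : Metric.closedBall (0 : ℂ) r ⊆ Metric.ball 0 1 := Metric.closedBall_subset_ball hr
  have hc : IsPreconnected (Metric.ball (0 : ℂ) 1) := (convex_ball 0 1).isPreconnected
  have hga := hg.analyticOnNhd Metric.isOpen_ball
  have h0m : (0 : ℂ) ∈ Metric.ball (0 : ℂ) 1 := by simp
  have hfin : {z | z ∈ Metric.closedBall (0 : ℂ) r ∧ g z = 0}.Finite := by
    by_contra hinf
    obtain ⟨x, hx, hacc⟩ := Set.Infinite.exists_accPt_of_subset_isCompact hinf hcp fun z hz => hz.1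
    refine h0 (hga.eqOn_zero_of_preconnected_of_frequently_eq_zero hc (hsub hx) ?_ h0m)
    exact (accPt_iff_frequently_nhdsNE.mp hacc).mono fun z hz => hz.2
  obtain ⟨P, ψ, hψ, hP, hψS⟩ := exists_polynomial_mul_ne_zero_on_finset
    Metric.isOpen_ball hc hg h0m h0
    hfin.toFinset (fun z hz => hsub (by simpa using ((hfin.mem_toFinset).mp hz).1))
  have hP0 : P.eval 0 ≠ 0 := fun h => h0 (by rw [hP 0 h0m, h, zero_mul])
  have hne : ∀ z ∈ Metric.closedBall (0 : ℂ) r, ψ z ≠ 0 := by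
    intro z hz h
    by_cases hgz : g z = 0
    · exact hψS z (hfin.mem_toFinset.mpr ⟨hz, hgz⟩) h
    · exact hgz (by rw [hP z (hsub hz), h, mul_zero])
  rcases (Metric.closedBall (0 : ℂ) r).eq_empty_or_nonempty with he | hn
  · refine ⟨P, ψ, 1, one_pos, hP0, hψ, hP, fun z hz => ?_⟩
    have : z ∈ Metric.closedBall (0 : ℂ) r := by simpa using hz
    rw [he] at this
    exact this.elim
  · obtain ⟨z₁, hz₁, hmin⟩ := hcp.exists_isMinOn hn (f := fun z => ‖ψ z‖)
      ((hψ.continuousOn.mono hsub).norm)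
    exact ⟨P, ψ, ‖ψ z₁‖, norm_pos_iff.mpr (hne z₁ hz₁), hP0, hψ, hP, fun z hz =>
      hmin (by simpa using hz)⟩

lemma norm_natCast_cpow_neg_lt_one {p : ℕ} (hp : 2 ≤ p) {s : ℂ} (hs : 0 < s.re) :
    ‖(p : ℂ) ^ (-s)‖ < 1 := by
  rw [norm_natCast_cpow_of_pos (by omega), neg_re]
  exact Real.rpow_lt_one_of_one_lt_of_neg (by exact_mod_cast hp) (by linarith)

lemma norm_natCast_cpow_neg_le {p : ℕ} (hp : 1 ≤ p) {s : ℂ} {b : ℝ} (hs : b ≤ s.re) :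
    ‖(p : ℂ) ^ (-s)‖ ≤ (p : ℝ) ^ (-b) := by
  rw [norm_natCast_cpow_of_pos (by omega), neg_re]
  exact Real.rpow_le_rpow_of_exponent_le (by exact_mod_cast hp) (by linarith)

lemma differentiable_natCast_cpow_neg {p : ℕ} (hp : p ≠ 0) :
    Differentiable ℂ fun s : ℂ => (p : ℂ) ^ (-s) := fun s =>
  (differentiableAt_id.neg).const_cpow (Or.inl (by exact_mod_cast hp))

lemma differentiableOn_comp_natCast_cpow_neg {g : ℂ → ℂ}
    (hg : DifferentiableOn ℂ g (Metric.ball 0 1)) {p : ℕ} (hp : 2 ≤ p) :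
    DifferentiableOn ℂ (fun s : ℂ => g ((p : ℂ) ^ (-s))) {s | 0 < s.re} :=
  hg.comp (differentiable_natCast_cpow_neg (by omega)).differentiableOn fun s hs => by
    simpa using norm_natCast_cpow_neg_lt_one hp hs

lemma exists_radius_of_isBigO {g : ℂ → ℂ} {M : ℕ} (hM : 1 ≤ M)
    (hgO : (fun u => g u - 1) =O[𝓝 0] fun u : ℂ => u ^ M) :
    ∃ r C : ℝ, 0 < r ∧ r < 1 ∧ 0 < C ∧
      ∀ u : ℂ, ‖u‖ ≤ r → ‖g u - 1‖ ≤ C * ‖u‖ ^ M ∧ ‖g u - 1‖ ≤ 1 / 2 := by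
  obtain ⟨C, hC, hb⟩ := hgO.exists_pos
  have hlim : Tendsto (fun u : ℂ => C * ‖u‖ ^ M) (𝓝 0) (𝓝 0) := by
    have : Continuous fun u : ℂ => C * ‖u‖ ^ M := by fun_prop
    simpa [show M ≠ 0 by omega] using this.tendsto 0
  have h2 := hlim.eventually (eventually_le_nhds (show (0 : ℝ) < 1 / 2 by norm_num))
  obtain ⟨δ, hδ, hball⟩ := Metric.eventually_nhds_iff_ball.mp (hb.bound.and h2)
  refine ⟨min (δ / 2) (1 / 2), C, by positivity, by
    exact (min_le_right _ _).trans_lt (by norm_num), hC, fun u hu => ?_⟩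
  have hu' : u ∈ Metric.ball (0 : ℂ) δ := by
    have := hu.trans (min_le_left _ _)
    simpa using by linarith
  obtain ⟨h3, h4⟩ := hball u hu'
  rw [norm_pow] at h3
  exact ⟨h3, h3.trans h4⟩

lemma exists_eulerTail {g : ℂ → ℂ} (hg : DifferentiableOn ℂ g (Metric.ball 0 1)) {M : ℕ}
    (hM : 1 ≤ M) (hgO : (fun u => g u - 1) =O[𝓝 0] fun u : ℂ => u ^ M) :
    ∃ (N : ℕ) (H : ℂ → ℂ), DifferentiableOn ℂ H {s | 1 / (M : ℝ) < s.re} ∧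
      (∀ b : ℝ, 1 / (M : ℝ) < b → ∃ m : ℝ, 0 < m ∧ ∀ s : ℂ, b ≤ s.re → m ≤ ‖H s‖) ∧
      ∀ s : ℂ, 1 / (M : ℝ) < s.re →
        HasProd (fun p : Nat.Primes => if (p : ℕ) < N then 1 else g ((p : ℂ) ^ (-s))) (H s) := by
  obtain ⟨r, C, hr0, hr1, hC, hgr⟩ := exists_radius_of_isBigO hM hgO
  have hM' : (0 : ℝ) < M := by exact_mod_cast hM
  have hinv : 0 < 1 / (M : ℝ) := by positivity
  obtain ⟨N, hN⟩ := eventually_atTop.mp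
    (((tendsto_rpow_neg_atTop hinv).comp tendsto_natCast_atTop_atTop).eventually
      (eventually_le_nhds hr0))
  set ℓ : Nat.Primes → ℂ → ℂ := fun p s =>
    if (p : ℕ) < N then 0 else log (1 + (g ((p : ℂ) ^ (-s)) - 1)) with hℓ
  have hsmall : ∀ (p : Nat.Primes) (s : ℂ), N ≤ (p : ℕ) → 1 / (M : ℝ) < s.re →
      ‖((p : ℕ) : ℂ) ^ (-s)‖ ≤ r := fun p s hp hs =>
    (norm_natCast_cpow_neg_le p.2.one_le hs.le).trans (hN p hp)
  have hbound : ∀ (p : Nat.Primes) (s : ℂ) (b : ℝ), 1 / (M : ℝ) < b → b ≤ s.re →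
      ‖ℓ p s‖ ≤ 3 / 2 * C * ((p : ℕ) : ℝ) ^ (-(b * M)) := by
    intro p s b hb hs
    simp only [hℓ]
    split_ifs with h
    · rw [norm_zero]
      positivity
    · push Not at h
      obtain ⟨h1, h2⟩ := hgr _ (hsmall p s h (hb.trans_le hs))
      refine (norm_log_one_add_half_le_self h2).trans ?_
      have h3 : ‖((p : ℕ) : ℂ) ^ (-s)‖ ^ M ≤ ((p : ℕ) : ℝ) ^ (-(b * M)) := by
        rw [← neg_mul, Real.rpow_mul_natCast (by positivity)]
        exact pow_le_pow_left₀ (norm_nonneg _) (norm_natCast_cpow_neg_le p.2.one_le hs) _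
      calc 3 / 2 * ‖g (((p : ℕ) : ℂ) ^ (-s)) - 1‖ ≤ 3 / 2 * (C * ‖((p : ℕ) : ℂ) ^ (-s)‖ ^ M) := by
            gcongr
        _ ≤ 3 / 2 * (C * ((p : ℕ) : ℝ) ^ (-(b * M))) := by gcongr
        _ = _ := by ring
  have hsummable : ∀ b : ℝ, 1 / (M : ℝ) < b →
      Summable fun p : Nat.Primes => 3 / 2 * C * ((p : ℕ) : ℝ) ^ (-(b * M)) := fun b hb => by
    refine (Nat.Primes.summable_rpow.mpr ?_).mul_left _
    rw [div_lt_iff₀ hM'] at hb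
    linarith
  have hdiff : ∀ (p : Nat.Primes), DifferentiableOn ℂ (ℓ p) {s | 1 / (M : ℝ) < s.re} := by
    intro p s hs
    by_cases h : (p : ℕ) < N
    · simp only [hℓ, h, if_true]
      exact differentiableWithinAt_const _
    · simp only [hℓ, h, if_false]
      have h2 := (hgr _ (hsmall p s (not_lt.mp h) hs)).2
      refine DifferentiableWithinAt.clog ?_ (mem_slitPlane_of_norm_lt_one (by linarith))
      refine ((((differentiableOn_comp_natCast_cpow_neg hg p.2.two_le) s ?_).mono ?_).sub_const
        1).const_add 1
      · exact hinv.trans hs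
      · exact fun w hw => hinv.trans hw
  have hopen : ∀ b : ℝ, IsOpen {s : ℂ | b < s.re} := fun b =>
    isOpen_lt continuous_const continuous_re
  refine ⟨N, fun s => exp (∑' p, ℓ p s), ?_, ?_, ?_⟩
  · intro s hs
    obtain ⟨b, hb, hbs⟩ := exists_between (show 1 / (M : ℝ) < s.re from hs)
    have h1 : DifferentiableOn ℂ (fun s => ∑' p, ℓ p s) {s | b < s.re} :=
      differentiableOn_tsum_of_summable_norm (hsummable b hb)
        (fun p => (hdiff p).mono fun w hw => hb.trans hw) (hopen b)
        fun p w hw => hbound p w b hb (le_of_lt hw)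
    exact ((h1.differentiableAt ((hopen b).mem_nhds hbs)).cexp).differentiableWithinAt
  · intro b hb
    refine ⟨Real.exp (-(∑' p : Nat.Primes, 3 / 2 * C * ((p : ℕ) : ℝ) ^ (-(b * M)))),
      Real.exp_pos _, fun s hs => ?_⟩
    rw [norm_exp, Real.exp_le_exp]
    have h1 := tsum_of_norm_bounded (hsummable b hb).hasSum fun p => hbound p s b hb hs
    have h2 := (abs_le.mp ((abs_re_le_norm _).trans h1)).1
    exact h2
  · intro s hs
    obtain ⟨b, hb, hbs⟩ := exists_between hs
    have hsum : Summable fun p => ℓ p s :=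
      Summable.of_norm_bounded (hsummable b hb) fun p => hbound p s b hb hbs.le
    convert hsum.hasSum.cexp using 2 with p
    simp only [Function.comp_apply, hℓ]
    split_ifs with h
    · rw [exp_zero]
    · have h2 := (hgr _ (hsmall p s (not_lt.mp h) hs)).2
      have h0 := slitPlane_ne_zero
        (mem_slitPlane_of_norm_lt_one (show ‖g (((p : ℕ) : ℂ) ^ (-s)) - 1‖ < 1 by linarith))
      rw [exp_log h0, add_sub_cancel]

lemma exists_eulerProduct {g : ℂ → ℂ} (hg : DifferentiableOn ℂ g (Metric.ball 0 1)) {M : ℕ}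
    (hM : 1 ≤ M) (hgO : (fun u => g u - 1) =O[𝓝 0] fun u : ℂ => u ^ M) {b : ℝ}
    (hb : 1 / (M : ℝ) < b) :
    ∃ G L T : ℂ → ℂ, DifferentiableOn ℂ G {s | 1 / (M : ℝ) < s.re} ∧
      (∀ s : ℂ, 1 / (M : ℝ) < s.re →
        HasProd (fun p : Nat.Primes => g ((p : ℂ) ^ (-s))) (G s)) ∧
      Differentiable ℂ L ∧ ExpBddOn L univ ∧ (∀ᶠ σ : ℝ in atTop, L σ ≠ 0) ∧
      DifferentiableOn ℂ T {s | b < s.re} ∧ (∃ m : ℝ, 0 < m ∧ ∀ s : ℂ, b < s.re → m ≤ ‖T s‖) ∧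
      ∀ s : ℂ, b < s.re → G s = L s * T s := by
  have hM' : (0 : ℝ) < M := by exact_mod_cast hM
  have hinv : 0 < 1 / (M : ℝ) := by positivity
  have hb0 : 0 < b := hinv.trans hb
  have hg0 : g 0 ≠ 0 := by
    intro h
    obtain ⟨r, C, hr0, -, -, h1⟩ := exists_radius_of_isBigO hM hgO
    have := (h1 0 (by simpa using hr0.le)).2
    rw [h] at this
    norm_num at this
  obtain ⟨N, H, hHd, hHb, hHp⟩ := exists_eulerTail hg hM hgO
  obtain ⟨P, ψ, m, hm, hP0, hψ, hPψ, hψm⟩ := exists_polynomial_mul_bounded_below hg hg0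
    (r := (2 : ℝ) ^ (-b)) (Real.rpow_lt_one_of_one_lt_of_neg one_lt_two (by linarith))
  obtain ⟨m', hm', hHm⟩ := hHb b hb
  set S : Finset Nat.Primes := (Finset.range N).subtype Nat.Prime with hS
  have hmemS : ∀ p : Nat.Primes, p ∈ S ↔ (p : ℕ) < N := fun p =>
    Finset.mem_subtype.trans Finset.mem_range
  have hz : ∀ (p : Nat.Primes) (s : ℂ), 0 < s.re → ((p : ℕ) : ℂ) ^ (-s) ∈ Metric.ball (0 : ℂ) 1 :=
    fun p s hs => by simpa using norm_natCast_cpow_neg_lt_one p.2.two_le hs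
  refine ⟨fun s => (∏ p ∈ S, g (((p : ℕ) : ℂ) ^ (-s))) * H s,
    fun s => ∏ p ∈ S, P.eval (((p : ℕ) : ℂ) ^ (-s)),
    fun s => (∏ p ∈ S, ψ (((p : ℕ) : ℂ) ^ (-s))) * H s, ?_, ?_, ?_, ?_, ?_, ?_, ?_, ?_⟩
  · refine DifferentiableOn.mul (DifferentiableOn.fun_finsetProd fun p _ => ?_) hHd
    exact (differentiableOn_comp_natCast_cpow_neg hg p.2.two_le).mono fun s hs => hinv.trans hs
  · intro s hs
    have h1 : HasProd (fun p : Nat.Primes => if (p : ℕ) < N then g (((p : ℕ) : ℂ) ^ (-s)) else 1)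
        (∏ p ∈ S, if (p : ℕ) < N then g (((p : ℕ) : ℂ) ^ (-s)) else 1) :=
      hasProd_prod_of_ne_finset_one fun p hp => if_neg (by rwa [← hmemS])
    rw [Finset.prod_congr rfl fun p hp => if_pos ((hmemS p).mp hp)] at h1
    convert h1.mul (hHp s hs) using 2 with p
    split_ifs <;> simp
  · exact Differentiable.fun_finsetProd fun p _ =>
      P.differentiable.comp (differentiable_natCast_cpow_neg p.2.ne_zero)
  · exact ExpBddOn.prod fun p _ => ExpBddOn.polynomial_eval P (.natCast_cpow_neg p.2.one_le)
  · simp only [Finset.prod_ne_zero_iff]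
    refine (Finset.eventually_all S).mpr fun p _ => ?_
    have hlim : Tendsto (fun σ : ℝ => ((p : ℕ) : ℂ) ^ (-(σ : ℂ))) atTop (𝓝 0) := by
      rw [tendsto_zero_iff_norm_tendsto_zero]
      have hp : (1 : ℝ) < (p : ℕ) := by exact_mod_cast p.2.one_lt
      refine ((tendsto_rpow_atTop_of_base_lt_one _
        (by linarith [inv_pos.mpr (zero_lt_one.trans hp)])
        (inv_lt_one_of_one_lt₀ hp)).congr fun σ => ?_)
      rw [norm_natCast_cpow_of_pos p.2.pos, Real.inv_rpow (by positivity), neg_re, ofReal_re,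
        Real.rpow_neg (by positivity)]
    exact (((P.continuous.tendsto 0).comp hlim).eventually_ne hP0)
  · refine DifferentiableOn.mul (DifferentiableOn.fun_finsetProd fun p _ => ?_)
      (hHd.mono fun s hs => hb.trans hs)
    exact (differentiableOn_comp_natCast_cpow_neg hψ p.2.two_le).mono fun s hs => hb0.trans hs
  · refine ⟨m ^ S.card * m', by positivity, fun s hs => ?_⟩
    rw [norm_mul, norm_prod, ← Finset.prod_const]
    refine mul_le_mul (Finset.prod_le_prod (fun _ _ => hm.le) fun p _ => ?_) (hHm s hs.le)
      hm'.le (by positivity)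
    · refine hψm _ ((norm_natCast_cpow_neg_le p.2.one_le hs.le).trans ?_)
      exact Real.rpow_le_rpow_of_nonpos two_pos (by exact_mod_cast p.2.two_le) (by linarith)
  · intro s hs
    simp only [← mul_assoc, ← Finset.prod_mul_distrib]
    congr 1
    exact Finset.prod_congr rfl fun p _ => hPψ _ (hz p s (hb0.trans hs))

lemma abs_le_one_of_multiplicative {f : ℕ → ℤ} {ε : ℕ → ℤ} (hf1 : f 1 = 1)
    (hmul : ∀ m n : ℕ, Nat.Coprime m n → f (m * n) = f m * f n)
    (hεval : ∀ j : ℕ, 1 ≤ j → ε j = -1 ∨ ε j = 0 ∨ ε j = 1)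
    (hfp : ∀ p : ℕ, Nat.Prime p → ∀ j : ℕ, 1 ≤ j → f (p ^ j) = ε j) {n : ℕ} (hn : n ≠ 0) :
    |f n| ≤ 1 := by
  induction n using Nat.recOnPosPrimePosCoprime with
  | prime_pow p n hp h =>
    rw [hfp p hp n h]
    rcases hεval n h with h | h | h <;> simp [h]
  | zero => exact absurd rfl hn
  | one => simp [hf1]
  | coprime a b ha hb hab iha ihb =>
    rw [hmul a b hab, abs_mul]
    exact mul_le_one₀ (iha (by omega)) (abs_nonneg _) (ihb (by omega))

lemma sum_range_mul_pow_eq {ε : ℕ → ℤ} {k : ℕ} (hk : 1 ≤ k)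
    (hεval : ∀ j : ℕ, 1 ≤ j → ε j = -1 ∨ ε j = 0 ∨ ε j = 1)
    (hzero : ∀ j : ℕ, 1 ≤ j → j ≤ k - 1 → ε j = 0) (hεk : ε k = -1) (u : ℂ) :
    ∑ j ∈ Finset.range (2 * k + 1), (if j = 0 then (1 : ℂ) else ε j) * u ^ j =
      1 - u ^ k + ∑ j ∈ Finset.Icc (k + 1) (2 * k) with ε j = 1, u ^ j
        - ∑ j ∈ Finset.Icc (k + 1) (2 * k) with ε j = -1, u ^ j := by
  have h1 : ∀ j ∈ Finset.range (2 * k + 1), (if j = 0 then (1 : ℂ) else ε j) * u ^ j =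
      (if j = 0 then 1 else 0) - (if j = k then u ^ j else 0) +
        (if j ∈ (Finset.Icc (k + 1) (2 * k)).filter (fun j => ε j = 1) then u ^ j else 0) -
        (if j ∈ (Finset.Icc (k + 1) (2 * k)).filter (fun j => ε j = -1) then u ^ j else 0) := by
    intro j hj
    simp only [Finset.mem_filter, Finset.mem_Icc]
    rw [Finset.mem_range] at hj
    rcases Nat.eq_zero_or_pos j with rfl | hj0
    · simp [show ¬ (0 = k) by omega]
    rcases lt_trichotomy j k with h | rfl | h
    · simp [hzero j hj0 (by omega), hj0.ne', h.ne, show ¬ k + 1 ≤ j by omega]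
    · simp [hεk, hj0.ne']
    · have h3 : k + 1 ≤ j ∧ j ≤ 2 * k := by omega
      rcases hεval j hj0 with h2 | h2 | h2 <;> simp [h2, h.ne', hj0.ne', h3]
  have h2 : ∀ p : ℕ → Prop, [DecidablePred p] → Finset.range (2 * k + 1) ∩
      (Finset.Icc (k + 1) (2 * k)).filter p = (Finset.Icc (k + 1) (2 * k)).filter p := by
    intro p _
    refine Finset.inter_eq_right.mpr fun j hj => ?_
    simp only [Finset.mem_filter, Finset.mem_Icc, Finset.mem_range] at hj ⊢
    omega
  rw [Finset.sum_congr rfl h1, Finset.sum_sub_distrib, Finset.sum_add_distrib,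
    Finset.sum_sub_distrib, Finset.sum_ite_mem, Finset.sum_ite_mem, h2, h2, Finset.sum_ite_eq',
    Finset.sum_ite_eq', if_pos (by simp), if_pos (by simp; omega)]

lemma hasProd_LSeries_of_multiplicative {f : ℕ → ℤ} {ε : ℕ → ℤ} (hf1 : f 1 = 1)
    (hmul : ∀ m n : ℕ, Nat.Coprime m n → f (m * n) = f m * f n)
    (hfp : ∀ p : ℕ, Nat.Prime p → ∀ j : ℕ, 1 ≤ j → f (p ^ j) = ε j)
    (hb : ∀ n : ℕ, n ≠ 0 → |f n| ≤ 1) {s : ℂ} (hs : 1 < s.re) :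
    HasProd (fun p : Nat.Primes =>
        ∑' j : ℕ, (if j = 0 then (1 : ℂ) else ε j) * (((p : ℕ) : ℂ) ^ (-s)) ^ j)
      (LSeries (fun n => (f n : ℂ)) s) := by
  have hsum : LSeriesSummable (fun n => (f n : ℂ)) s := by
    refine LSeriesSummable_of_bounded_of_one_lt_re (m := 1) (fun n hn => ?_) hs
    rw [norm_intCast]
    exact_mod_cast hb n hn
  have h1 := EulerProduct.eulerProduct_hasProd (f := LSeries.term (fun n => (f n : ℂ)) s)
    (by simp [hf1]) (fun {m n} hmn => ?_) hsum.norm (by simp)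
  · have h2 : ∀ (p : Nat.Primes) (j : ℕ), LSeries.term (fun n => (f n : ℂ)) s ((p : ℕ) ^ j) =
        (if j = 0 then (1 : ℂ) else ε j) * (((p : ℕ) : ℂ) ^ (-s)) ^ j := by
      intro p j
      have h3 : (((p : ℕ) ^ j : ℕ) : ℂ) ^ s = (((p : ℕ) : ℂ) ^ s) ^ j := by
        induction j with
        | zero => simp
        | succ j ih => rw [pow_succ, Nat.cast_mul, natCast_mul_natCast_cpow, ih, pow_succ]
      rw [LSeries.term_of_ne_zero (pow_ne_zero _ p.2.ne_zero), h3, cpow_neg, inv_pow,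
        div_eq_mul_inv]
      congr 1
      split_ifs with h
      · simp [h, hf1]
      · rw [hfp p p.2 j (Nat.pos_of_ne_zero h)]
    simp only [h2] at h1
    exact h1
  · simp only [LSeries.term_def]
    rcases eq_or_ne m 0 with rfl | hm
    · simp
    rcases eq_or_ne n 0 with rfl | hn
    · simp
    rw [if_neg (mul_ne_zero hm hn), if_neg hm, if_neg hn, hmul m n hmn, Nat.cast_mul,
      natCast_mul_natCast_cpow]
    push_cast
    rw [mul_div_mul_comm]

/-- The Euler product of a Möbius-type fake `μ`, with its zeta factors split off. -/
lemma exists_eulerFactor {f : ℕ → ℤ} {ε : ℕ → ℤ} (hf1 : f 1 = 1)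
    (hmul : ∀ m n : ℕ, Nat.Coprime m n → f (m * n) = f m * f n)
    (hεval : ∀ j : ℕ, 1 ≤ j → ε j = -1 ∨ ε j = 0 ∨ ε j = 1)
    (hfp : ∀ p : ℕ, Nat.Prime p → ∀ j : ℕ, 1 ≤ j → f (p ^ j) = ε j)
    {k : ℕ} (hk : 1 ≤ k) (hzero : ∀ j : ℕ, 1 ≤ j → j ≤ k - 1 → ε j = 0) (hεk : ε k = -1) :
    ∃ g : ℂ → ℂ, DifferentiableOn ℂ g (Metric.ball 0 1) ∧
      ((fun u => g u - 1) =O[𝓝 0] fun u => u ^ (2 * k + 1)) ∧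
      ∀ (s G : ℂ), 1 < s.re → HasProd (fun p : Nat.Primes => g ((p : ℂ) ^ (-s))) G →
        LSeries (fun n => (f n : ℂ)) s * riemannZeta (k * s) *
            ∏ j ∈ Finset.Icc (k + 1) (2 * k) with ε j = -1, riemannZeta (j * s) =
          G * ∏ j ∈ Finset.Icc (k + 1) (2 * k) with ε j = 1, riemannZeta (j * s) := by
  have ha : ∀ j, ‖(if j = 0 then (1 : ℂ) else ε j)‖ ≤ 1 := by
    intro j
    split_ifs with h
    · simp
    · rcases hεval j (Nat.pos_of_ne_zero h) with h | h | h <;> simp [h]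
  have hJ : ∀ p : ℕ → Prop, [DecidablePred p] → ∀ j ∈ (Finset.Icc (k + 1) (2 * k)).filter p,
      k + 1 ≤ j := fun p _ j hj => (Finset.mem_Icc.mp (Finset.mem_filter.mp hj).1).1
  obtain ⟨g, hg, hgO, hgΦ⟩ := exists_correction ha hk (hJ _) (hJ _)
    (sum_range_mul_pow_eq hk hεval hzero hεk)
  refine ⟨g, hg, hgO, fun s G hs hG => ?_⟩
  have hF := hasProd_LSeries_of_multiplicative hf1 hmul hfp
    (fun n hn => abs_le_one_of_multiplicative hf1 hmul hεval hfp hn) hs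
  have hζ : ∀ j : ℕ, 1 ≤ j → HasProd
      (fun p : Nat.Primes => (1 - (((p : ℕ) : ℂ) ^ (-s)) ^ j)⁻¹) (riemannZeta (j * s)) := by
    intro j hj
    have hre : 1 < ((j : ℂ) * s).re := by
      have : (1 : ℝ) ≤ j := by exact_mod_cast hj
      simp only [mul_re, natCast_re, natCast_im, zero_mul, sub_zero]
      nlinarith
    convert riemannZeta_eulerProduct_hasProd hre using 5 with p
    rw [← cpow_nat_mul, mul_neg]
  have hL := (hF.mul (hζ k hk)).mul
    (hasProd_prod fun j (hj : j ∈ (Finset.Icc (k + 1) (2 * k)).filter fun j => ε j = -1) =>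
      hζ j (by have := hJ _ j hj; omega))
  have hR := hG.mul
    (hasProd_prod fun j (hj : j ∈ (Finset.Icc (k + 1) (2 * k)).filter fun j => ε j = 1) =>
      hζ j (by have := hJ _ j hj; omega))
  refine hL.unique ?_
  convert hR using 2 with p
  exact (hgΦ _ (norm_natCast_cpow_neg_lt_one p.2.two_le (by linarith))).symm

lemma AnalyticAt.dslope_of {q : ℂ → ℂ} {a z : ℂ} (ha : AnalyticAt ℂ q a) (hz : AnalyticAt ℂ q z) :
    AnalyticAt ℂ (dslope q a) z := by
  rcases eq_or_ne z a with rfl | h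
  · obtain ⟨p, hp⟩ := ha
    exact ⟨_, hp.has_fpower_series_dslope_fslope⟩
  · have h1 : AnalyticAt ℂ (fun w => (q w - q a) / (w - a)) z :=
      (hz.sub analyticAt_const).div (analyticAt_id.sub analyticAt_const) (sub_ne_zero.mpr h)
    refine h1.congr ?_
    filter_upwards [isOpen_ne.mem_nhds h] with w hw
    rw [dslope_of_ne _ hw, slope_def_field]

lemma im_dslope_ofReal {q : ℂ → ℂ} {τ a : ℝ} (hq : ∀ σ : ℝ, τ < σ → AnalyticAt ℂ q σ)
    (him : ∀ σ : ℝ, τ < σ → (q σ).im = 0) (ha : τ < a) {σ : ℝ} (hσ : τ < σ) :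
    (dslope q a σ).im = 0 := by
  have hne : ∀ x : ℝ, τ < x → x ≠ a → (dslope q a x).im = 0 := fun x hx hxa => by
    rw [dslope_of_ne _ (by exact_mod_cast hxa), slope_def_field, ← ofReal_sub, div_ofReal_im,
      sub_im, him x hx, him a ha, sub_zero, zero_div]
  rcases eq_or_ne σ a with rfl | h
  · have hc : ContinuousAt (fun x : ℝ => (dslope q σ x).im) σ :=
      continuous_im.continuousAt.comp
        (((hq σ hσ).dslope_of (hq σ hσ)).continuousAt.comp continuous_ofReal.continuousAt)
    refine tendsto_nhds_unique (l := 𝓝[≠] σ) (hc.tendsto.mono_left nhdsWithin_le_nhds)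
      (Tendsto.congr' ?_ tendsto_const_nhds)
    filter_upwards [self_mem_nhdsWithin, nhdsWithin_le_nhds (lt_mem_nhds hσ)] with x hx hx'
    exact (hne x hx' hx).symm
  · exact hne σ hσ h

lemma exists_partialFraction {τ : ℝ} {x : ℕ → ℝ} {J : Finset ℕ} (hinj : InjOn x J)
    (hx : ∀ j ∈ J, τ < x j) {N : ℂ → ℂ} (hN : ∀ σ : ℝ, τ < σ → AnalyticAt ℂ N σ)
    (him : ∀ σ : ℝ, τ < σ → (N σ).im = 0) :
    ∃ (c : ℕ → ℝ) (q : ℂ → ℂ), (∀ σ : ℝ, τ < σ → AnalyticAt ℂ q σ) ∧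
      (∀ σ : ℝ, τ < σ → (q σ).im = 0) ∧
      ∀ s : ℂ, (∀ j ∈ J, s ≠ x j) →
        N s = (∏ j ∈ J, (s - x j)) * (q s + ∑ j ∈ J, c j * (1 / (s - x j))) := by
  classical
  induction J using Finset.induction_on with
  | empty => exact ⟨0, N, hN, him, fun s _ => by simp⟩
  | insert a J haJ ih =>
    obtain ⟨c, q, hq, hqim, hNq⟩ := ih (hinj.mono (by simp))
      (fun j hj => hx j (Finset.mem_insert_of_mem hj))
    have hxa := hx a (Finset.mem_insert_self _ _)
    set d : ℕ → ℝ := fun j =>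
      if j = a then (q (x a)).re - ∑ i ∈ J, c i / (x i - x a) else c j / (x j - x a) with hd
    have hda : d a = (q (x a)).re - ∑ i ∈ J, c i / (x i - x a) := if_pos rfl
    have hdj : ∀ j ∈ J, (d j : ℂ) = (c j / (x j - x a) : ℝ) := fun j hj => by
      rw [hd]
      beta_reduce
      rw [if_neg (ne_of_mem_of_not_mem hj haJ)]
    refine ⟨d, dslope q (x a),
      fun σ hσ => (hq _ hxa).dslope_of (hq σ hσ),
      fun σ hσ => im_dslope_ofReal hq hqim hxa hσ, fun s hs => ?_⟩
    have hsa : s - x a ≠ 0 := sub_ne_zero.mpr (hs a (Finset.mem_insert_self _ _))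
    have hqa : ((q (x a)).re : ℂ) = q (x a) := by
      apply Complex.ext <;> simp [hqim _ hxa]
    have hqs : q s = q (x a) + (s - x a) * dslope q (x a) s := by
      have := sub_smul_dslope q (x a : ℂ) s
      rw [smul_eq_mul] at this
      rw [this]
      ring
    have hterm : ∀ j ∈ J, (c j : ℂ) * (1 / (s - x j)) =
        (s - x a) * (d j * (1 / (s - x j)) -
          (c j / (x j - x a) : ℝ) * (1 / (s - x a))) := by
      intro j hj
      have h1 : s - x j ≠ 0 := sub_ne_zero.mpr (hs j (Finset.mem_insert_of_mem hj))
      have h2 : x j - x a ≠ 0 := sub_ne_zero.mpr fun h => haJ (by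
        rwa [← hinj (Finset.mem_insert_of_mem hj) (Finset.mem_insert_self _ _) h])
      have h3 : (x j : ℂ) - x a ≠ 0 := by exact_mod_cast h2
      rw [hdj j hj]
      push_cast
      field_simp
      ring
    rw [hNq s fun j hj => hs j (Finset.mem_insert_of_mem hj), Finset.prod_insert haJ,
      Finset.sum_insert haJ, hda, hqs, Finset.sum_congr rfl hterm, ← Finset.mul_sum,
      Finset.sum_sub_distrib, ← Finset.sum_mul]
    push_cast
    rw [hqa]
    field_simp
    ring

lemma im_eq_zero_of_analyticAt {N : ℂ → ℂ} {τ b : ℝ} (hN : ∀ σ : ℝ, τ < σ → AnalyticAt ℂ N σ)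
    (him : ∀ σ : ℝ, b < σ → (N σ).im = 0) {σ : ℝ} (hσ : τ < σ) : (N σ).im = 0 := by
  have h1 : AnalyticOnNhd ℝ (fun x : ℝ => (N x).im) (Ioi τ) := fun x hx =>
    (imCLM.analyticAt _).comp (hN x hx).comp_ofReal_real
  refine h1.eqOn_zero_of_preconnected_of_eventuallyEq_zero (z₀ := max τ b + 1)
    isPreconnected_Ioi ?_ ?_ hσ
  · exact (le_max_left τ b).trans_lt (lt_add_one _)
  · filter_upwards [lt_mem_nhds ((le_max_right τ b).trans_lt (lt_add_one _))] with x hx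
    exact him x hx

end

section

open Complex Filter Topology Set MeasureTheory

lemma im_mellinIoi_ofReal (A : ℝ → ℝ) (σ : ℝ) : (mellinIoi A σ).im = 0 := by
  have h : mellinIoi A σ = ((∫ x in Ioi (1 : ℝ), A x * x ^ (-(σ + 1)) : ℝ) : ℂ) := by
    rw [mellinIoi, ← integral_complex_ofReal]
    refine setIntegral_congr_fun measurableSet_Ioi fun x hx => ?_
    have hx0 : 0 < x := lt_trans one_pos hx
    rw [show -((σ : ℂ) + 1) = ((-(σ + 1) : ℝ) : ℂ) by push_cast; rfl, ← ofReal_cpow hx0.le,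
      ← ofReal_mul]
  rw [h, ofReal_im]

lemma mellinIoi_sub_sum {A : ℝ → ℝ} (hA : Measurable A) (hAb : ∀ x, 1 < x → |A x| ≤ x)
    {c : ℕ → ℝ} {e : ℕ → ℝ} {I : Finset ℕ} (he : ∀ j ∈ I, e j ≤ 1) {s : ℂ} (hs : 1 < s.re) :
    mellinIoi (fun x => A x - ∑ j ∈ I, c j * x ^ e j) s =
      mellinIoi A s - ∑ j ∈ I, c j * (1 / (s - e j)) := by
  have h1 := integrableOn_mellin_of_norm_le hA (C := 1) (a := 1) (by simpa using hAb) hs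
  have h2 : ∀ j ∈ I, IntegrableOn (fun x : ℝ => (c j : ℂ) * (((x ^ e j : ℝ) : ℂ) *
      (x : ℂ) ^ (-(s + 1)))) (Ioi 1) := fun j hj => by
    refine (integrableOn_mellin_of_norm_le (by fun_prop) (C := 1) (a := 1) (fun x hx => ?_)
      hs).const_mul _
    rw [abs_of_nonneg (by positivity), one_mul]
    exact Real.rpow_le_rpow_of_exponent_le hx.le (he j hj)
  have h3 : ∀ j ∈ I, (c j : ℂ) * (1 / (s - e j)) =
      ∫ x in Ioi (1 : ℝ), (c j : ℂ) * (((x ^ e j : ℝ) : ℂ) * (x : ℂ) ^ (-(s + 1))) := fun j hj => by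
    rw [integral_const_mul, ← mellinIoi_rpow _ ((he j hj).trans_lt hs), mellinIoi]
  rw [Finset.sum_congr rfl h3, ← integral_finsetSum _ h2, mellinIoi, mellinIoi,
    ← integral_sub h1 (integrable_finsetSum _ h2)]
  refine integral_congr_ae (Eventually.of_forall fun x => ?_)
  simp only
  push_cast
  rw [sub_mul, Finset.sum_mul]
  simp only [mul_assoc]

lemma one_lt_re_natCast_mul {j : ℕ} (hj : 1 ≤ j) {s : ℂ} (hs : 1 < s.re) :
    1 < ((j : ℂ) * s).re := by
  have : (1 : ℝ) ≤ j := by exact_mod_cast hj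
  simp only [mul_re, natCast_re, natCast_im, zero_mul, sub_zero]
  nlinarith

lemma exists_main_terms {k : ℕ} (hk : 1 ≤ k) {Jp Jm : Finset ℕ}
    (hJp : Jp ⊆ Finset.Icc (k + 1) (2 * k)) (hJm : Jm ⊆ Finset.Icc (k + 1) (2 * k))
    {A : ℝ → ℝ} (hA : Measurable A) (hAb : ∀ x, 1 < x → |A x| ≤ x) {G : ℂ → ℂ}
    (hG : DifferentiableOn ℂ G {s | 1 / ((2 * k + 1 : ℕ) : ℝ) < s.re})
    (hrel : ∀ s : ℂ, 1 < s.re → s * mellinIoi A s * riemannZeta₁ (k * s) *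
        (∏ j ∈ Jm, riemannZeta₁ (j * s)) * ∏ j ∈ Jp, (j * s - 1) =
      (k * s - 1) * (∏ j ∈ Jm, (j * s - 1)) * (∏ j ∈ Jp, riemannZeta₁ (j * s)) * G s) :
    ∃ c : ℕ → ℝ, (∀ j, j ∉ Jp → c j = 0) ∧
      ∃ q : ℂ → ℂ, (∀ σ : ℝ, 1 / ((2 * k + 1 : ℕ) : ℝ) < σ → AnalyticAt ℂ q σ) ∧
        ∀ s : ℂ, 1 < s.re → mellinIoi (fun x => A x - ∑ j ∈ Finset.Icc (k + 1) (2 * k),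
          c j * x ^ (1 / (j : ℝ))) s = q s := by
  classical
  set τ : ℝ := 1 / ((2 * k + 1 : ℕ) : ℝ) with hτ
  have hτ0 : 0 < τ := by positivity
  have hJp1 : ∀ j ∈ Jp, k + 1 ≤ j ∧ j ≤ 2 * k := fun j hj => Finset.mem_Icc.mp (hJp hj)
  have hJm1 : ∀ j ∈ Jm, k + 1 ≤ j ∧ j ≤ 2 * k := fun j hj => Finset.mem_Icc.mp (hJm hj)
  set D : ℂ → ℂ := fun s => s * riemannZeta₁ (k * s) * (∏ j ∈ Jm, riemannZeta₁ (j * s)) *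
    ∏ j ∈ Jp, (j : ℂ) with hD
  set N : ℂ → ℂ := fun s => (k * s - 1) * (∏ j ∈ Jm, (j * s - 1)) *
    (∏ j ∈ Jp, riemannZeta₁ (j * s)) * G s / D s with hN
  have hjs : ∀ j : ℕ, Differentiable ℂ fun s : ℂ => riemannZeta₁ (j * s) := fun j =>
    differentiable_riemannZeta₁.comp (by fun_prop)
  have hprod0 : ∏ j ∈ Jp, (j : ℂ) ≠ 0 := Finset.prod_ne_zero_iff.mpr fun j hj => by
    have := (hJp1 j hj).1
    exact_mod_cast (by omega : j ≠ 0)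
  have hNan : ∀ σ : ℝ, τ < σ → AnalyticAt ℂ N σ := fun σ hσ => by
    have hσ0 : 0 < σ := hτ0.trans hσ
    have hZ0 : ∀ j : ℕ, 1 ≤ j → riemannZeta₁ ((j : ℂ) * σ) ≠ 0 := fun j hj => by
      have := riemannZeta₁_ofReal_ne_zero (σ := j * σ) (by positivity)
      simpa using this
    have hGan : AnalyticAt ℂ G σ := hG.analyticAt
      ((isOpen_lt continuous_const continuous_re).mem_nhds (by simpa using hσ))
    have h1 : Differentiable ℂ fun s : ℂ => (k * s - 1) * (∏ j ∈ Jm, (j * s - 1)) *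
        (∏ j ∈ Jp, riemannZeta₁ (j * s)) := by
      refine Differentiable.mul (by fun_prop) (Differentiable.fun_finsetProd fun j _ => hjs j)
    have h2 : Differentiable ℂ D := by
      refine Differentiable.mul (Differentiable.mul (differentiable_id.mul (hjs k))
        (Differentiable.fun_finsetProd fun j _ => hjs j)) (by fun_prop)
    refine ((h1.analyticAt _).mul hGan).div (h2.analyticAt _) ?_
    refine mul_ne_zero (mul_ne_zero (mul_ne_zero (by exact_mod_cast hσ0.ne') (hZ0 k hk)) ?_) hprod0
    exact Finset.prod_ne_zero_iff.mpr fun j hj => hZ0 j (by have := hJm1 j hj; omega)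
  have hNeq : ∀ s : ℂ, 1 < s.re → N s = mellinIoi A s * ∏ j ∈ Jp, (s - (1 / (j : ℝ) : ℝ)) := by
    intro s hs
    have hD0 : D s ≠ 0 := by
      refine mul_ne_zero (mul_ne_zero (mul_ne_zero ?_ ?_) ?_) hprod0
      · rintro rfl
        simp at hs
        linarith
      · exact riemannZeta₁_ne_zero_of_one_le_re (one_lt_re_natCast_mul hk hs).le
      · exact Finset.prod_ne_zero_iff.mpr fun j hj => riemannZeta₁_ne_zero_of_one_le_re
          (one_lt_re_natCast_mul (by have := hJm1 j hj; omega) hs).le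
    have h1 : ∏ j ∈ Jp, ((j : ℂ) * s - 1) =
        (∏ j ∈ Jp, (j : ℂ)) * ∏ j ∈ Jp, (s - (1 / (j : ℝ) : ℝ)) := by
      rw [← Finset.prod_mul_distrib]
      refine Finset.prod_congr rfl fun j hj => ?_
      have : (j : ℂ) ≠ 0 := by
        have := (hJp1 j hj).1
        exact_mod_cast (by omega : j ≠ 0)
      push_cast
      field_simp
    simp only [hN]
    rw [div_eq_iff hD0, ← hrel s hs, h1]
    simp only [hD]
    ring
  have hNim : ∀ σ : ℝ, τ < σ → (N σ).im = 0 := fun σ hσ => by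
    refine im_eq_zero_of_analyticAt (b := 1) hNan (fun x hx => ?_) hσ
    rw [hNeq x (by simpa using hx)]
    simp only [← ofReal_sub, ← ofReal_prod]
    rw [im_mul_ofReal, im_mellinIoi_ofReal, zero_mul]
  obtain ⟨c, q, hq, -, hNq⟩ := exists_partialFraction (τ := τ) (x := fun j : ℕ => 1 / (j : ℝ))
    (J := Jp) (fun i _ j _ h => by simpa using h) (fun j hj => by
      have := hJp1 j hj
      have hj0 : 0 < j := by omega
      exact one_div_lt_one_div_of_lt (by exact_mod_cast hj0)
        (by exact_mod_cast (by omega : j < 2 * k + 1))) hNan hNim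
  refine ⟨fun j => if j ∈ Jp then c j else 0, fun j hj => if_neg hj, q, hq, fun s hs => ?_⟩
  rw [mellinIoi_sub_sum hA hAb (fun j hj => ?_) hs]
  · have hsne : ∀ j ∈ Jp, s - (1 / (j : ℝ) : ℝ) ≠ 0 := fun j hj h => by
      have h1 : s.re = 1 / (j : ℝ) := by rw [sub_eq_zero.mp h, ofReal_re]
      have h2 : 1 / (j : ℝ) ≤ 1 := (one_div (j : ℝ)).trans_le (Nat.cast_inv_le_one j)
      linarith
    have h1 := hNq s fun j hj => sub_ne_zero.mp (hsne j hj)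
    rw [hNeq s hs, mul_comm] at h1
    have h2 := mul_left_cancel₀ (Finset.prod_ne_zero_iff.mpr hsne) h1
    rw [h2, sub_eq_iff_eq_add]
    congr 1
    rw [← Finset.sum_subset hJp fun j _ hj => by rw [if_neg hj, ofReal_zero, zero_mul]]
    exact Finset.sum_congr rfl fun j hj => by rw [if_pos hj]
  · exact (one_div (j : ℝ)).trans_le (Nat.cast_inv_le_one j)

lemma convex_setOf_lt_re (b : ℝ) : Convex ℝ {s : ℂ | b < s.re} :=
  convex_halfSpace_re_gt b

lemma isOpen_setOf_lt_re (b : ℝ) : IsOpen {s : ℂ | b < s.re} :=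
  isOpen_lt continuous_const continuous_re

lemma eqOn_of_eqOn_re_gt {f g : ℂ → ℂ} {a b : ℝ} (hf : DifferentiableOn ℂ f {s | a < s.re})
    (hg : DifferentiableOn ℂ g {s | a < s.re}) (h : ∀ s : ℂ, b < s.re → f s = g s) {s : ℂ}
    (hs : a < s.re) : f s = g s := by
  have hz : max a b < ((max a b + 1 : ℝ) : ℂ).re := by simp
  refine (hf.analyticOnNhd (isOpen_setOf_lt_re a)).eqOn_of_preconnected_of_eventuallyEq
    (hg.analyticOnNhd (isOpen_setOf_lt_re a)) (convex_setOf_lt_re a).isPreconnected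
    ((le_max_left a b).trans_lt hz) ?_ hs
  filter_upwards [(isOpen_setOf_lt_re b).mem_nhds ((le_max_right a b).trans_lt hz)] with z hz'
  exact h z hz'

lemma tendsto_sub_mul_of_forall_le {Y : ℂ → ℂ} {θ : ℝ}
    (hYb : ∀ ε : ℝ, 0 < ε → ∃ C : ℝ, 0 ≤ C ∧ ∀ s : ℂ, θ < s.re → ‖Y s‖ ≤ ε / (s.re - θ) + C)
    (t : ℝ) : Tendsto (fun σ : ℝ => ((σ - θ : ℝ) : ℂ) * Y (σ + t * I)) (𝓝[>] θ) (𝓝 0) := by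
  rw [Metric.tendsto_nhds]
  intro δ hδ
  obtain ⟨C, hC, hb⟩ := hYb (δ / 2) (by positivity)
  have h1 : Tendsto (fun σ : ℝ => C * (σ - θ)) (𝓝[>] θ) (𝓝 0) := by
    have : Continuous fun σ : ℝ => C * (σ - θ) := by fun_prop
    simpa using (this.tendsto θ).mono_left nhdsWithin_le_nhds
  filter_upwards [h1.eventually (gt_mem_nhds (half_pos hδ)), self_mem_nhdsWithin] with σ h2 hσ
  have hσ' : 0 < σ - θ := sub_pos.mpr hσ
  rw [dist_zero_right, norm_mul, norm_real, Real.norm_eq_abs, abs_of_pos hσ']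
  have h3 := hb (σ + t * I) (by simpa using hσ)
  rw [show ((σ : ℂ) + t * I).re = σ by simp] at h3
  calc (σ - θ) * ‖Y (σ + t * I)‖ ≤ (σ - θ) * (δ / 2 / (σ - θ) + C) := by gcongr
    _ = δ / 2 + C * (σ - θ) := by field_simp
    _ < δ := by linarith

lemma exists_numerator_continuation {k : ℕ} {Jp Jm : Finset ℕ} (hk : 1 ≤ k)
    (hJp : Jp ⊆ Finset.Icc (k + 1) (2 * k)) {A : ℝ → ℝ} (hA : Measurable A)
    (hAb : ∀ x, 1 < x → |A x| ≤ x) {G : ℂ → ℂ} {θ : ℝ}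
    (hG : DifferentiableOn ℂ G {s | θ < s.re})
    (hrel : ∀ s : ℂ, 1 < s.re → s * mellinIoi A s * riemannZeta₁ (k * s) *
        (∏ j ∈ Jm, riemannZeta₁ (j * s)) * ∏ j ∈ Jp, (j * s - 1) =
      (k * s - 1) * (∏ j ∈ Jm, (j * s - 1)) * (∏ j ∈ Jp, riemannZeta₁ (j * s)) * G s)
    {c : ℕ → ℝ} (hc : ∀ j, j ∉ Jp → c j = 0) {Y : ℂ → ℂ}
    (hY : DifferentiableOn ℂ Y {s | θ < s.re})
    (hYE : ∀ s : ℂ, 1 < s.re → mellinIoi (fun x => A x - ∑ j ∈ Finset.Icc (k + 1) (2 * k),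
          c j * x ^ (1 / (j : ℝ))) s = Y s)
    (hYb : ∀ ε : ℝ, 0 < ε → ∃ C : ℝ, 0 ≤ C ∧ ∀ s : ℂ, θ < s.re → ‖Y s‖ ≤ ε / (s.re - θ) + C) :
    ∃ K : ℂ → ℂ, DifferentiableOn ℂ K {s | θ < s.re} ∧
      (∀ s : ℂ, θ < s.re → K s * riemannZeta₁ (k * s) * (∏ j ∈ Jm, riemannZeta₁ (j * s)) =
        (k * s - 1) * (∏ j ∈ Jm, (j * s - 1)) * (∏ j ∈ Jp, riemannZeta₁ (j * s)) * G s) ∧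
      (∃ C : ℝ, 0 ≤ C ∧ ∀ s : ℂ, θ < s.re →
        ‖K s‖ ≤ Real.exp (C * (1 + ‖s‖)) * (1 + 1 / (s.re - θ))) ∧
      ∀ t : ℝ, Tendsto (fun σ : ℝ => ((σ - θ : ℝ) : ℂ) * K (σ + t * I)) (𝓝[>] θ) (𝓝 0) := by
  classical
  set a : ℂ → ℂ := fun s => s * ∏ j ∈ Jp, ((j : ℂ) * s - 1) with ha
  set b : ℂ → ℂ := fun s => s * ∑ j ∈ Jp, (c j : ℂ) * (j * ∏ i ∈ Jp.erase j, ((i : ℂ) * s - 1))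
    with hb
  have had : Differentiable ℂ a := by fun_prop
  have hbd : Differentiable ℂ b := by fun_prop
  have hlin : ∀ j : ℕ, ExpBddOn (fun s => (j : ℂ) * s - 1) univ := fun j =>
    ((ExpBddOn.const _).mul .id).sub (.const _)
  obtain ⟨C₁, hC₁, hC₁b⟩ : ExpBddOn a univ := ExpBddOn.id.mul (.prod fun j _ => hlin j)
  obtain ⟨C₂, hC₂, hC₂b⟩ : ExpBddOn b univ := ExpBddOn.id.mul
    (.sum fun j _ => (ExpBddOn.const _).mul ((ExpBddOn.const _).mul (.prod fun i _ => hlin i)))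
  have hjs : ∀ j : ℕ, Differentiable ℂ fun s : ℂ => riemannZeta₁ (j * s) := fun j =>
    differentiable_riemannZeta₁.comp (by fun_prop)
  have hKd : DifferentiableOn ℂ (fun s => a s * Y s + b s) {s | θ < s.re} :=
    (had.differentiableOn.mul hY).add hbd.differentiableOn
  refine ⟨fun s => a s * Y s + b s, hKd, fun s hs => ?_, ?_, fun t => ?_⟩
  · refine eqOn_of_eqOn_re_gt (b := 1) (a := θ)
      (f := fun s => (a s * Y s + b s) * riemannZeta₁ (k * s) *
        (∏ j ∈ Jm, riemannZeta₁ (j * s)))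
      (g := fun s => (k * s - 1) * (∏ j ∈ Jm, (j * s - 1)) *
        (∏ j ∈ Jp, riemannZeta₁ (j * s)) * G s)
      ((hKd.mul (hjs k).differentiableOn).mul
        (Differentiable.fun_finsetProd fun j _ => hjs j).differentiableOn) ?_ (fun z hz => ?_) hs
    · refine DifferentiableOn.mul (Differentiable.differentiableOn ?_) hG
      exact Differentiable.mul (by fun_prop) (Differentiable.fun_finsetProd fun j _ => hjs j)
    · show (a z * Y z + b z) * riemannZeta₁ (k * z) * (∏ j ∈ Jm, riemannZeta₁ (j * z)) = _
      rw [← hrel z hz]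
      have h1 := mellinIoi_sub_sum hA hAb (c := c) (e := fun j => 1 / (j : ℝ))
        (I := Finset.Icc (k + 1) (2 * k))
        (fun j _ => (one_div (j : ℝ)).trans_le (Nat.cast_inv_le_one j)) hz
      rw [hYE z hz, ← Finset.sum_subset hJp fun j _ hj => by rw [hc j hj, ofReal_zero, zero_mul]]
        at h1
      have h2 : ∀ j ∈ Jp, (c j : ℂ) * (1 / (z - (1 / (j : ℝ) : ℝ))) *
          (∏ i ∈ Jp, ((i : ℂ) * z - 1)) =
          (c j : ℂ) * (j * ∏ i ∈ Jp.erase j, ((i : ℂ) * z - 1)) := fun j hj => by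
        have hj1 : 1 ≤ j := by
          have := (Finset.mem_Icc.mp (hJp hj)).1
          omega
        have hj0 : (j : ℂ) ≠ 0 := by exact_mod_cast (by omega : j ≠ 0)
        have h3 : (j : ℂ) * z - 1 ≠ 0 := fun h => by
          have h4 := one_lt_re_natCast_mul hj1 hz
          rw [sub_eq_zero.mp h, one_re] at h4
          exact lt_irrefl _ h4
        have h5 : z - (1 / (j : ℝ) : ℝ) = ((j : ℂ) * z - 1) / j := by
          push_cast
          field_simp
        rw [← Finset.mul_prod_erase _ _ hj, h5]
        field_simp
      have h3 : Y z * (∏ i ∈ Jp, ((i : ℂ) * z - 1)) +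
          ∑ j ∈ Jp, (c j : ℂ) * (j * ∏ i ∈ Jp.erase j, ((i : ℂ) * z - 1)) =
          mellinIoi A z * ∏ i ∈ Jp, ((i : ℂ) * z - 1) := by
        rw [← Finset.sum_congr rfl h2, ← Finset.sum_mul, h1]
        ring
      have h4 : a z * Y z + b z = z * (mellinIoi A z * ∏ i ∈ Jp, ((i : ℂ) * z - 1)) := by
        rw [← h3]
        simp only [ha, hb]
        ring
      rw [h4]
      ring
  · obtain ⟨C₀, hC₀, hY₀⟩ := hYb 1 one_pos
    refine ⟨C₁ + C₂ + C₀ + 1, by positivity, fun s hs => ?_⟩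
    have hp : 0 < 1 / (s.re - θ) := one_div_pos.mpr (sub_pos.mpr hs)
    have e0 : 0 ≤ ‖s‖ := norm_nonneg s
    have e3 : 1 + C₀ ≤ Real.exp (C₀ * (1 + ‖s‖)) := by
      nlinarith [Real.add_one_le_exp (C₀ * (1 + ‖s‖)), mul_nonneg hC₀ e0]
    have e4 : 2 ≤ Real.exp (1 * (1 + ‖s‖)) := by
      linarith [Real.add_one_le_exp (1 * (1 + ‖s‖))]
    have e5 : 1 ≤ Real.exp (C₁ * (1 + ‖s‖)) := Real.one_le_exp (by positivity)
    have e6 : 1 ≤ Real.exp (C₂ * (1 + ‖s‖)) := Real.one_le_exp (by positivity)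
    have e7 : ‖Y s‖ ≤ Real.exp (C₀ * (1 + ‖s‖)) * (1 + 1 / (s.re - θ)) := by
      nlinarith [hY₀ s hs]
    rw [add_mul, add_mul, add_mul, Real.exp_add, Real.exp_add, Real.exp_add]
    set x₀ := Real.exp (C₀ * (1 + ‖s‖))
    set x₁ := Real.exp (C₁ * (1 + ‖s‖))
    set x₂ := Real.exp (C₂ * (1 + ‖s‖))
    set x₃ := Real.exp (1 * (1 + ‖s‖))
    set w := 1 + 1 / (s.re - θ)
    have hw : 1 ≤ w := by simp only [w]; linarith
    have hx₀ : 1 ≤ x₀ := by linarith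
    have f1 : ‖a s‖ * ‖Y s‖ ≤ x₁ * (x₀ * w) :=
      mul_le_mul (hC₁b s (mem_univ s)) e7 (norm_nonneg _) (by linarith)
    have f2 : x₁ * (x₀ * w) ≤ x₁ * x₂ * x₀ * w := by
      have : 0 ≤ x₁ * (x₀ * w) := by positivity
      nlinarith
    have f3 : x₂ ≤ x₁ * x₂ * x₀ * w := by
      have g1 : 1 ≤ x₁ * x₀ * w := one_le_mul_of_one_le_of_one_le
        (one_le_mul_of_one_le_of_one_le e5 hx₀) hw
      nlinarith
    have f4 : 0 ≤ x₁ * x₂ * x₀ * w := by positivity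
    calc ‖a s * Y s + b s‖ ≤ ‖a s‖ * ‖Y s‖ + ‖b s‖ := by
          rw [← norm_mul]
          exact norm_add_le _ _
      _ ≤ 2 * (x₁ * x₂ * x₀ * w) := by linarith [hC₂b s (mem_univ s)]
      _ ≤ x₃ * (x₁ * x₂ * x₀ * w) := by gcongr
      _ = _ := by ring
  · have h1 := tendsto_sub_mul_of_forall_le hYb t
    have hline : Continuous fun σ : ℝ => (σ : ℂ) + t * I := by fun_prop
    have h2 := ((had.continuous.comp hline).tendsto θ).mono_left
      (nhdsWithin_le_nhds (s := Ioi θ))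
    have h3 : Tendsto (fun σ : ℝ => ((σ - θ : ℝ) : ℂ) * b (σ + t * I)) (𝓝[>] θ) (𝓝 0) := by
      have : Continuous fun σ : ℝ => ((σ - θ : ℝ) : ℂ) * b (σ + t * I) :=
        (by fun_prop : Continuous fun σ : ℝ => ((σ - θ : ℝ) : ℂ)).mul (hbd.continuous.comp hline)
      simpa using (this.tendsto θ).mono_left (nhdsWithin_le_nhds (s := Ioi θ))
    have h4 := (h2.mul h1).add h3
    rw [mul_zero, zero_add] at h4
    refine h4.congr fun σ => ?_
    simp only [Function.comp_apply]
    ring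

end

section

open Complex Filter Topology Set

/-- On `σ < re s`, the function `riemannZeta₁` divides an entire function of exponential type, with
a cofactor of exponential growth. -/
def HasZetaCofactor (σ : ℝ) : Prop :=
  ∃ L T : ℂ → ℂ, Differentiable ℂ L ∧ ExpBddOn L univ ∧ (∀ᶠ x : ℝ in atTop, L x ≠ 0) ∧
    DifferentiableOn ℂ T {s | σ < s.re} ∧ ExpBddOn T {s | σ < s.re} ∧
    ∀ s : ℂ, σ < s.re → riemannZeta₁ s * T s = L s

lemma HasZetaCofactor.mono {σ σ' : ℝ} (h : HasZetaCofactor σ) (hσ : σ ≤ σ') :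
    HasZetaCofactor σ' := by
  obtain ⟨L, T, hL, hLb, hL0, hT, hTb, hLT⟩ := h
  have hsub : {s : ℂ | σ' < s.re} ⊆ {s | σ < s.re} := fun s hs => lt_of_le_of_lt hσ hs
  exact ⟨L, T, hL, hLb, hL0, hT.mono hsub, hTb.mono hsub, fun s hs => hLT s (hsub hs)⟩

lemma hasZetaCofactor_two : HasZetaCofactor 2 := by
  have h0 : ∀ s : ℂ, 2 < s.re → riemannZeta₁ s ≠ 0 := fun s hs =>
    riemannZeta₁_ne_zero_of_one_le_re (by linarith)
  refine ⟨fun _ => 1, fun s => (riemannZeta₁ s)⁻¹, differentiable_const _, .const _,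
    Eventually.of_forall fun _ => one_ne_zero,
    differentiable_riemannZeta₁.differentiableOn.inv h0, ?_, fun s hs => mul_inv_cancel₀ (h0 s hs)⟩
  obtain ⟨C, hC, hb⟩ := norm_inv_riemannZeta₁_le
  exact ⟨C, hC, fun s hs => hb s (le_of_lt hs)⟩

lemma re_ofReal_mul_pos_ge {r : ℝ} (hr : 1 ≤ r) {s : ℂ} {b : ℝ} (hb : 0 ≤ b) (hs : b < s.re) :
    b < ((r : ℂ) * s).re := by
  rw [re_ofReal_mul]
  nlinarith

section

variable {k : ℕ} {Jp Jm : Finset ℕ} {K L₀ T₀ : ℂ → ℂ} {m : ℝ}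

lemma HasZetaCofactor.step (hk : 1 ≤ k) (hJp : Jp ⊆ Finset.Icc (k + 1) (2 * k))
    (hJm : Jm ⊆ Finset.Icc (k + 1) (2 * k))
    (hKrel : ∀ s : ℂ, 1 / (2 * k : ℝ) < s.re →
      K s * riemannZeta₁ (k * s) * (∏ j ∈ Jm, riemannZeta₁ (j * s)) =
        (k * s - 1) * (∏ j ∈ Jm, (j * s - 1)) * (∏ j ∈ Jp, riemannZeta₁ (j * s)) *
          (L₀ s * T₀ s))
    (hL₀ : Differentiable ℂ L₀) (hL₀b : ExpBddOn L₀ univ) (hL₀0 : ∀ᶠ x : ℝ in atTop, L₀ x ≠ 0)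
    (hT₀ : DifferentiableOn ℂ T₀ {s | 1 / (2 * k : ℝ) < s.re}) (hm : 0 < m)
    (hmT : ∀ s : ℂ, 1 / (2 * k : ℝ) < s.re → m ≤ ‖T₀ s‖)
    {σ σ' : ℝ} (h : HasZetaCofactor σ) (hσ' : 1 / 2 ≤ σ') (hσσ' : σ ≤ σ' * ((k + 1) / k)) :
    ∃ L B : ℂ → ℂ, Differentiable ℂ L ∧ ExpBddOn L univ ∧ (∀ᶠ x : ℝ in atTop, L x ≠ 0) ∧
      DifferentiableOn ℂ B {s | σ' < s.re} ∧ ExpBddOn B {s | σ' < s.re} ∧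
      ∀ s : ℂ, σ' < s.re → riemannZeta₁ s * (K ((1 / k : ℝ) * s) * B s) = L s := by
  obtain ⟨L, T, hL, hLb, hL0, hT, hTb, hLT⟩ := h
  have hk0 : (0 : ℝ) < k := by exact_mod_cast hk
  have hkC : (k : ℂ) ≠ 0 := by exact_mod_cast hk0.ne'
  have hr : ∀ j : ℕ, k + 1 ≤ j → 1 < (j / k : ℝ) := fun j hj => by
    rw [one_lt_div hk0]
    exact_mod_cast hj
  have hJp1 : ∀ j ∈ Jp, k + 1 ≤ j := fun j hj => (Finset.mem_Icc.mp (hJp hj)).1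
  have hJm1 : ∀ j ∈ Jm, k + 1 ≤ j := fun j hj => (Finset.mem_Icc.mp (hJm hj)).1
  have hjs : ∀ (j : ℕ) (s : ℂ), (j : ℂ) * ((1 / k : ℝ) * s) = ((j / k : ℝ) : ℂ) * s := fun j s => by
    push_cast
    ring
  have hκ : ∀ s : ℂ, σ' < s.re → 1 / (2 * k : ℝ) < (((1 / k : ℝ) : ℂ) * s).re := fun s hs => by
    rw [re_ofReal_mul, div_mul_eq_mul_div, one_mul, div_lt_div_iff₀ (by positivity) hk0]
    nlinarith
  have hσj : ∀ j ∈ Jp, ∀ s : ℂ, σ' < s.re → σ < (((j / k : ℝ) : ℂ) * s).re := fun j hj s hs => by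
    rw [re_ofReal_mul]
    have h1 : ((k + 1) / k : ℝ) ≤ j / k := by
      gcongr
      exact_mod_cast hJp1 j hj
    have h2 : 0 < ((k + 1) / k : ℝ) := by positivity
    nlinarith
  have hdlin : ∀ r : ℝ, Differentiable ℂ fun s : ℂ => (r : ℂ) * s := fun r => by fun_prop
  refine ⟨fun s => (s - 1) * (∏ j ∈ Jm, (((j / k : ℝ) : ℂ) * s - 1)) *
      (∏ j ∈ Jp, L (((j / k : ℝ) : ℂ) * s)) * L₀ ((1 / k : ℝ) * s),
    fun s => (∏ j ∈ Jm, riemannZeta₁ (((j / k : ℝ) : ℂ) * s)) *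
      (∏ j ∈ Jp, T (((j / k : ℝ) : ℂ) * s)) * (T₀ ((1 / k : ℝ) * s))⁻¹, ?_, ?_, ?_, ?_, ?_, ?_⟩
  · refine Differentiable.mul (Differentiable.mul (by fun_prop)
      (Differentiable.fun_finsetProd fun j _ => hL.comp (hdlin _))) (hL₀.comp (hdlin _))
  · refine ExpBddOn.mul (ExpBddOn.mul (ExpBddOn.mul (ExpBddOn.id.sub (.const _))
      (.prod fun j _ => ((ExpBddOn.const _).mul .id).sub (.const _)))
      (.prod fun j _ => hLb.comp_const_mul _ fun _ _ => mem_univ _))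
      (hL₀b.comp_const_mul _ fun _ _ => mem_univ _)
  · have htend : ∀ r : ℝ, 0 < r → Tendsto (fun x : ℝ => r * x) atTop atTop := fun r hr =>
      tendsto_id.const_mul_atTop hr
    have h1 : ∀ᶠ x : ℝ in atTop, ∀ j ∈ Jp, L (((j / k : ℝ) * x : ℝ) : ℂ) ≠ 0 :=
      (Finset.eventually_all Jp).mpr fun j hj =>
        (htend _ (zero_lt_one.trans (hr j (hJp1 j hj)))).eventually hL0
    have h2 := (htend (1 / k : ℝ) (by positivity)).eventually hL₀0
    filter_upwards [h1, h2, eventually_gt_atTop 1] with x hx1 hx2 hx3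
    rw [ofReal_mul] at hx2
    refine mul_ne_zero (mul_ne_zero (mul_ne_zero ?_ ?_) ?_) hx2
    · rw [sub_ne_zero]
      exact_mod_cast hx3.ne'
    · refine Finset.prod_ne_zero_iff.mpr fun j hj => ?_
      rw [sub_ne_zero, ← ofReal_mul]
      have := hr j (hJm1 j hj)
      have h3 : 1 < (j / k : ℝ) * x := by nlinarith
      exact_mod_cast h3.ne'
    · refine Finset.prod_ne_zero_iff.mpr fun j hj => ?_
      rw [← ofReal_mul]
      exact hx1 j hj
  · refine DifferentiableOn.mul (DifferentiableOn.mul ?_ ?_) ?_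
    · exact (Differentiable.fun_finsetProd fun j _ =>
        differentiable_riemannZeta₁.comp (hdlin _)).differentiableOn
    · exact DifferentiableOn.fun_finsetProd fun j hj =>
        hT.comp (hdlin _).differentiableOn fun s hs => hσj j hj s hs
    · refine DifferentiableOn.inv (hT₀.comp (hdlin _).differentiableOn fun s hs => hκ s hs)
        fun s hs h0 => ?_
      have := hmT _ (hκ s hs)
      rw [h0, norm_zero] at this
      linarith
  · refine ExpBddOn.mul (ExpBddOn.mul (.prod fun j hj => ?_) (.prod fun j hj => ?_)) ?_
    · have hZ : ExpBddOn riemannZeta₁ {s | 1 / 2 ≤ s.re} := norm_riemannZeta₁_le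
      refine hZ.comp_const_mul _ fun s hs => ?_
      exact (re_ofReal_mul_pos_ge (hr j (hJm1 j hj)).le (by norm_num) (hσ'.trans_lt hs)).le
    · exact hTb.comp_const_mul _ fun s hs => hσj j hj s hs
    · refine ExpBddOn.of_norm_le (A := m⁻¹) fun s hs => ?_
      rw [norm_inv]
      exact inv_anti₀ hm (hmT _ (hκ s hs))
  · intro s hs
    have h1 := hKrel _ (hκ s hs)
    simp only [hjs] at h1
    have hks : ((k / k : ℝ) : ℂ) * s = s := by rw [div_self hk0.ne', ofReal_one, one_mul]
    rw [hks] at h1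
    have hT0 : T₀ ((1 / k : ℝ) * s) ≠ 0 := fun h0 => by
      have := hmT _ (hκ s hs)
      rw [h0, norm_zero] at this
      linarith
    have h2 : ∏ j ∈ Jp, L (((j / k : ℝ) : ℂ) * s) =
        (∏ j ∈ Jp, riemannZeta₁ (((j / k : ℝ) : ℂ) * s)) * ∏ j ∈ Jp, T (((j / k : ℝ) : ℂ) * s) := by
      rw [← Finset.prod_mul_distrib]
      exact Finset.prod_congr rfl fun j hj => (hLT _ (hσj j hj s hs)).symm
    beta_reduce
    rw [h2, show ∀ z x a b c : ℂ, z * (x * (a * b * c)) = (x * z * a) * b * c by intros; ring, h1,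
      show ∀ a b w t : ℂ, a * (b * w) * t * w⁻¹ = a * t * b * (w * w⁻¹) by intros; ring,
      mul_inv_cancel₀ hT0, mul_one]
    ring

lemma numerator_continuation_false (hk : 1 ≤ k) (hJp : Jp ⊆ Finset.Icc (k + 1) (2 * k))
    (hJm : Jm ⊆ Finset.Icc (k + 1) (2 * k))
    (hKrel : ∀ s : ℂ, 1 / (2 * k : ℝ) < s.re →
      K s * riemannZeta₁ (k * s) * (∏ j ∈ Jm, riemannZeta₁ (j * s)) =
        (k * s - 1) * (∏ j ∈ Jm, (j * s - 1)) * (∏ j ∈ Jp, riemannZeta₁ (j * s)) *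
          (L₀ s * T₀ s))
    (hL₀ : Differentiable ℂ L₀) (hL₀b : ExpBddOn L₀ univ) (hL₀0 : ∀ᶠ x : ℝ in atTop, L₀ x ≠ 0)
    (hT₀ : DifferentiableOn ℂ T₀ {s | 1 / (2 * k : ℝ) < s.re}) (hm : 0 < m)
    (hmT : ∀ s : ℂ, 1 / (2 * k : ℝ) < s.re → m ≤ ‖T₀ s‖)
    (hK : DifferentiableOn ℂ K {s | 1 / (2 * k : ℝ) < s.re})
    (hKb : ∃ C : ℝ, 0 ≤ C ∧ ∀ s : ℂ, 1 / (2 * k : ℝ) < s.re →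
        ‖K s‖ ≤ Real.exp (C * (1 + ‖s‖)) * (1 + 1 / (s.re - 1 / (2 * k : ℝ))))
    (hKlim : ∀ t : ℝ, Tendsto (fun σ : ℝ => ((σ - 1 / (2 * k : ℝ) : ℝ) : ℂ) * K (σ + t * I))
      (𝓝[>] (1 / (2 * k : ℝ))) (𝓝 0)) : False := by
  have hk0 : (0 : ℝ) < k := by exact_mod_cast hk
  have hstep : ∀ {σ σ' : ℝ}, HasZetaCofactor σ → 1 / 2 ≤ σ' → σ ≤ σ' * ((k + 1) / k) → _ :=
    fun {σ σ'} => HasZetaCofactor.step hk hJp hJm hKrel hL₀ hL₀b hL₀0 hT₀ hm hmT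
  have hκ : ∀ s : ℂ, 1 / 2 < s.re → 1 / (2 * k : ℝ) < (((1 / k : ℝ) : ℂ) * s).re := fun s hs => by
    rw [re_ofReal_mul, div_mul_eq_mul_div, one_mul, div_lt_div_iff₀ (by positivity) hk0]
    nlinarith
  have hKκ : DifferentiableOn ℂ (fun s => K ((1 / k : ℝ) * s)) {s | 1 / 2 < s.re} :=
    hK.comp (by fun_prop : Differentiable ℂ fun s : ℂ => ((1 / k : ℝ) : ℂ) * s).differentiableOn
      fun s hs => hκ s hs
  obtain ⟨C, hC, hKκb⟩ : ∃ C : ℝ, 0 ≤ C ∧ ∀ s : ℂ, 1 / 2 < s.re →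
      ‖K ((1 / k : ℝ) * s)‖ ≤ Real.exp (C * (1 + ‖s‖)) * (1 + 1 / (s.re - 1 / 2)) := by
    obtain ⟨C, hC, hb⟩ := hKb
    refine ⟨C + k, by positivity, fun s hs => (hb _ (hκ s hs)).trans ?_⟩
    have hp : 0 < s.re - 1 / 2 := sub_pos.mpr hs
    have h1 : 1 / ((((1 / k : ℝ) : ℂ) * s).re - 1 / (2 * k : ℝ)) = k * (1 / (s.re - 1 / 2)) := by
      rw [re_ofReal_mul]
      field_simp
    have h2 : ‖((1 / k : ℝ) : ℂ) * s‖ ≤ ‖s‖ := by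
      rw [norm_mul, norm_real, Real.norm_eq_abs, abs_of_pos (by positivity)]
      refine mul_le_of_le_one_left (norm_nonneg s) ?_
      rw [div_le_one hk0]
      exact_mod_cast hk
    have h3 : (1 + k : ℝ) ≤ Real.exp (k * (1 + ‖s‖)) := by
      nlinarith [Real.add_one_le_exp (k * (1 + ‖s‖)), norm_nonneg s]
    rw [h1, add_mul, Real.exp_add, mul_assoc]
    have h4 : 0 < 1 / (s.re - 1 / 2) := by positivity
    refine mul_le_mul (by gcongr) ?_ (by positivity) (by positivity)
    calc 1 + k * (1 / (s.re - 1 / 2)) ≤ (1 + k) * (1 + 1 / (s.re - 1 / 2)) := by nlinarith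
      _ ≤ _ := by gcongr
  have hmid : ∀ {σ σ' : ℝ}, HasZetaCofactor σ → 1 / 2 < σ' → σ ≤ σ' * ((k + 1) / k) →
      HasZetaCofactor σ' := by
    intro σ σ' h h1 h2
    obtain ⟨L, B, hL, hLb, hL0, hB, hBb, hLB⟩ := hstep h h1.le h2
    refine ⟨L, fun s => K ((1 / k : ℝ) * s) * B s, hL, hLb, hL0,
      (hKκ.mono fun s hs => h1.trans hs).mul hB, ExpBddOn.mul ?_ hBb, hLB⟩
    have h3 : ExpBddOn (fun s : ℂ => ((1 + 1 / (σ' - 1 / 2) : ℝ) : ℂ)) {s | σ' < s.re} := .const _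
    obtain ⟨D, hD, hDb⟩ := h3
    refine ⟨C + D, by positivity, fun s hs => (hKκb s (h1.trans hs)).trans ?_⟩
    rw [add_mul, Real.exp_add]
    gcongr
    refine le_trans ?_ (hDb s hs)
    rw [norm_real]
    refine le_trans ?_ (Real.le_norm_self _)
    have h4 : 0 < σ' - 1 / 2 := sub_pos.mpr h1
    have h5 : σ' < s.re := hs
    gcongr
  set ρ : ℝ := k / (k + 1) with hρ
  set σs : ℝ := (k + 1) / (2 * k) with hσs
  have hσs2 : 1 / 2 < σs := by
    rw [hσs, div_lt_div_iff₀ two_pos (by positivity)]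
    linarith
  have hρ0 : 0 < ρ := by positivity
  have hρ1 : ρ < 1 := by
    rw [hρ, div_lt_one (by positivity)]
    linarith
  have hρinv : ρ * ((k + 1) / k) = 1 := by
    rw [hρ]
    field_simp
  have hinv1 : 1 ≤ ((k + 1) / k : ℝ) := by
    rw [one_le_div hk0]
    linarith
  have hall : ∀ n : ℕ, HasZetaCofactor (max (2 * ρ ^ n) σs) := by
    intro n
    induction n with
    | zero => exact hasZetaCofactor_two.mono (by simp)
    | succ n ih =>
      refine hmid ih (hσs2.trans_le (le_max_right _ _)) (max_le ?_ ?_)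
      · calc 2 * ρ ^ n = 2 * ρ ^ (n + 1) * ((k + 1) / k) := by
              rw [pow_succ, mul_assoc, mul_assoc, hρinv, mul_one]
          _ ≤ _ := by
              gcongr
              exact le_max_left _ _
      · have h1 : σs ≤ max (2 * ρ ^ (n + 1)) σs := le_max_right _ _
        nlinarith
  obtain ⟨n, hn⟩ := exists_pow_lt_of_lt_one (show (0 : ℝ) < 1 / 4 by norm_num) hρ1
  have hlast : HasZetaCofactor σs := (hall n).mono (max_le (by linarith) le_rfl)
  obtain ⟨L, B, hL, ⟨C₁, hC₁, hLb⟩, hL0, hB, ⟨C₂, hC₂, hBb⟩, hLB⟩ := hstep hlast le_rfl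
    (show σs ≤ 1 / 2 * ((k + 1) / k) by
      rw [hσs]
      refine le_of_eq ?_
      field_simp)
  refine riemannZeta₁_cofactor_false hL (T := fun s => K ((1 / k : ℝ) * s) * B s)
    (C := C₁ + C₂ + C) (by positivity) (fun s => ?_) hL0
    (hKκ.mul hB) (fun s hs => ?_) hLB (fun t => ?_)
  · refine (hLb s (mem_univ s)).trans ?_
    gcongr
    linarith
  · rw [norm_mul]
    have hp : 0 < 1 / (s.re - 1 / 2) := one_div_pos.mpr (sub_pos.mpr hs)
    calc ‖K ((1 / k : ℝ) * s)‖ * ‖B s‖ ≤ (Real.exp (C * (1 + ‖s‖)) * (1 + 1 / (s.re - 1 / 2))) *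
          Real.exp (C₂ * (1 + ‖s‖)) :=
        mul_le_mul (hKκb s hs) (hBb s hs) (norm_nonneg _) (by positivity)
      _ = Real.exp ((C₂ + C) * (1 + ‖s‖)) * (1 + 1 / (s.re - 1 / 2)) := by
        rw [add_mul, Real.exp_add]
        ring
      _ ≤ _ := by
        gcongr
        linarith
  · have h1 : Tendsto (fun σ : ℝ => σ / k) (𝓝[>] (1 / 2)) (𝓝[>] (1 / (2 * k : ℝ))) := by
      refine tendsto_nhdsWithin_iff.mpr ⟨?_, ?_⟩
      · have : Continuous fun σ : ℝ => σ / k := by fun_prop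
        have h := (this.tendsto (1 / 2)).mono_left (nhdsWithin_le_nhds (s := Ioi (1 / 2)))
        rwa [div_div] at h
      · filter_upwards [self_mem_nhdsWithin] with σ hσ
        rw [mem_Ioi, ← div_div]
        exact div_lt_div_of_pos_right hσ hk0
    have h2 := ((hKlim (t / k)).comp h1).norm
    have h3 : Tendsto (fun σ : ℝ => k * Real.exp (C₂ * (1 + ‖(σ : ℂ) + t * I‖)))
        (𝓝[>] (1 / 2)) (𝓝 (k * Real.exp (C₂ * (1 + ‖((1 / 2 : ℝ) : ℂ) + t * I‖)))) := by
      have : Continuous fun σ : ℝ => (k : ℝ) * Real.exp (C₂ * (1 + ‖(σ : ℂ) + t * I‖)) := by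
        fun_prop
      exact (this.tendsto (1 / 2)).mono_left nhdsWithin_le_nhds
    have h4 := h2.mul h3
    rw [norm_zero, zero_mul] at h4
    refine squeeze_zero_norm' ?_ h4
    filter_upwards [self_mem_nhdsWithin] with σ hσ
    have h5 : ((1 / k : ℝ) : ℂ) * (σ + t * I) = ((σ / k : ℝ) : ℂ) + ((t / k : ℝ) : ℂ) * I := by
      push_cast
      ring
    have h6 : ((σ - 1 / 2 : ℝ) : ℂ) = k * ((σ / k - 1 / (2 * k) : ℝ) : ℂ) := by
      rw [← ofReal_natCast, ← ofReal_mul]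
      congr 1
      field_simp
    rw [h5, h6]
    simp only [Function.comp_apply, norm_mul, norm_natCast]
    have h7 := hBb (σ + t * I) (by simpa using hσ)
    calc _ = ‖((σ / k - 1 / (2 * k) : ℝ) : ℂ)‖ * ‖K (((σ / k : ℝ) : ℂ) + ((t / k : ℝ) : ℂ) * I)‖ *
          (k * ‖B (σ + t * I)‖) := by ring
      _ ≤ _ := by gcongr

end

end

section

open Complex Filter Topology Set MeasureTheory

lemma riemannZeta₁_eq_sub_mul {s : ℂ} (hs : s ≠ 1) : riemannZeta₁ s = (s - 1) * riemannZeta s := by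
  rw [riemannZeta_eq_inv_sub_mul hs, mul_inv_cancel_left₀ (sub_ne_zero.mpr hs)]

lemma measurable_sum_Icc_floor (f : ℕ → ℝ) :
    Measurable fun x : ℝ => ∑ n ∈ Finset.Icc 1 ⌊x⌋₊, f n :=
  (measurable_from_nat (f := fun N => ∑ n ∈ Finset.Icc 1 N, f n)).comp Nat.measurable_floor

lemma abs_sum_Icc_floor_le {f : ℕ → ℝ} (hf : ∀ n, n ≠ 0 → |f n| ≤ 1) {x : ℝ} (hx : 0 ≤ x) :
    |∑ n ∈ Finset.Icc 1 ⌊x⌋₊, f n| ≤ x :=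
  calc |∑ n ∈ Finset.Icc 1 ⌊x⌋₊, f n| ≤ ∑ n ∈ Finset.Icc 1 ⌊x⌋₊, |f n| :=
        Finset.abs_sum_le_sum_abs _ _
    _ ≤ ∑ n ∈ Finset.Icc 1 ⌊x⌋₊, (1 : ℝ) :=
        Finset.sum_le_sum fun n hn => hf n (by have := (Finset.mem_Icc.mp hn).1; omega)
    _ = ⌊x⌋₊ := by simp
    _ ≤ x := Nat.floor_le hx

lemma LSeries_eq_mul_mellinIoi {f : ℕ → ℝ} (hf : ∀ n, n ≠ 0 → |f n| ≤ 1) {s : ℂ} (hs : 1 < s.re) :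
    LSeries (fun n => (f n : ℂ)) s =
      s * mellinIoi (fun x => ∑ n ∈ Finset.Icc 1 ⌊x⌋₊, f n) s := by
  rw [LSeries_eq_mul_integral' _ zero_le_one hs]
  · simp only [mellinIoi, ofReal_sum]
  · refine Asymptotics.IsBigO.of_bound 1 (Eventually.of_forall fun n => ?_)
    have h1 := Finset.sum_le_sum (s := Finset.Icc 1 n) (f := fun k => ‖(f k : ℂ)‖) (g := fun _ => 1)
      fun k hk => by
        rw [norm_real]
        exact hf k (by have := (Finset.mem_Icc.mp hk).1; omega)
    rw [Finset.sum_const, Nat.card_Icc, Nat.add_sub_cancel, nsmul_eq_mul, mul_one] at h1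
    rw [Real.rpow_one, one_mul, Real.norm_of_nonneg (Finset.sum_nonneg fun _ _ => norm_nonneg _),
      Real.norm_natCast]
    exact h1

lemma abs_sub_sum_rpow_le {A : ℝ → ℝ} (hA : ∀ x, 1 < x → |A x| ≤ x) (c : ℕ → ℝ) {S : Finset ℕ}
    (hS : ∀ j ∈ S, 1 ≤ j) {x : ℝ} (hx : 1 < x) :
    |A x - ∑ j ∈ S, c j * x ^ (1 / (j : ℝ))| ≤ (1 + ∑ j ∈ S, |c j|) * x := by
  refine (abs_sub _ _).trans ?_
  rw [add_mul, one_mul, Finset.sum_mul]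
  refine add_le_add (hA x hx) ((Finset.abs_sum_le_sum_abs _ _).trans
    (Finset.sum_le_sum fun j hj => ?_))
  rw [abs_mul, abs_of_nonneg (Real.rpow_nonneg (by linarith) _)]
  refine mul_le_mul_of_nonneg_left ?_ (abs_nonneg _)
  refine (Real.rpow_le_rpow_of_exponent_le hx.le ?_).trans_eq (Real.rpow_one x)
  have : (1 : ℝ) ≤ j := by exact_mod_cast hS j hj
  rw [div_le_one (by linarith)]
  exact this

lemma mellinIoi_neg (E : ℝ → ℝ) (s : ℂ) : mellinIoi (fun x => -E x) s = -mellinIoi E s := by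
  simp only [mellinIoi, ofReal_neg, neg_mul, integral_neg]

/-- A continuation of the Mellin transform of a real function to a half-plane, small near the
boundary line, exists as soon as the function is one-sidedly small. -/
lemma exists_continuation_of_abs_oneSided {E : ℝ → ℝ} (hEm : Measurable E) {C : ℝ}
    (hE : ∀ x, 1 < x → |E x| ≤ C * x) {θ : ℝ} (hθ0 : 0 < θ) (hθ1 : θ < 1) {q : ℂ → ℂ}
    (hq : ∀ σ : ℝ, θ ≤ σ → AnalyticAt ℂ q σ) (hqE : ∀ s : ℂ, 1 < s.re → mellinIoi E s = q s)
    (hle : (∀ ε : ℝ, 0 < ε → ∀ᶠ x in atTop, E x ≤ ε * x ^ θ) ∨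
      ∀ ε : ℝ, 0 < ε → ∀ᶠ x in atTop, -(ε * x ^ θ) ≤ E x) :
    ∃ Y : ℂ → ℂ, DifferentiableOn ℂ Y {s | θ < s.re} ∧ (∀ s : ℂ, 1 < s.re → mellinIoi E s = Y s) ∧
      ∀ ε : ℝ, 0 < ε → ∃ C' : ℝ, 0 ≤ C' ∧ ∀ s : ℂ, θ < s.re → ‖Y s‖ ≤ ε / (s.re - θ) + C' := by
  rcases hle with hle | hle
  · obtain ⟨Y, hY, hYq, hYb⟩ := exists_continuation_of_oneSided hEm hE hθ0 hθ1 hq hqE hle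
    exact ⟨Y, hY, fun s hs => (hqE s hs).trans (hYq s hs).symm, hYb⟩
  · obtain ⟨Y, hY, hYq, hYb⟩ := exists_continuation_of_oneSided (E := fun x => -E x)
      (q := fun s => -q s) hEm.neg (by simpa only [abs_neg] using hE) hθ0 hθ1
      (fun σ hσ => (hq σ hσ).fun_neg) (fun s hs => by rw [mellinIoi_neg, hqE s hs])
      (fun ε hε => (hle ε hε).mono fun x hx => by linarith)
    refine ⟨fun s => -Y s, hY.fun_neg, fun s hs => ?_, by simpa only [norm_neg] using hYb⟩
    beta_reduce
    rw [hqE s hs, hYq s hs, neg_neg]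

lemma omegaPM_of_not_oneSided {E g : ℝ → ℝ}
    (h : ¬((∀ ε : ℝ, 0 < ε → ∀ᶠ x in atTop, E x ≤ ε * g x) ∨
      ∀ ε : ℝ, 0 < ε → ∀ᶠ x in atTop, -(ε * g x) ≤ E x)) : OmegaPM E g := by
  simp only [not_or, not_forall, exists_prop, eventually_atTop, not_exists, not_le] at h
  obtain ⟨⟨c, hc, h1⟩, d, hd, h2⟩ := h
  refine ⟨⟨c, hc, fun x₀ => ?_⟩, d, hd, fun x₀ => ?_⟩
  · obtain ⟨x, hx, hlt⟩ := h1 x₀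
    exact ⟨x, hx, hlt.le⟩
  · obtain ⟨x, hx, hlt⟩ := h2 x₀
    exact ⟨x, hx, hlt.le⟩

lemma riemannZeta₁_relation {k : ℕ} (hk : 1 ≤ k) {Jp Jm : Finset ℕ}
    (hJp : ∀ j ∈ Jp, 1 ≤ j) (hJm : ∀ j ∈ Jm, 1 ≤ j) {F g s : ℂ} (hs : 1 < s.re)
    (h : F * riemannZeta (k * s) * ∏ j ∈ Jm, riemannZeta (j * s) =
      g * ∏ j ∈ Jp, riemannZeta (j * s)) :
    F * riemannZeta₁ (k * s) * (∏ j ∈ Jm, riemannZeta₁ (j * s)) * ∏ j ∈ Jp, (j * s - 1) =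
      (k * s - 1) * (∏ j ∈ Jm, (j * s - 1)) * (∏ j ∈ Jp, riemannZeta₁ (j * s)) * g := by
  have hne : ∀ j : ℕ, 1 ≤ j → (j : ℂ) * s ≠ 1 := fun j hj h1 => by
    have := one_lt_re_natCast_mul hj hs
    rw [h1, one_re] at this
    exact lt_irrefl _ this
  have hprod : ∀ J : Finset ℕ, (∀ j ∈ J, 1 ≤ j) → ∏ j ∈ J, riemannZeta₁ (j * s) =
      (∏ j ∈ J, (j * s - 1)) * ∏ j ∈ J, riemannZeta (j * s) := fun J hJ => by
    rw [← Finset.prod_mul_distrib]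
    exact Finset.prod_congr rfl fun j hj => riemannZeta₁_eq_sub_mul (hne j (hJ j hj))
  rw [hprod Jp hJp, hprod Jm hJm, riemannZeta₁_eq_sub_mul (hne k hk)]
  linear_combination (k * s - 1) * (∏ j ∈ Jm, (j * s - 1)) * (∏ j ∈ Jp, (j * s - 1)) * h

end

/-- oscillations for Möbius-type fake μ's.
If `f` is a fake μ defined via `(ε_j)` with `ε_j = 0` for `1 ≤ j ≤ k-1` and
`ε_k = -1`, then there are real constants `c_j` for `k+1 ≤ j ≤ 2k`, with
`c_j = 0` whenever `ε_j ≠ 1`, such that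
`F_f(x) - Σ_{j=k+1}^{2k} c_j x^{1/j} = Ω_±(x^{1/(2k)})`. -/
theorem stmt_9 (f : ℕ → ℤ) (ε : ℕ → ℤ)
    (hf1 : f 1 = 1)
    (hmul : ∀ m n : ℕ, Nat.Coprime m n → f (m * n) = f m * f n)
    (hεval : ∀ j : ℕ, 1 ≤ j → ε j = -1 ∨ ε j = 0 ∨ ε j = 1)
    (hfp : ∀ p : ℕ, Nat.Prime p → ∀ j : ℕ, 1 ≤ j → f (p ^ j) = ε j)
    (k : ℕ) (hk : 1 ≤ k)
    (hzero : ∀ j : ℕ, 1 ≤ j → j ≤ k - 1 → ε j = 0)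
    (hεk : ε k = -1) :
    ∃ c : ℕ → ℝ,
      (∀ j : ℕ, k + 1 ≤ j → j ≤ 2 * k → ε j ≠ 1 → c j = 0) ∧
      OmegaPM
        (fun x : ℝ => (∑ n ∈ Finset.Icc 1 ⌊x⌋₊, (f n : ℝ)) -
          ∑ j ∈ Finset.Icc (k + 1) (2 * k), c j * x ^ (1 / (j : ℝ)))
        (fun x : ℝ => x ^ (1 / (2 * k : ℝ))) := by
  have hfb : ∀ n, n ≠ 0 → |(f n : ℝ)| ≤ 1 := fun n hn => by
    exact_mod_cast abs_le_one_of_multiplicative hf1 hmul hεval hfp hn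
  have hk0 : (0 : ℝ) < k := by exact_mod_cast hk
  have hAm := measurable_sum_Icc_floor fun n => (f n : ℝ)
  have hAb : ∀ x : ℝ, 1 < x → |∑ n ∈ Finset.Icc 1 ⌊x⌋₊, (f n : ℝ)| ≤ x := fun x hx =>
    abs_sum_Icc_floor_le hfb (by linarith)
  have hθ : 1 / ((2 * k + 1 : ℕ) : ℝ) < 1 / (2 * k : ℝ) := by
    push_cast
    gcongr
    linarith
  obtain ⟨g, hg, hgO, hgL⟩ := exists_eulerFactor hf1 hmul hεval hfp hk hzero hεk
  obtain ⟨G, L, T, hGd, hGprod, hL, hLb, hL0, hT, ⟨m, hm, hmT⟩, hGLT⟩ :=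
    exists_eulerProduct hg (by omega) hgO hθ
  set Jp := {j ∈ Finset.Icc (k + 1) (2 * k) | ε j = 1} with hJp
  set Jm := {j ∈ Finset.Icc (k + 1) (2 * k) | ε j = -1} with hJm
  have hJps : Jp ⊆ Finset.Icc (k + 1) (2 * k) := Finset.filter_subset _ _
  have hJms : Jm ⊆ Finset.Icc (k + 1) (2 * k) := Finset.filter_subset _ _
  have hIcc : ∀ j ∈ Finset.Icc (k + 1) (2 * k), 1 ≤ j := fun j hj => by
    have := (Finset.mem_Icc.mp hj).1
    omega
  have hrel : ∀ s : ℂ, 1 < s.re → _ := fun s hs =>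
    riemannZeta₁_relation hk (fun j hj => hIcc j (hJps hj)) (fun j hj => hIcc j (hJms hj)) hs
      (F := s * mellinIoi (fun x => ∑ n ∈ Finset.Icc 1 ⌊x⌋₊, (f n : ℝ)) s) (g := G s) (by
        rw [← LSeries_eq_mul_mellinIoi hfb hs]
        simp only [Complex.ofReal_intCast]
        refine hgL s (G s) hs (hGprod s (lt_of_le_of_lt ?_ hs))
        rw [div_le_one (by positivity)]
        exact_mod_cast Nat.le_add_left 1 (2 * k))
  obtain ⟨c, hc, q, hq, hqE⟩ := exists_main_terms hk hJps hJms hAm hAb hGd hrel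
  refine ⟨c, fun j _ _ hj => hc j fun h => hj (Finset.mem_filter.mp h).2,
    omegaPM_of_not_oneSided fun hle => ?_⟩
  have hEm : Measurable fun x : ℝ => (∑ n ∈ Finset.Icc 1 ⌊x⌋₊, (f n : ℝ)) -
      ∑ j ∈ Finset.Icc (k + 1) (2 * k), c j * x ^ (1 / (j : ℝ)) :=
    hAm.sub (Finset.measurable_fun_sum _ fun j _ => (measurable_id.pow_const _).const_mul _)
  obtain ⟨Y, hY, hYE, hYb⟩ := exists_continuation_of_abs_oneSided hEm
    (fun x hx => abs_sub_sum_rpow_le hAb c hIcc hx) (θ := 1 / (2 * k : ℝ)) (by positivity)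
    (by
      have : (1 : ℝ) ≤ k := by exact_mod_cast hk
      rw [div_lt_one (by positivity)]
      linarith)
    (fun σ hσ => hq σ (hθ.trans_le hσ)) hqE hle
  obtain ⟨K, hK, hKrel, hKb, hKlim⟩ := exists_numerator_continuation hk hJps hAm hAb
    (hGd.mono fun s hs => hθ.trans hs) hrel hc hY hYE hYb
  refine numerator_continuation_false hk hJps hJms (fun s hs => ?_) hL hLb hL0 hT hm hmT hK hKb
    hKlim
  rw [← hGLT s hs]
  exact hKrel s hs
end

section
/- Let f be a fake μ defined via the sequence (ε_j), and suppose there is an integer k ≥ 2 with ε_j = 0 for 1 ≤ j ≤ k−1 and ε_k = 1 (so f is of powerfull-type with initial index k). Then there exists a real constant c such that for every ε > 0 one has Σ_{n≤x} f(n) − c x^{1/k} ≪_ε x^{1/(k+1)+ε}. -/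
open Filter

open Finset

/-- A nonnegative multiplicative function is summable once its local Euler factors are bounded by
`1 + b p` with `b` summable. -/
lemma summable_of_tsum_prime_pow_le {h b : ℕ → ℝ} (h_nonneg : ∀ n, 0 ≤ h n) (h_zero : h 0 = 0)
    (h_one : h 1 = 1) (h_mul : ∀ m n, Nat.Coprime m n → h (m * n) = h m * h n)
    (h_sum : ∀ p : ℕ, p.Prime → Summable fun j : ℕ ↦ h (p ^ j))
    (b_nonneg : ∀ n, 0 ≤ b n) (b_sum : Summable b)
    (h_le : ∀ p : ℕ, p.Prime → ∑' j : ℕ, h (p ^ j) ≤ 1 + b p) : Summable h := by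
  refine summable_of_sum_le (c := Real.exp (∑' n, b n)) h_nonneg fun u ↦ ?_
  obtain ⟨N, hN⟩ := u.exists_nat_subset_range
  have hs := (EulerProduct.summable_and_hasSum_smoothNumbers_prod_primesBelow_tsum h_one
    (fun {m n} hc ↦ h_mul m n hc)
    (fun {p} hp ↦ by simpa only [Real.norm_of_nonneg (h_nonneg _)] using h_sum p hp) N).2
  have hs' := (hasSum_subtype_iff_indicator (f := h) (s := N.smoothNumbers)).1 hs
  calc ∑ n ∈ u, h n = ∑ n ∈ u, N.smoothNumbers.indicator h n := by
        refine Finset.sum_congr rfl fun n hn ↦ ?_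
        rcases Nat.eq_zero_or_pos n with rfl | hpos
        · rw [h_zero, Set.indicator_apply]; simp [h_zero]
        · rw [Set.indicator_of_mem]
          exact Nat.mem_smoothNumbers_of_lt hpos (Finset.mem_range.1 (hN hn))
    _ ≤ ∏ p ∈ N.primesBelow, ∑' j : ℕ, h (p ^ j) :=
        sum_le_hasSum u (fun n _ ↦ Set.indicator_nonneg (fun n _ ↦ h_nonneg n) n) hs'
    _ ≤ ∏ p ∈ N.primesBelow, (1 + b p) :=
        Finset.prod_le_prod (fun p _ ↦ tsum_nonneg fun _ ↦ h_nonneg _)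
          fun p hp ↦ h_le p (Nat.prime_of_mem_primesBelow hp)
    _ ≤ Real.exp (∑ p ∈ N.primesBelow, b p) :=
        Real.prod_one_add_le_exp_sum _ b_nonneg
    _ ≤ Real.exp (∑' n, b n) :=
        Real.exp_le_exp.2 (b_sum.sum_le_tsum _ fun n _ ↦ b_nonneg n)

/-- The arithmetic function `n ↦ ∏ p ∣ n, e (v_p n)`. -/
def ofExponents (e : ℕ → ℤ) : ArithmeticFunction ℤ :=
  ⟨fun n ↦ if n = 0 then 0 else n.factorization.prod fun _ j ↦ e j, by simp⟩

lemma ofExponents_apply (e : ℕ → ℤ) {n : ℕ} (hn : n ≠ 0) :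
    ofExponents e n = n.factorization.prod fun _ j ↦ e j := by
  simp [ofExponents, hn]

lemma isMultiplicative_ofExponents (e : ℕ → ℤ) : (ofExponents e).IsMultiplicative := by
  rw [ArithmeticFunction.IsMultiplicative.iff_ne_zero]
  refine ⟨by simp [ofExponents], fun {m n} hm hn hc ↦ ?_⟩
  rw [ofExponents_apply e hm, ofExponents_apply e hn, ofExponents_apply e (mul_ne_zero hm hn),
    Nat.factorization_mul hm hn,
    Finsupp.prod_add_index_of_disjoint (by simpa using hc.disjoint_primeFactors)]

lemma ofExponents_prime_pow {e : ℕ → ℤ} (he : e 0 = 1) {p : ℕ} (hp : p.Prime) (j : ℕ) :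
    ofExponents e (p ^ j) = e j := by
  rw [ofExponents_apply e (pow_ne_zero _ hp.ne_zero), hp.factorization_pow,
    Finsupp.prod_single_index he]

lemma ofExponents_eq {f : ℕ → ℤ} {e : ℕ → ℤ} (hf1 : f 1 = 1)
    (hmul : ∀ m n : ℕ, Nat.Coprime m n → f (m * n) = f m * f n)
    (hfp : ∀ p : ℕ, Nat.Prime p → ∀ j : ℕ, 1 ≤ j → f (p ^ j) = e j) {n : ℕ} (hn : n ≠ 0) :
    ofExponents e n = f n := by
  rw [ofExponents_apply e hn, Nat.multiplicative_factorization f hmul hf1 hn]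
  refine Finset.prod_congr rfl fun p hp ↦ ?_
  exact (hfp p (Nat.prime_of_mem_primeFactors hp) _
    (Nat.one_le_iff_ne_zero.2 (Finsupp.mem_support_iff.1 hp))).symm

open Classical in
/-- The indicator function of the positive `k`-th powers. -/
noncomputable def powIndicator (k : ℕ) : ArithmeticFunction ℤ :=
  ⟨fun n ↦ if n ≠ 0 ∧ ∃ m, m ^ k = n then 1 else 0, by simp⟩

open Classical in
lemma powIndicator_apply (k n : ℕ) :
    powIndicator k n = if n ≠ 0 ∧ ∃ m, m ^ k = n then 1 else 0 := rfl

lemma isMultiplicative_powIndicator (k : ℕ) : (powIndicator k).IsMultiplicative := by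
  rw [ArithmeticFunction.IsMultiplicative.iff_ne_zero]
  refine ⟨?_, fun {m n} hm hn hc ↦ ?_⟩
  · rw [powIndicator_apply, if_pos ⟨one_ne_zero, 1, one_pow k⟩]
  have key : (∃ c, c ^ k = m * n) ↔ (∃ c, c ^ k = m) ∧ ∃ c, c ^ k = n := by
    constructor
    · rintro ⟨c, h⟩
      obtain ⟨a, ha⟩ := exists_eq_pow_of_mul_eq_pow (Nat.isUnit_iff.2 hc) h.symm
      obtain ⟨b, hb⟩ := exists_eq_pow_of_mul_eq_pow (Nat.isUnit_iff.2 hc.symm)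
        ((mul_comm n m).trans h.symm)
      exact ⟨⟨a, ha.symm⟩, b, hb.symm⟩
    · rintro ⟨⟨a, rfl⟩, b, rfl⟩
      exact ⟨a * b, mul_pow a b k⟩
  simp only [powIndicator_apply, ne_eq, hm, hn, mul_eq_zero, or_self, not_false_eq_true, true_and,
    key]
  split_ifs <;> simp_all

lemma powIndicator_prime_pow (k : ℕ) {p : ℕ} (hp : p.Prime) (j : ℕ) :
    powIndicator k (p ^ j) = if k ∣ j then 1 else 0 := by
  have key : (∃ m, m ^ k = p ^ j) ↔ k ∣ j := by
    constructor
    · rintro ⟨m, h⟩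
      have := congrArg (fun n ↦ n.factorization p) h
      simp only [Nat.factorization_pow, Finsupp.smul_apply, hp.factorization_self, smul_eq_mul,
        mul_one] at this
      exact ⟨_, this.symm⟩
    · rintro ⟨i, rfl⟩
      exact ⟨p ^ i, by rw [← pow_mul, mul_comm]⟩
  simp [powIndicator_apply, hp.ne_zero, key]

/-- There are `⌊y ^ (1 / k)⌋` positive `k`-th powers up to `y`. -/
lemma sum_powIndicator {k : ℕ} (hk : k ≠ 0) {y : ℝ} (hy : 0 ≤ y) :
    ∑ m ∈ Ioc 0 ⌊y⌋₊, powIndicator k m = ⌊y ^ (1 / (k : ℝ))⌋₊ := by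
  classical
  have himage : (Ioc 0 ⌊y⌋₊).filter (fun n ↦ n ≠ 0 ∧ ∃ m, m ^ k = n) =
      (Ioc 0 ⌊y ^ (1 / (k : ℝ))⌋₊).image (· ^ k) := by
    have hle (m : ℕ) : m ≤ ⌊y ^ (1 / (k : ℝ))⌋₊ ↔ m ^ k ≤ ⌊y⌋₊ := by
      rw [Nat.le_floor_iff (by positivity), Nat.le_floor_iff hy, one_div,
        Real.le_rpow_inv_iff_of_pos (by positivity) hy (by positivity), Real.rpow_natCast,
        Nat.cast_pow]
    ext n
    simp only [mem_filter, mem_Ioc, mem_image, hle]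
    constructor
    · rintro ⟨⟨-, h⟩, hn, m, rfl⟩
      exact ⟨m, ⟨Nat.pos_of_ne_zero fun h0 ↦ hn (by simp [h0, hk]), h⟩, rfl⟩
    · rintro ⟨m, ⟨hm, h⟩, rfl⟩
      exact ⟨⟨by positivity, h⟩, by positivity, m, rfl⟩
  simp only [powIndicator_apply]
  rw [Finset.sum_boole, himage, Finset.card_image_of_injective _ (Nat.pow_left_injective hk)]
  simp

/-- Adding up the `k`-step differences of `E` along an arithmetic progression recovers `E`. -/
lemma sum_dvd_sub_shift (E : ℕ → ℤ) {k : ℕ} (hk : k ≠ 0) (j : ℕ) :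
    ∑ i ∈ range (j + 1), (E i - if k ≤ i then E (i - k) else 0) * (if k ∣ j - i then 1 else 0) =
      E j := by
  induction j using Nat.strong_induction_on with
  | _ j ih =>
    rw [Finset.sum_range_succ, Nat.sub_self, if_pos (dvd_zero k), mul_one]
    rcases lt_or_ge j k with hjk | hjk
    · rw [Finset.sum_eq_zero fun i hi ↦ ?_]
      · simp [hjk]
      · have hi' := mem_range.1 hi
        rw [if_neg (c := k ∣ j - i) (Nat.not_dvd_of_pos_of_lt (by omega) (by omega)), mul_zero]
    · have hshift : ∑ i ∈ range (j - k + 1),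
          (E i - if k ≤ i then E (i - k) else 0) * (if k ∣ j - i then 1 else 0) = E (j - k) := by
        rw [← ih (j - k) (by omega)]
        refine Finset.sum_congr rfl fun i hi ↦ ?_
        have hi' := mem_range.1 hi
        simp only [show j - i = j - k - i + k by omega, Nat.dvd_add_self_right]
      rw [if_pos hjk, ← Finset.sum_subset (s₁ := range (j - k + 1))]
      · rw [hshift, add_sub_cancel]
      · exact fun i hi ↦ by simp only [mem_range] at hi ⊢; omega
      · intro i hi hi'
        simp only [mem_range] at hi hi'
        rw [if_neg (c := k ∣ j - i) (Nat.not_dvd_of_pos_of_lt (by omega) (by omega)), mul_zero]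

lemma ofExponents_mul_powIndicator {E : ℕ → ℤ} (hE : E 0 = 1) {k : ℕ} (hk : k ≠ 0) :
    ofExponents (fun j ↦ E j - if k ≤ j then E (j - k) else 0) * powIndicator k =
      ofExponents E := by
  rw [ArithmeticFunction.IsMultiplicative.eq_iff_eq_on_prime_powers _
    ((isMultiplicative_ofExponents _).mul (isMultiplicative_powIndicator k)) _
    (isMultiplicative_ofExponents E)]
  intro p j hp
  rw [ArithmeticFunction.mul_apply,
    Nat.sum_divisorsAntidiagonal
      (fun a b ↦ ofExponents (fun j ↦ E j - if k ≤ j then E (j - k) else 0) a * powIndicator k b),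
    Nat.sum_divisors_prime_pow hp, ofExponents_prime_pow hE hp, ← sum_dvd_sub_shift E hk j]
  refine Finset.sum_congr rfl fun i hi ↦ ?_
  rw [ofExponents_prime_pow (by simp [hE, hk]) hp,
    Nat.pow_div (Nat.lt_succ_iff.1 (mem_range.1 hi)) hp.pos, powIndicator_prime_pow k hp]

/-- Bound for a local Euler factor whose coefficients vanish at `1, …, k`. -/
lemma tsum_abs_mul_pow_le {a : ℕ → ℝ} (ha0 : a 0 = 1) (ha : ∀ j, |a j| ≤ 2) {k : ℕ}
    (hak : ∀ j, 1 ≤ j → j ≤ k → a j = 0) {r q : ℝ} (hr : 0 ≤ r) (hrq : r ≤ q) (hq : q < 1) :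
    Summable (fun j : ℕ ↦ |a j| * r ^ j) ∧
      ∑' j : ℕ, |a j| * r ^ j ≤ 1 + 2 * (1 - q)⁻¹ * r ^ (k + 1) := by
  have hgeom := summable_geometric_of_lt_one hr (hrq.trans_lt hq)
  have hsum : Summable fun j : ℕ ↦ |a j| * r ^ j :=
    Summable.of_nonneg_of_le (fun j ↦ by positivity)
      (fun j ↦ mul_le_mul_of_nonneg_right (ha j) (by positivity)) (hgeom.mul_left 2)
  refine ⟨hsum, ?_⟩
  rw [← hsum.sum_add_tsum_nat_add (k + 1)]
  refine add_le_add (le_of_eq ?_) ?_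
  · rw [Finset.sum_range_succ', Finset.sum_eq_zero fun j hj ↦ ?_]
    · simp [ha0]
    · simp [hak (j + 1) (by omega) (by simpa using hj)]
  · have htail : Summable fun j : ℕ ↦ |a (j + (k + 1))| * r ^ (j + (k + 1)) :=
      (summable_nat_add_iff (f := fun j : ℕ ↦ |a j| * r ^ j) (k + 1)).2 hsum
    calc ∑' j : ℕ, |a (j + (k + 1))| * r ^ (j + (k + 1))
        ≤ ∑' j : ℕ, 2 * r ^ (k + 1) * r ^ j := by
          refine htail.tsum_le_tsum (fun j ↦ ?_) (hgeom.mul_left _)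
          rw [pow_add, mul_comm (r ^ j), mul_assoc]
          exact mul_le_mul_of_nonneg_right (ha _) (by positivity)
      _ = 2 * (1 - r)⁻¹ * r ^ (k + 1) := by
          rw [tsum_mul_left, tsum_geometric_of_lt_one hr (hrq.trans_lt hq)]
          ring
      _ ≤ 2 * (1 - q)⁻¹ * r ^ (k + 1) := by
          have : 0 < 1 - q := by linarith
          gcongr

/-- If `e` is bounded by `2` and vanishes at `1, …, k`, then the Dirichlet series of `ofExponents e`
converges absolutely to the right of `1 / (k + 1)`. -/
lemma summable_abs_ofExponents {e : ℕ → ℤ} (he0 : e 0 = 1) (he : ∀ j, |e j| ≤ 2) {k : ℕ}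
    (hek : ∀ j, 1 ≤ j → j ≤ k → e j = 0) {σ : ℝ} (hσ : 1 / ((k : ℝ) + 1) < σ) :
    Summable fun n : ℕ ↦ |(ofExponents e n : ℝ)| * (n : ℝ) ^ (-σ) := by
  have hσ0 : 0 < σ := lt_trans (by positivity) hσ
  have h2 : (2 : ℝ) ^ (-σ) < 1 := Real.rpow_lt_one_of_one_lt_of_neg (by norm_num) (by linarith)
  have hpow (p j : ℕ) : ((p ^ j : ℕ) : ℝ) ^ (-σ) = ((p : ℝ) ^ (-σ)) ^ j := by
    rw [Nat.cast_pow, ← Real.rpow_natCast, ← Real.rpow_natCast, ← Real.rpow_mul (by positivity),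
      ← Real.rpow_mul (by positivity), mul_comm]
  have hlocal (p : ℕ) (hp : p.Prime) :
      Summable (fun j : ℕ ↦ |(ofExponents e (p ^ j) : ℝ)| * ((p ^ j : ℕ) : ℝ) ^ (-σ)) ∧
      ∑' j : ℕ, |(ofExponents e (p ^ j) : ℝ)| * ((p ^ j : ℕ) : ℝ) ^ (-σ) ≤
        1 + 2 * (1 - (2 : ℝ) ^ (-σ))⁻¹ * (p : ℝ) ^ (-((k + 1) * σ)) := by
    have hr : (p : ℝ) ^ (-σ) ≤ 2 ^ (-σ) :=
      Real.rpow_le_rpow_of_nonpos (by norm_num) (by exact_mod_cast hp.two_le) (by linarith)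
    have hrk : (p : ℝ) ^ (-((k + 1) * σ)) = ((p : ℝ) ^ (-σ)) ^ (k + 1) := by
      rw [← Real.rpow_natCast, ← Real.rpow_mul (by positivity)]
      push_cast
      ring_nf
    simp only [ofExponents_prime_pow he0 hp, hpow, hrk]
    exact tsum_abs_mul_pow_le (a := fun j ↦ (e j : ℝ)) (by simp [he0])
      (fun j ↦ by exact_mod_cast he j) (fun j h1 h2 ↦ by simp [hek j h1 h2]) (by positivity) hr h2
  refine summable_of_tsum_prime_pow_le
    (b := fun n ↦ 2 * (1 - (2 : ℝ) ^ (-σ))⁻¹ * (n : ℝ) ^ (-((k + 1) * σ)))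
    (fun n ↦ by positivity) (by simp) (by simp [(isMultiplicative_ofExponents e).map_one])
    (fun m n hc ↦ ?_) (fun p hp ↦ (hlocal p hp).1) (fun n ↦ ?_) ?_ (fun p hp ↦ (hlocal p hp).2)
  · rw [(isMultiplicative_ofExponents e).map_mul_of_coprime hc, Int.cast_mul, abs_mul,
      Nat.cast_mul, Real.mul_rpow (by positivity) (by positivity)]
    ring
  · have : 0 < 1 - (2 : ℝ) ^ (-σ) := by linarith
    positivity
  · refine (Real.summable_nat_rpow.2 ?_).mul_left _
    rw [neg_lt_neg_iff]
    rwa [div_lt_iff₀' (by positivity)] at hσ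

/-- Replacing `⌊(x / d) ^ α⌋` by `(x / d) ^ α` in a weighted sum over `d ≤ x`, and completing the
sum, costs `O(x ^ σ)` when the Dirichlet series of the weights converges absolutely at `σ ≤ α`. -/
lemma abs_sum_mul_floor_sub_le {a : ℕ → ℝ} (ha0 : a 0 = 0) {σ α : ℝ} (hσ : 0 ≤ σ) (hσα : σ ≤ α)
    (ha : Summable fun n : ℕ ↦ |a n| * (n : ℝ) ^ (-σ)) {x : ℝ} (hx : 1 ≤ x) :
    |∑ d ∈ Ioc 0 ⌊x⌋₊, a d * ⌊(x / d) ^ α⌋₊ - (∑' d : ℕ, a d * (d : ℝ) ^ (-α)) * x ^ α| ≤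
      (∑' d : ℕ, |a d| * (d : ℝ) ^ (-σ)) * x ^ σ := by
  have hx0 : 0 < x := by linarith
  have hdiv {d : ℕ} (β : ℝ) : (d : ℝ) ^ (-β) * x ^ β = (x / d) ^ β := by
    rw [Real.div_rpow hx0.le (by positivity), Real.rpow_neg (by positivity)]
    ring
  have hα : Summable fun d : ℕ ↦ a d * (d : ℝ) ^ (-α) := by
    refine Summable.of_norm_bounded ha fun d ↦ ?_
    rcases Nat.eq_zero_or_pos d with rfl | hd
    · simp [ha0]
    rw [norm_mul, Real.norm_eq_abs, Real.norm_of_nonneg (by positivity)]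
    have : (1 : ℝ) ≤ d := by exact_mod_cast hd
    gcongr
  have hfin : HasSum (fun d : ℕ ↦ if d ∈ Ioc 0 ⌊x⌋₊ then a d * (⌊(x / d) ^ α⌋₊ : ℝ) else 0)
      (∑ d ∈ Ioc 0 ⌊x⌋₊, a d * ⌊(x / d) ^ α⌋₊) := by
    rw [← Finset.sum_filter_of_ne (p := (· ∈ Ioc 0 ⌊x⌋₊)) (fun d hd _ ↦ hd), Finset.sum_filter]
    exact hasSum_sum_of_ne_finset_zero fun d hd ↦ if_neg hd
  have hdiff := hfin.sub (hα.hasSum.mul_right (x ^ α))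
  rw [← hdiff.tsum_eq, ← tsum_mul_right, ← Real.norm_eq_abs]
  refine tsum_of_norm_bounded (ha.mul_right (x ^ σ)).hasSum fun d ↦ ?_
  rcases Nat.eq_zero_or_pos d with rfl | hd
  · simp [ha0]
  have hd' : (0 : ℝ) < d := by exact_mod_cast hd
  rw [mul_assoc, mul_assoc, hdiv, hdiv, Real.norm_eq_abs]
  split_ifs with hmem
  · rw [← mul_sub, abs_mul]
    refine mul_le_mul_of_nonneg_left ?_ (abs_nonneg _)
    have hdx : (d : ℝ) ≤ x := (Nat.le_floor_iff hx0.le).1 (mem_Ioc.1 hmem).2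
    have h1 : 1 ≤ (x / d) ^ σ := Real.one_le_rpow ((one_le_div hd').2 hdx) hσ
    have h2 := Nat.floor_le (a := (x / d) ^ α) (by positivity)
    have h3 := Nat.lt_floor_add_one ((x / d) ^ α)
    rw [abs_le]
    constructor <;> linarith
  · rw [zero_sub, abs_neg, abs_mul, abs_of_nonneg (a := (x / d) ^ α) (by positivity)]
    refine mul_le_mul_of_nonneg_left ?_ (abs_nonneg _)
    have hdx : x < d := by
      rw [← Nat.floor_lt hx0.le]
      by_contra! h
      exact hmem (mem_Ioc.2 ⟨hd, h⟩)
    exact Real.rpow_le_rpow_of_exponent_ge (by positivity) ((div_le_one hd').2 hdx.le) hσα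

/-- unconditional upper bound, powerfull-type.
If `f` is a fake μ defined via `(ε_j)` with `ε_j = 0` for `1 ≤ j ≤ k-1` and
`ε_k = 1` (where `k ≥ 2`), then there is a real constant `c` such that for
every `ε > 0` one has `Σ_{n ≤ x} f(n) - c x^{1/k} ≪_ε x^{1/(k+1)+ε}`. -/
theorem stmt_11 (f : ℕ → ℤ) (ε : ℕ → ℤ)
    (hf1 : f 1 = 1)
    (hmul : ∀ m n : ℕ, Nat.Coprime m n → f (m * n) = f m * f n)
    (hεval : ∀ j : ℕ, 1 ≤ j → ε j = -1 ∨ ε j = 0 ∨ ε j = 1)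
    (hfp : ∀ p : ℕ, Nat.Prime p → ∀ j : ℕ, 1 ≤ j → f (p ^ j) = ε j)
    (k : ℕ) (hk : 2 ≤ k)
    (hzero : ∀ j : ℕ, 1 ≤ j → j ≤ k - 1 → ε j = 0)
    (hεk : ε k = 1) :
    ∃ c : ℝ, ∀ ε' : ℝ, 0 < ε' → ∃ C : ℝ, ∀ᶠ x : ℝ in atTop,
      |(∑ n ∈ Finset.Icc 1 ⌊x⌋₊, (f n : ℝ)) - c * x ^ (1 / (k : ℝ))| ≤
        C * x ^ (1 / ((k : ℝ) + 1) + ε') := by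
  have hk0 : k ≠ 0 := by omega
  set E : ℕ → ℤ := fun j ↦ if j = 0 then 1 else ε j with hE
  set e : ℕ → ℤ := fun j ↦ E j - if k ≤ j then E (j - k) else 0 with he
  have hE0 : E 0 = 1 := rfl
  have hEpos {j : ℕ} (hj : 1 ≤ j) : E j = ε j := if_neg (by omega)
  have hEabs (j : ℕ) : |E j| ≤ 1 := by
    rcases Nat.eq_zero_or_pos j with rfl | hj
    · simp [hE0]
    · rw [hEpos hj]
      rcases hεval j hj with h | h | h <;> simp [h]
  have he0 : e 0 = 1 := by simp [he, hE0, hk0]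
  have heabs (j : ℕ) : |e j| ≤ 2 := by
    have h1 := hEabs j
    have h2 := hEabs (j - k)
    simp only [he]
    split_ifs
    · exact (abs_sub _ _).trans (by linarith)
    · rw [sub_zero]; linarith
  have hek (j : ℕ) (hj : 1 ≤ j) (hjk : j ≤ k) : e j = 0 := by
    simp only [he, hEpos hj]
    rcases hjk.lt_or_eq with h | rfl
    · simp [hzero j hj (by omega), h]
    · simp [hεk, hE0]
  have hsum (x : ℝ) (hx : 0 ≤ x) : ∑ n ∈ Icc 1 ⌊x⌋₊, (f n : ℝ) =
      ∑ d ∈ Ioc 0 ⌊x⌋₊, (ofExponents e d : ℝ) * ⌊(x / d) ^ (1 / (k : ℝ))⌋₊ := by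
    have h : ∑ n ∈ Icc 1 ⌊x⌋₊, f n =
        ∑ d ∈ Ioc 0 ⌊x⌋₊, ofExponents e d * ⌊(x / d) ^ (1 / (k : ℝ))⌋₊ := by
      calc ∑ n ∈ Icc 1 ⌊x⌋₊, f n = ∑ n ∈ Ioc 0 ⌊x⌋₊, (ofExponents e * powIndicator k) n := by
            rw [ofExponents_mul_powIndicator hE0 hk0]
            refine Finset.sum_congr rfl fun n hn ↦ (ofExponents_eq hf1 hmul ?_ ?_).symm
            · intro p hp j hj
              rw [hfp p hp j hj, hEpos hj]
            · have := (mem_Ioc.1 hn).1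
              omega
        _ = _ := by
            rw [ArithmeticFunction.sum_Ioc_mul_eq_sum_sum]
            refine Finset.sum_congr rfl fun d _ ↦ ?_
            rw [← Nat.floor_div_natCast, sum_powIndicator hk0 (by positivity)]
    exact_mod_cast congrArg (Int.cast : ℤ → ℝ) h
  refine ⟨∑' d : ℕ, (ofExponents e d : ℝ) * (d : ℝ) ^ (-(1 / (k : ℝ))), fun δ hδ ↦ ?_⟩
  set σ : ℝ := min (1 / (k : ℝ)) (1 / ((k : ℝ) + 1) + δ) with hσ
  have hσ1 : 1 / ((k : ℝ) + 1) < σ :=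
    lt_min (one_div_lt_one_div_of_lt (by positivity) (by linarith)) (by linarith)
  refine ⟨∑' d : ℕ, |(ofExponents e d : ℝ)| * (d : ℝ) ^ (-σ), ?_⟩
  filter_upwards [eventually_ge_atTop 1] with x hx
  rw [hsum x (by linarith)]
  refine (abs_sum_mul_floor_sub_le (by simp) (le_trans (by positivity) hσ1.le) (min_le_left _ _)
    (summable_abs_ofExponents he0 heabs hek hσ1) hx).trans ?_
  refine mul_le_mul_of_nonneg_left ?_ (tsum_nonneg fun d ↦ by positivity)
  exact Real.rpow_le_rpow_of_exponent_le hx (min_le_right _ _)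
end
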